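/- Quantitative inequality for narrow planar convex sets: let p ∈ (1,∞) and let m be a positive integer. There exist positive constants η₀ = η₀(p,m) and c = c(p,m) (given by explicit formulas) such that for every open bounded convex domain Ω ⊂ ℝ² with diameter D_Ω = 1, positioned so that the segment [0,1]×{0} is a diameter of Ω, with η_Ω ≤ η₀, and for every positive (1/m)-concave function φ on Ω, one has μ_p(Ω,φ) ≥ π_p^p + c·η_Ω². -/

import Mathlib

open MeasureTheory Set Filter Topology

/-- `π_p := 2π (p-1)^{1/p} / (p sin(π/p))`. -/
noncomputable def piP (p : ℝ) : ℝ :=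
  2 * Real.pi * (p - 1) ^ (1 / p) / (p * Real.sin (Real.pi / p))

/-- The first nontrivial Neumann `p`-Laplacian eigenvalue of `Ω` with weight `φ`. -/
noncomputable def muP (p : ℝ) {N : ℕ} (Ω : Set (EuclideanSpace ℝ (Fin N)))
    (φ : EuclideanSpace ℝ (Fin N) → ℝ) : ℝ :=
  sInf { r : ℝ | ∃ (u : EuclideanSpace ℝ (Fin N) → ℝ) (K : NNReal),
    LipschitzWith K u ∧
    ¬ (∀ᵐ x ∂(volume.restrict Ω), u x = 0) ∧
    (∫ x in Ω, φ x * |u x| ^ (p - 2) * u x) = 0 ∧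
    r = (∫ x in Ω, φ x * ‖fderiv ℝ u x‖ ^ p) / (∫ x in Ω, φ x * |u x| ^ p) }

/-- A positive function is `α`-concave on `Ω` if its `α`-th power is concave. -/
def IsAlphaConcaveOn {N : ℕ} (α : ℝ) (Ω : Set (EuclideanSpace ℝ (Fin N)))
    (φ : EuclideanSpace ℝ (Fin N) → ℝ) : Prop :=
  (∀ x ∈ Ω, 0 < φ x) ∧ ConcaveOn ℝ Ω fun x => φ x ^ α


/-- The maximal length of vertical chords of a planar set `Ω`:
`η_Ω := sup_x H¹({y : (x,y) ∈ Ω})`. -/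
noncomputable def etaOmega (Ω : Set (EuclideanSpace ℝ (Fin 2))) : ℝ :=
  ⨆ x : ℝ, (volume { y : ℝ | ∃ z ∈ Ω, z 0 = x ∧ z 1 = y }).toReal

theorem integrableOn_Ioi_inv_one_add_rpow {q : ℝ} (hq : 1 < q) :
    IntegrableOn (fun t : ℝ => (1 + t ^ q)⁻¹) (Ioi 0) := by
  have hpos : ∀ t : ℝ, 0 ≤ t → 0 < 1 + t ^ q := fun t ht => by positivity
  have hmeas : Measurable (fun t : ℝ => (1 + t ^ q)⁻¹) := by fun_prop
  rw [← Ioc_union_Ioi_eq_Ioi (zero_le_one' ℝ)]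
  refine IntegrableOn.union ?_ ?_
  · refine Integrable.mono' (g := fun _ => (1 : ℝ)) (integrable_const _)
      hmeas.aestronglyMeasurable ?_
    filter_upwards [ae_restrict_mem measurableSet_Ioc] with t ht
    rw [Real.norm_of_nonneg (inv_nonneg.2 (hpos t ht.1.le).le)]
    exact inv_le_one_of_one_le₀ (by have := Real.rpow_nonneg ht.1.le q; linarith)
  · refine Integrable.mono' (integrableOn_Ioi_rpow_of_lt (a := -q) (by linarith) one_pos)
      hmeas.aestronglyMeasurable ?_
    filter_upwards [ae_restrict_mem measurableSet_Ioi] with t ht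
    have ht0 : (0 : ℝ) < t := lt_trans one_pos ht
    rw [Real.norm_of_nonneg (inv_nonneg.2 (hpos t ht0.le).le), Real.rpow_neg ht0.le]
    exact inv_anti₀ (Real.rpow_pos_of_pos ht0 _) (by linarith)

theorem integral_Ioi_inv_one_add_rpow {q : ℝ} (hq : 1 < q) :
    ∫ t in Ioi (0 : ℝ), (1 + t ^ q)⁻¹ = Real.pi / q / Real.sin (Real.pi / q) := by
  have hq0 : 0 < q := by linarith
  have hinner : ∀ t ∈ Ioi (0 : ℝ),
      ∫ r in Ioi (0 : ℝ), Real.exp (-r) * Real.exp (-r * t ^ q) = (1 + t ^ q)⁻¹ := by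
    intro t ht
    have h1 : -(1 + t ^ q) < 0 := by have := Real.rpow_nonneg (le_of_lt ht) q; linarith
    have := integral_exp_mul_Ioi h1 0
    simp only [mul_zero, Real.exp_zero] at this
    rw [neg_div_neg_eq, one_div] at this
    rw [← this]
    refine setIntegral_congr_fun measurableSet_Ioi fun r _ => ?_
    rw [← Real.exp_add]; ring_nf
  have houter : ∀ r ∈ Ioi (0 : ℝ),
      ∫ t in Ioi (0 : ℝ), Real.exp (-r) * Real.exp (-r * t ^ q)
        = Real.Gamma (1 / q + 1) * (Real.exp (-r) * r ^ ((1 - 1 / q) - 1)) := by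
    intro r hr
    rw [integral_const_mul, integral_exp_neg_mul_rpow hq0 hr]
    rw [show (1 - 1 / q) - 1 = -1 / q by ring]; ring
  have hInt : Integrable (Function.uncurry fun t r : ℝ => Real.exp (-r) * Real.exp (-r * t ^ q))
      ((volume.restrict (Ioi 0)).prod (volume.restrict (Ioi 0))) := by
    rw [integrable_prod_iff]
    · constructor
      · filter_upwards [ae_restrict_mem measurableSet_Ioi] with t ht
        by_contra hcon
        have h1 := hinner t ht
        simp only [Function.uncurry] at hcon
        rw [integral_undef hcon] at h1
        have : 0 < (1 + t ^ q)⁻¹ := by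
          have := Real.rpow_nonneg (le_of_lt ht) q; positivity
        linarith
      · refine (integrableOn_Ioi_inv_one_add_rpow hq).congr ?_
        filter_upwards [ae_restrict_mem measurableSet_Ioi] with t ht
        rw [← hinner t ht]
        refine integral_congr_ae (Eventually.of_forall fun r => ?_)
        simp only [Function.uncurry]
        rw [Real.norm_of_nonneg (by positivity)]
    · refine Measurable.aestronglyMeasurable ?_
      unfold Function.uncurry
      fun_prop
  have hswap := integral_integral_swap hInt
  rw [setIntegral_congr_fun measurableSet_Ioi hinner,
    setIntegral_congr_fun measurableSet_Ioi houter, integral_const_mul] at hswap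
  have hlt : 1 / q < 1 := by rw [div_lt_one hq0]; exact hq
  rw [hswap, ← Real.Gamma_eq_integral (by linarith), Real.Gamma_add_one (by positivity), mul_assoc,
    Real.Gamma_mul_Gamma_one_sub]
  rw [show Real.pi * (1 / q) = Real.pi / q by ring]
  ring

theorem piP_pos {p : ℝ} (hp : 1 < p) : 0 < piP p := by
  have hp0 : 0 < p := by linarith
  have hs : 0 < Real.sin (Real.pi / p) := by
    apply Real.sin_pos_of_pos_of_lt_pi (by positivity)
    rw [div_lt_iff₀ hp0]; nlinarith [Real.pi_pos]
  have : 0 < p - 1 := by linarith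
  unfold piP; positivity

/-- Half of the time that the Riccati flow `θ' = Λ + (p - 1) θ ^ q` needs to blow up. -/
theorem tendsto_riccati_time {p Λ : ℝ} (hp : 1 < p) (hΛ : 0 < Λ) :
    Tendsto (fun S : ℝ => 2 * ∫ t in (0 : ℝ)..S, (Λ + (p - 1) * t ^ (p / (p - 1)))⁻¹) atTop
      (𝓝 (piP p * Λ ^ (-(1 / p)))) := by
  set q := p / (p - 1) with hqdef
  have hp1 : 0 < p - 1 := by linarith
  have hp0 : 0 < p := by linarith
  have hq : 1 < q := by rw [hqdef, lt_div_iff₀ hp1]; linarith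
  have hq0 : 0 < q := by linarith
  have hpq : 1 / q = 1 - 1 / p := by rw [hqdef]; field_simp
  set b := ((p - 1) / Λ) ^ (1 / q) with hb
  have hb0 : 0 < b := by positivity
  have hbq : b ^ q = (p - 1) / Λ := by
    rw [hb, ← Real.rpow_mul (by positivity), one_div_mul_cancel hq0.ne', Real.rpow_one]
  have hfun : ∀ t ∈ Ioi (0 : ℝ), (Λ + (p - 1) * t ^ q)⁻¹ = Λ⁻¹ * (1 + (b * t) ^ q)⁻¹ := by
    intro t ht
    rw [Real.mul_rpow hb0.le (le_of_lt ht), hbq, ← mul_inv]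
    congr 1; field_simp
  have hI : IntegrableOn (fun t => (Λ + (p - 1) * t ^ q)⁻¹) (Ioi 0) := by
    refine IntegrableOn.congr_fun ?_ (fun t ht => (hfun t ht).symm) measurableSet_Ioi
    refine Integrable.const_mul ?_ _
    have := (integrableOn_Ioi_comp_mul_left_iff (fun t : ℝ => (1 + t ^ q)⁻¹) 0 hb0).2
      (by simpa using integrableOn_Ioi_inv_one_add_rpow hq)
    exact this
  have hval : 2 * ∫ t in Ioi (0 : ℝ), (Λ + (p - 1) * t ^ q)⁻¹ = piP p * Λ ^ (-(1 / p)) := by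
    rw [setIntegral_congr_fun measurableSet_Ioi hfun, integral_const_mul,
      integral_comp_mul_left_Ioi (fun t : ℝ => (1 + t ^ q)⁻¹) 0 hb0, mul_zero,
      integral_Ioi_inv_one_add_rpow hq]
    have hsin : Real.sin (Real.pi / q) = Real.sin (Real.pi / p) := by
      rw [div_eq_mul_one_div Real.pi q, hpq, mul_sub, mul_one, Real.sin_pi_sub,
        ← div_eq_mul_one_div]
    have hs : 0 < Real.sin (Real.pi / p) := by
      apply Real.sin_pos_of_pos_of_lt_pi (by positivity)
      rw [div_lt_iff₀ hp0]; nlinarith [Real.pi_pos]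
    have hbinv : b⁻¹ = (p - 1) ^ (1 / p) / (p - 1) * (Λ * Λ ^ (-(1 / p))) := by
      rw [hb, hpq, Real.rpow_sub (by positivity), Real.rpow_one, Real.div_rpow hp1.le hΛ.le,
        Real.rpow_neg hΛ.le]
      have h1 : 0 < (p - 1) ^ (1 / p) := by positivity
      have h2 : 0 < Λ ^ (1 / p) := by positivity
      field_simp
    rw [hsin, smul_eq_mul, hbinv, piP, hqdef]
    field_simp
  rw [← hval]
  exact (intervalIntegral_tendsto_integral_Ioi 0 hI tendsto_id).const_mul 2

theorem exists_superlevel_ae_eq_Ioo {m : ℝ → ℝ} (hm : Monotone m) {c : ℝ} (hc : 0 ≤ c) (t : ℝ) :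
    ∃ a ∈ Icc 0 c, ({x | t < m x} ∩ Ioo 0 c : Set ℝ) =ᵐ[volume] Ioo a c := by
  set S : Set ℝ := ({x | t < m x} ∩ Ioo 0 c) ∪ {c} with hS
  have hbdd : BddBelow S := ⟨0, by rintro x (⟨_, hx⟩ | rfl); exacts [hx.1.le, hc]⟩
  have hne : S.Nonempty := ⟨c, Or.inr rfl⟩
  refine ⟨sInf S, ⟨le_csInf hne ?_, csInf_le hbdd (Or.inr rfl)⟩, ?_⟩
  · rintro x (⟨_, hx⟩ | rfl); exacts [hx.1.le, hc]
  · have h1 : Ioo (sInf S) c ⊆ {x | t < m x} ∩ Ioo 0 c := by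
      intro x hx
      obtain ⟨y, hy, hyx⟩ := exists_lt_of_csInf_lt hne hx.1
      rcases hy with ⟨hy, hy0⟩ | rfl
      · exact ⟨lt_of_lt_of_le hy (hm hyx.le), hy0.1.trans hyx, hx.2⟩
      · exact absurd hyx (not_lt.2 hx.2.le)
    have h2 : {x | t < m x} ∩ Ioo 0 c ⊆ Ico (sInf S) c := fun x hx =>
      ⟨csInf_le hbdd (Or.inl hx), hx.2.2⟩
    exact (LE.le.eventuallyLE h2 |>.trans Ioo_ae_eq_Ico.symm.le).antisymm
      (LE.le.eventuallyLE h1)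

theorem integral_monotone_mul_deriv_nonpos {m f f' : ℝ → ℝ} {c C : ℝ} (hc : 0 ≤ c)
    (hm : Monotone m) (hm0 : ∀ x, 0 ≤ m x) (hmC : ∀ x, m x ≤ C)
    (hf : ∀ x, HasDerivAt f (f' x) x) (hf' : Continuous f')
    (hf0 : ∀ x ∈ Icc 0 c, 0 ≤ f x) (hfc : f c = 0) :
    ∫ x in Ioo 0 c, m x * f' x ≤ 0 := by
  have hlayer : ∀ x, m x = ∫ t in Ioo 0 C, ({y : ℝ × ℝ | y.2 < m y.1}.indicator 1 (x, t) : ℝ) := by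
    intro x
    have : (fun t => ({y : ℝ × ℝ | y.2 < m y.1}.indicator 1 (x, t) : ℝ))
        = (Iio (m x)).indicator 1 := by
      ext t; simp [indicator]
    rw [this, integral_indicator_one measurableSet_Iio, measureReal_restrict_apply measurableSet_Iio]
    have : Iio (m x) ∩ Ioo 0 C = Ioo 0 (m x) := by
      ext t; simp only [mem_inter_iff, mem_Iio, mem_Ioo]
      constructor
      · rintro ⟨h1, h2, -⟩; exact ⟨h2, h1⟩
      · rintro ⟨h1, h2⟩; exact ⟨h2, h1, h2.trans_le (hmC x)⟩
    rw [this]; simp [hm0 x]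
  have hmeasS : MeasurableSet {y : ℝ × ℝ | y.2 < m y.1} :=
    measurableSet_lt measurable_snd (hm.measurable.comp measurable_fst)
  have hInt : Integrable (Function.uncurry fun x t : ℝ =>
      ({y : ℝ × ℝ | y.2 < m y.1}.indicator 1 (x, t) : ℝ) * f' x)
      ((volume.restrict (Ioo 0 c)).prod (volume.restrict (Ioo 0 C))) := by
    obtain ⟨K, hK⟩ := isCompact_Icc.exists_bound_of_continuousOn (hf'.continuousOn (s := Icc 0 c))
    refine Integrable.mono' (g := fun _ => K) (integrable_const _) ?_ ?_
    · refine Measurable.aestronglyMeasurable ?_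
      refine Measurable.mul ?_ (hf'.measurable.comp measurable_fst)
      exact measurable_one.indicator hmeasS
    · rw [Measure.prod_restrict]
      filter_upwards [ae_restrict_mem (measurableSet_Ioo.prod measurableSet_Ioo)] with z hz
      have h1 := hK z.1 ⟨hz.1.1.le, hz.1.2.le⟩
      simp only [Function.uncurry, indicator, Pi.one_apply]
      split_ifs
      · simpa using h1
      · simpa using (norm_nonneg _).trans h1
  have : ∫ x in Ioo 0 c, m x * f' x = ∫ x in Ioo 0 c, ∫ t in Ioo 0 C,
      ({y : ℝ × ℝ | y.2 < m y.1}.indicator 1 (x, t) : ℝ) * f' x := by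
    refine setIntegral_congr_fun measurableSet_Ioo fun x _ => ?_
    rw [integral_mul_const, ← hlayer]
  rw [this, integral_integral_swap hInt]
  refine integral_nonpos fun t => ?_
  have h2 : (fun x => ({y : ℝ × ℝ | y.2 < m y.1}.indicator 1 (x, t) : ℝ) * f' x)
      = {x | t < m x}.indicator f' := by
    ext x; simp [indicator]
  simp only [h2]
  obtain ⟨a, ha, hae⟩ := exists_superlevel_ae_eq_Ioo hm hc t
  rw [integral_indicator (measurableSet_lt measurable_const hm.measurable),
    Measure.restrict_restrict (measurableSet_lt measurable_const hm.measurable),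
    setIntegral_congr_set hae, ← integral_Ioc_eq_integral_Ioo,
    ← intervalIntegral.integral_of_le ha.2,
    intervalIntegral.integral_eq_sub_of_hasDerivAt (fun x _ => hf x) (hf'.intervalIntegrable _ _),
    hfc]
  simpa using hf0 a ha

/-- The signed power `|t| ^ (p - 2) * t`. -/
noncomputable def sgnPow (p t : ℝ) : ℝ := |t| ^ (p - 2) * t

theorem hasDerivAt_abs_rpow_sgnPow {p : ℝ} (hp : 1 < p) (t : ℝ) :
    HasDerivAt (fun t : ℝ => |t| ^ p) (p * sgnPow p t) t := by
  simpa only [sgnPow, mul_assoc] using hasDerivAt_abs_rpow t hp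

theorem continuous_sgnPow {p : ℝ} (hp : 1 < p) : Continuous (sgnPow p) := by
  have h1 : ContDiff ℝ 1 (fun t : ℝ => |t| ^ p) := contDiff_norm_rpow hp
  have h2 := h1.continuous_deriv le_rfl
  have h3 : deriv (fun t : ℝ => |t| ^ p) = fun t => p * sgnPow p t :=
    funext fun t => (hasDerivAt_abs_rpow_sgnPow hp t).deriv
  rw [h3] at h2
  have h4 : sgnPow p = fun t => p⁻¹ * (p * sgnPow p t) := by
    ext t; field_simp
  rw [h4]; exact continuous_const.mul h2

theorem abs_sgnPow {p : ℝ} (t : ℝ) (hp : 1 < p) : |sgnPow p t| = |t| ^ (p - 1) := by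
  rcases eq_or_ne t 0 with rfl | ht
  · simp [sgnPow, Real.zero_rpow (by linarith : p - 1 ≠ 0)]
  · rw [sgnPow, abs_mul, abs_of_nonneg (by positivity : 0 ≤ |t| ^ (p - 2))]
    nth_rw 2 [← Real.rpow_one |t|]
    rw [← Real.rpow_add (abs_pos.2 ht)]; ring_nf

theorem young_sgnPow {p : ℝ} (hp : 1 < p) {θ : ℝ} (hθ : 0 ≤ θ) (a b : ℝ) :
    -(p * θ * sgnPow p a * b) ≤ |b| ^ p + (p - 1) * θ ^ (p / (p - 1)) * |a| ^ p := by
  have hp1 : 0 < p - 1 := by linarith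
  have hp0 : 0 < p := by linarith
  have hconj : p.HolderConjugate (p / (p - 1)) := Real.HolderConjugate.conjExponent hp
  have hy := Real.young_inequality_of_nonneg (abs_nonneg b)
    (by positivity : 0 ≤ θ * |a| ^ (p - 1)) hconj
  rw [Real.mul_rpow hθ (by positivity), ← Real.rpow_mul (abs_nonneg a),
    show (p - 1) * (p / (p - 1)) = p by field_simp] at hy
  have h1 : -(p * θ * sgnPow p a * b) ≤ p * (|b| * (θ * |a| ^ (p - 1))) := by
    refine (neg_le_abs _).trans (le_of_eq ?_)
    rw [abs_mul, abs_mul, abs_sgnPow a hp, abs_of_nonneg (by positivity : 0 ≤ p * θ)]; ring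
  refine h1.trans ?_
  calc p * (|b| * (θ * |a| ^ (p - 1)))
      ≤ p * (|b| ^ p / p + θ ^ (p / (p - 1)) * |a| ^ p / (p / (p - 1))) := by gcongr
    _ = _ := by field_simp

theorem integral_left_le {p Λ c C : ℝ} (hp : 1 < p) (hc : 0 ≤ c)
    {h ω ω' θ θ' v v' : ℝ → ℝ}
    (hω : ∀ x, HasDerivAt ω (ω' x) x) (hω' : Continuous ω') (hω0 : ∀ x, 0 < ω x)
    (hmono : MonotoneOn (fun x => h x / ω x) (Ioo 0 c))
    (hh0 : ∀ x ∈ Ioo 0 c, 0 ≤ h x) (hhC : ∀ x ∈ Ioo 0 c, h x ≤ C)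
    (hθ : ∀ x, HasDerivAt θ (θ' x) x) (hθ' : Continuous θ') (hθ0 : ∀ x ∈ Icc 0 c, 0 ≤ θ x)
    (hric : ∀ x ∈ Ioo 0 c,
      Λ * ω x + (p - 1) * θ x ^ (p / (p - 1)) * ω x ≤ ω' x * θ x + ω x * θ' x)
    (hv : ∀ x, HasDerivAt v (v' x) x) (hv' : Continuous v') (hvc : v c = 0) :
    Λ * ∫ x in Ioo 0 c, h x * |v x| ^ p ≤ ∫ x in Ioo 0 c, h x * |v' x| ^ p := by
  have hωc : Continuous ω := continuous_iff_continuousAt.2 fun x => (hω x).continuousAt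
  have hθc : Continuous θ := continuous_iff_continuousAt.2 fun x => (hθ x).continuousAt
  have hvc' : Continuous v := continuous_iff_continuousAt.2 fun x => (hv x).continuousAt
  have hp0 : 0 ≤ p := by linarith
  obtain ⟨x₀, -, hx₀⟩ := isCompact_Icc.exists_isMinOn (nonempty_Icc.2 hc)
    (hωc.continuousOn (s := Icc 0 c))
  have hdiv : ∀ x ∈ Ioo 0 c, h x / ω x ≤ |C| / ω x₀ := fun x hx =>
    div_le_div₀ (abs_nonneg _) ((hhC x hx).trans (le_abs_self C)) (hω0 _)
      (hx₀ ⟨hx.1.le, hx.2.le⟩)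
  have hdiv0 : ∀ x ∈ Ioo 0 c, 0 ≤ h x / ω x := fun x hx => div_nonneg (hh0 x hx) (hω0 x).le
  obtain ⟨m₀, hm₀, hm₀e⟩ := hmono.exists_monotone_extension
    ⟨0, by rintro _ ⟨x, hx, rfl⟩; exact hdiv0 x hx⟩
    ⟨|C| / ω x₀, by rintro _ ⟨x, hx, rfl⟩; exact hdiv x hx⟩
  set m : ℝ → ℝ := fun x => max 0 (min (|C| / ω x₀) (m₀ x)) with hmdef
  have hm : Monotone m := fun x y hxy => max_le_max le_rfl (min_le_min le_rfl (hm₀ hxy))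
  have hme : ∀ x ∈ Ioo 0 c, m x * ω x = h x := by
    intro x hx
    have : m x = h x / ω x := by
      simp only [hmdef, ← hm₀e hx]
      rw [min_eq_right (hdiv x hx), max_eq_right (hdiv0 x hx)]
    rw [this, div_mul_cancel₀ _ (hω0 x).ne']
  set f' : ℝ → ℝ := fun x => (ω' x * θ x + ω x * θ' x) * |v x| ^ p
    + ω x * θ x * (p * sgnPow p (v x) * v' x) with hf'def
  have hJ := continuous_sgnPow hp
  have habs : Continuous fun t : ℝ => |t| ^ p := continuous_abs.rpow_const fun _ => Or.inr hp0
  have hvp : Continuous fun x => |v x| ^ p := habs.comp hvc'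
  have hv'p : Continuous fun x => |v' x| ^ p := habs.comp hv'
  have hf'c : Continuous f' := by
    have := hJ.comp hvc'
    simp only [Function.comp_def] at this
    fun_prop
  have hkey := integral_monotone_mul_deriv_nonpos hc hm (C := max 0 (|C| / ω x₀))
    (f := fun x => ω x * θ x * |v x| ^ p) (f' := f') (fun x => le_max_left _ _)
    (fun x => max_le_max le_rfl (min_le_left _ _))
    (fun x => ((hω x).mul (hθ x)).mul ((hasDerivAt_abs_rpow_sgnPow hp (v x)).comp x (hv x)))
    hf'c (fun x hx => by have := hω0 x; have := hθ0 x hx; positivity)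
    (by simp [hvc, Real.zero_rpow (by linarith : p ≠ 0)])
  have hInt : ∀ g : ℝ → ℝ, Continuous g → IntegrableOn (fun x => m x * g x) (Ioo 0 c) := by
    intro g hg
    refine Integrable.bdd_mul (c := max 0 (|C| / ω x₀)) ?_ hm.measurable.aestronglyMeasurable ?_
    · exact (hg.integrableOn_Icc).mono_set Ioo_subset_Icc_self
    · refine Eventually.of_forall fun x => ?_
      rw [Real.norm_of_nonneg (le_max_left _ _)]
      exact max_le_max le_rfl (min_le_left _ _)
  have e : ∀ g : ℝ → ℝ, ∫ x in Ioo 0 c, h x * g x = ∫ x in Ioo 0 c, m x * (ω x * g x) := fun g =>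
    setIntegral_congr_fun measurableSet_Ioo fun x hx => by
      rw [← mul_assoc, hme x hx]
  rw [e, e, ← integral_const_mul]
  calc ∫ x in Ioo 0 c, Λ * (m x * (ω x * |v x| ^ p))
      ≤ ∫ x in Ioo 0 c, (m x * f' x + m x * (ω x * |v' x| ^ p)) := by
        refine setIntegral_mono_on ((hInt _ (by fun_prop)).const_mul _)
          ((hInt _ hf'c).add (hInt _ (by fun_prop))) measurableSet_Ioo fun x hx => ?_
        have hm0 : 0 ≤ m x := le_max_left _ _
        have h1 := young_sgnPow hp (hθ0 x ⟨hx.1.le, hx.2.le⟩) (v x) (v' x)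
        have h2 := mul_le_mul_of_nonneg_right (hric x hx) (by positivity : 0 ≤ |v x| ^ p)
        have h3 := mul_le_mul_of_nonneg_left h1 (hω0 x).le
        rw [← mul_add, mul_left_comm]
        refine mul_le_mul_of_nonneg_left ?_ hm0
        simp only [hf'def]
        nlinarith [h2, h3]
    _ = (∫ x in Ioo 0 c, m x * f' x) + ∫ x in Ioo 0 c, m x * (ω x * |v' x| ^ p) :=
        integral_add (hInt _ hf'c) (hInt _ (by fun_prop))
    _ ≤ _ := by linarith

theorem exists_ode_solution {F : ℝ → ℝ} {S : ℝ} (hS : 0 ≤ S) (hF : ContinuousOn F (Icc 0 S))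
    (hF0 : ∀ t ∈ Icc 0 S, 0 < F t) :
    ∃ θ θ' : ℝ → ℝ, (∀ x, HasDerivAt θ (θ' x) x) ∧ Continuous θ' ∧ StrictMono θ ∧
      (∀ s ∈ Icc 0 S, θ (∫ t in (0 : ℝ)..s, (F t)⁻¹) = s) ∧
      (∀ x, θ x ∈ Icc 0 S → θ' x = F (θ x)) := by
  set cl : ℝ → ℝ := fun t => max 0 (min S t) with hcl
  have hclm : ∀ t, cl t ∈ Icc 0 S := fun t =>
    ⟨le_max_left _ _, max_le hS (min_le_left _ _)⟩
  have hcle : ∀ t ∈ Icc 0 S, cl t = t := fun t ht => by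
    simp only [hcl]; rw [min_eq_right ht.2, max_eq_right ht.1]
  have hclc : Continuous cl := by fun_prop
  set G : ℝ → ℝ := fun t => (F (cl t))⁻¹ with hG
  have hG0 : ∀ t, 0 < G t := fun t => inv_pos.2 (hF0 _ (hclm t))
  have hGc : Continuous G := (hF.comp_continuous hclc hclm).inv₀ fun t => (hF0 _ (hclm t)).ne'
  set X : ℝ → ℝ := fun s => ∫ t in (0 : ℝ)..s, G t with hX
  have hXd : ∀ s, HasDerivAt X (G s) s := fun s =>
    intervalIntegral.integral_hasDerivAt_right (hGc.intervalIntegrable _ _)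
      (hGc.stronglyMeasurableAtFilter _ _) hGc.continuousAt
  have hXc : Continuous X := continuous_iff_continuousAt.2 fun x => (hXd x).continuousAt
  have hXm : StrictMono X := strictMono_of_deriv_pos fun s => by
    rw [(hXd s).deriv]; exact hG0 s
  obtain ⟨t₀, ht₀, hmin⟩ := isCompact_Icc.exists_isMinOn (nonempty_Icc.2 hS)
    (hGc.continuousOn (s := Icc 0 S))
  have hmin' : ∀ t, G t₀ ≤ G t := fun t => by
    have h1 : G (cl t) = G t := by simp only [hG]; rw [hcle _ (hclm t)]
    rw [← h1]; exact hmin (hclm t)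
  have hlin : ∀ s r, s ≤ r → G t₀ * (r - s) ≤ X r - X s := by
    intro s r hsr
    have : X r - X s = ∫ t in s..r, G t :=
      intervalIntegral.integral_interval_sub_left (hGc.intervalIntegrable _ _)
        (hGc.intervalIntegrable _ _)
    rw [this]
    have h2 := intervalIntegral.integral_mono_on hsr (f := fun _ => G t₀)
      (intervalIntegrable_const (μ := volume)) (hGc.intervalIntegrable _ _) (fun t _ => hmin' t)
    rw [intervalIntegral.integral_const, smul_eq_mul] at h2
    linarith
  have hsurj : Function.Surjective X := by
    refine hXc.surjective ?_ ?_
    · refine tendsto_atTop_mono' _ ?_ (tendsto_id.const_mul_atTop (hG0 t₀))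
      filter_upwards [eventually_ge_atTop 0] with r hr
      have := hlin 0 r hr
      simp only [hX, intervalIntegral.integral_same] at this ⊢
      simpa using this
    · refine tendsto_atBot_mono' _ ?_ (tendsto_id.const_mul_atBot (hG0 t₀))
      filter_upwards [eventually_le_atBot 0] with r hr
      have := hlin r 0 hr
      simp only [hX, intervalIntegral.integral_same] at this ⊢
      simp only [id]; linarith
  set e := hXm.orderIsoOfSurjective X hsurj with he
  have hec : Continuous e.symm := e.symm.continuous
  have hXe : ∀ x, X (e.symm x) = x := fun x => e.apply_symm_apply x
  refine ⟨e.symm, fun x => (G (e.symm x))⁻¹, fun x => ?_, ?_, e.symm.strictMono, ?_, ?_⟩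
  · exact HasDerivAt.of_local_left_inverse hec.continuousAt (hXd _) (hG0 _).ne'
      (Eventually.of_forall hXe)
  · exact (hGc.comp hec).inv₀ fun x => (hG0 _).ne'
  · intro s hs
    have : ∫ t in (0 : ℝ)..s, (F t)⁻¹ = X s := by
      refine intervalIntegral.integral_congr fun t ht => ?_
      rw [uIcc_of_le hs.1] at ht
      simp only [hG]; rw [hcle t ⟨ht.1, ht.2.trans hs.2⟩]
    rw [this]; exact e.symm_apply_apply s
  · intro x hx
    simp only [hG, inv_inv]; rw [hcle _ hx]

/-- A bounded positive log-concave weight on the unit interval. -/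
structure IsLogConcaveWeight (h : ℝ → ℝ) : Prop where
  pos : ∀ x ∈ Ioo (0 : ℝ) 1, 0 < h x
  concave : ConcaveOn ℝ (Ioo 0 1) fun x => Real.log (h x)
  bdd : ∃ C, ∀ x ∈ Ioo (0 : ℝ) 1, h x ≤ C

/-- The one-sided Poincaré inequality on `(0, c)` for functions normalised at `c`. -/
def LeftIneq (p Λ c : ℝ) (h : ℝ → ℝ) : Prop :=
  ∀ v v' : ℝ → ℝ, (∀ x, HasDerivAt v (v' x) x) → Continuous v' →
    Λ * ∫ x in (0 : ℝ)..c, h x * |v x - v c| ^ p ≤ ∫ x in (0 : ℝ)..c, h x * |v' x| ^ p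

/-- The one-sided Poincaré inequality on `(c, 1)` for functions normalised at `c`. -/
def RightIneq (p Λ c : ℝ) (h : ℝ → ℝ) : Prop :=
  ∀ v v' : ℝ → ℝ, (∀ x, HasDerivAt v (v' x) x) → Continuous v' →
    Λ * ∫ x in c..(1 : ℝ), h x * |v x - v c| ^ p ≤ ∫ x in c..(1 : ℝ), h x * |v' x| ^ p

theorem rightIneq_of_leftIneq {p Λ c : ℝ} {h : ℝ → ℝ}
    (H : LeftIneq p Λ (1 - c) fun x => h (1 - x)) : RightIneq p Λ c h := by
  intro v v' hv hv'
  have := H (fun x => v (1 - x)) (fun x => -v' (1 - x))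
    (fun x => by
      simpa [Function.comp_def] using (hv (1 - x)).comp x ((hasDerivAt_id x).const_sub 1))
    (by fun_prop)
  have e1 := intervalIntegral.integral_comp_sub_left (a := 0) (b := 1 - c)
    (fun x => h x * |v x - v c| ^ p) 1
  have e2 := intervalIntegral.integral_comp_sub_left (a := 0) (b := 1 - c)
    (fun x => h x * |v' x| ^ p) 1
  simp only [sub_sub_cancel, sub_zero, abs_neg] at this e1 e2
  rwa [e1, e2] at this

theorem IsLogConcaveWeight.reflect {h : ℝ → ℝ} (hh : IsLogConcaveWeight h) :
    IsLogConcaveWeight fun x => h (1 - x) := by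
  have hm : ∀ x ∈ Ioo (0 : ℝ) 1, 1 - x ∈ Ioo (0 : ℝ) 1 := fun x hx =>
    ⟨by linarith [hx.2], by linarith [hx.1]⟩
  refine ⟨fun x hx => hh.pos _ (hm x hx), ⟨convex_Ioo _ _, ?_⟩, ?_⟩
  · intro x hx y hy a b ha hb hab
    have := hh.concave.2 (hm x hx) (hm y hy) ha hb hab
    simp only [smul_eq_mul] at this ⊢
    rwa [show 1 - (a * x + b * y) = a * (1 - x) + b * (1 - y) by linear_combination -hab]
  · obtain ⟨C, hC⟩ := hh.bdd
    exact ⟨C, fun x hx => hC _ (hm x hx)⟩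

theorem IsLogConcaveWeight.continuousOn {h : ℝ → ℝ} (hh : IsLogConcaveWeight h) :
    ContinuousOn h (Ioo 0 1) := by
  have h1 := hh.concave.continuousOn isOpen_Ioo
  refine (h1.rexp).congr fun x hx => ?_
  simp only [Real.exp_log (hh.pos x hx)]

theorem IsLogConcaveWeight.integrableOn {h : ℝ → ℝ} (hh : IsLogConcaveWeight h) {g : ℝ → ℝ}
    (hg : Continuous g) : IntegrableOn (fun x => h x * g x) (Ioo 0 1) := by
  obtain ⟨C, hC⟩ := hh.bdd
  refine Integrable.bdd_mul (c := C) (hg.integrableOn_Icc.mono_set Ioo_subset_Icc_self)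
    (hh.continuousOn.aestronglyMeasurable measurableSet_Ioo) ?_
  filter_upwards [ae_restrict_mem measurableSet_Ioo] with x hx
  rw [Real.norm_of_nonneg (hh.pos x hx).le]; exact hC x hx

theorem IsLogConcaveWeight.intervalIntegrable {h : ℝ → ℝ} (hh : IsLogConcaveWeight h) {g : ℝ → ℝ}
    (hg : Continuous g) {a b : ℝ} (ha : a ∈ Icc (0 : ℝ) 1) (hb : b ∈ Icc (0 : ℝ) 1) :
    IntervalIntegrable (fun x => h x * g x) volume a b := by
  have : IntervalIntegrable (fun x => h x * g x) volume 0 1 :=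
    (intervalIntegrable_iff_integrableOn_Ioo_of_le zero_le_one).2 (hh.integrableOn hg)
  refine this.mono_set ?_
  rw [uIcc_of_le zero_le_one]
  exact uIcc_subset_Icc ha hb

/-- The two primitives entering the one-sided inequalities depend continuously on the endpoint. -/
theorem IsLogConcaveWeight.continuousOn_integral {h : ℝ → ℝ} (hh : IsLogConcaveWeight h)
    {p : ℝ} (hp : 1 < p) {v : ℝ → ℝ} (hv : Continuous v) :
    ContinuousOn (fun c => ∫ x in (0 : ℝ)..c, h x * |v x - v c| ^ p) (Icc 0 1) := by
  obtain ⟨C, hC⟩ := hh.bdd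
  obtain ⟨K, hK⟩ := isCompact_Icc.exists_bound_of_continuousOn (hv.continuousOn (s := Icc 0 1))
  have hp0 : 0 ≤ p := by linarith
  have hcon : ∀ c, Continuous fun x => |v x - v c| ^ p := fun c =>
    ((hv.sub continuous_const).abs).rpow_const fun _ => Or.inr hp0
  have heq : EqOn (fun c => ∫ x in (0 : ℝ)..c, h x * |v x - v c| ^ p)
      (fun c => ∫ x in Ioo (0 : ℝ) 1, (Ioo 0 c).indicator (fun x => h x * |v x - v c| ^ p) x)
      (Icc 0 1) := by
    intro c hc
    simp only
    rw [intervalIntegral.integral_of_le hc.1, integral_Ioc_eq_integral_Ioo,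
      setIntegral_indicator measurableSet_Ioo]
    congr 2
    exact (inter_eq_right.2 (Ioo_subset_Ioo_right hc.2)).symm
  refine ContinuousOn.congr ?_ heq
  intro c₀ hc₀
  refine tendsto_integral_filter_of_dominated_convergence (fun _ => |C| * (2 * K) ^ p) ?_ ?_
    (integrable_const _) ?_
  · filter_upwards [self_mem_nhdsWithin] with c hc
    exact ((hh.integrableOn (hcon c)).aestronglyMeasurable).indicator measurableSet_Ioo
  · filter_upwards [self_mem_nhdsWithin] with c hc
    filter_upwards [ae_restrict_mem measurableSet_Ioo] with x hx
    refine (norm_indicator_le_norm_self _ _).trans ?_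
    rw [norm_mul, Real.norm_of_nonneg (hh.pos x hx).le, Real.norm_of_nonneg (by positivity)]
    have h1 := hK x ⟨hx.1.le, hx.2.le⟩
    have h2 := hK c hc
    rw [Real.norm_eq_abs] at h1 h2
    gcongr
    · exact (hC x hx).trans (le_abs_self C)
    · exact (abs_sub _ _).trans (by linarith)
  · have hne : ∀ᵐ x : ℝ, x ≠ c₀ := by simp [ae_iff]
    filter_upwards [ae_restrict_of_ae hne, ae_restrict_mem measurableSet_Ioo] with x hx hx1
    have hlim : Tendsto (fun c => h x * |v x - v c| ^ p) (𝓝[Icc 0 1] c₀)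
        (𝓝 (h x * |v x - v c₀| ^ p)) := by
      refine Tendsto.mono_left (Continuous.tendsto ?_ c₀) nhdsWithin_le_nhds
      exact continuous_const.mul (((continuous_const.sub hv).abs).rpow_const fun _ => Or.inr hp0)
    rcases lt_or_gt_of_ne hx with hlt | hgt
    · rw [indicator_of_mem (show x ∈ Ioo 0 c₀ from ⟨hx1.1, hlt⟩)]
      refine hlim.congr' ?_
      filter_upwards [mem_nhdsWithin_of_mem_nhds (Ioi_mem_nhds hlt)] with c hc
      rw [indicator_of_mem (show x ∈ Ioo 0 c from ⟨hx1.1, hc⟩)]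
    · rw [indicator_of_notMem (show x ∉ Ioo 0 c₀ from fun h => absurd h.2 (not_lt.2 hgt.le))]
      refine tendsto_const_nhds.congr' ?_
      filter_upwards [mem_nhdsWithin_of_mem_nhds (Iio_mem_nhds hgt)] with c hc
      rw [indicator_of_notMem
        (show x ∉ Ioo 0 c from fun h => absurd h.2 (not_lt.2 (le_of_lt hc)))]

theorem isClosed_leftIneq {p Λ : ℝ} (hp : 1 < p) {h : ℝ → ℝ} (hh : IsLogConcaveWeight h) :
    IsClosed {c | c ∈ Icc (0 : ℝ) 1 ∧ LeftIneq p Λ c h} := by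
  have hp0 : 0 ≤ p := by linarith
  have : {c | c ∈ Icc (0 : ℝ) 1 ∧ LeftIneq p Λ c h} = Icc (0 : ℝ) 1 ∩ ⋂ (v : ℝ → ℝ) (v' : ℝ → ℝ)
      (_ : ∀ x, HasDerivAt v (v' x) x) (_ : Continuous v'), {c | c ∈ Icc (0 : ℝ) 1 ∧
        Λ * ∫ x in (0 : ℝ)..c, h x * |v x - v c| ^ p ≤ ∫ x in (0 : ℝ)..c, h x * |v' x| ^ p} := by
    ext c
    simp only [mem_ofPred_eq, LeftIneq, mem_inter_iff, mem_iInter]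
    constructor
    · rintro ⟨h1, h2⟩; exact ⟨h1, fun v v' a b => ⟨h1, h2 v v' a b⟩⟩
    · rintro ⟨h1, h2⟩; exact ⟨h1, fun v v' a b => (h2 v v' a b).2⟩
  rw [this]
  refine isClosed_Icc.inter (isClosed_iInter fun v => isClosed_iInter fun v' =>
    isClosed_iInter fun hv => isClosed_iInter fun hv' => ?_)
  have hvc : Continuous v := continuous_iff_continuousAt.2 fun x => (hv x).continuousAt
  refine IsClosed.isClosed_le isClosed_Icc
    (continuousOn_const.mul (hh.continuousOn_integral hp hvc)) ?_
  have hInt := hh.intervalIntegrable (g := fun x => |v' x| ^ p)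
    (hv'.abs.rpow_const fun _ => Or.inr hp0) (left_mem_Icc.2 zero_le_one)
    (right_mem_Icc.2 zero_le_one)
  have := intervalIntegral.continuousOn_primitive_interval'
    hInt left_mem_uIcc
  rwa [uIcc_of_le zero_le_one] at this

theorem exists_poincare_of_cover {p Λ : ℝ} (hp : 1 < p) {h : ℝ → ℝ} (hh : IsLogConcaveWeight h)
    (H : ∀ c ∈ Ioo (0 : ℝ) 1, LeftIneq p Λ c h ∨ LeftIneq p Λ (1 - c) fun x => h (1 - x))
    {v v' : ℝ → ℝ} (hv : ∀ x, HasDerivAt v (v' x) x) (hv' : Continuous v') :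
    ∃ c ∈ Icc (0 : ℝ) 1, Λ * ∫ x in (0 : ℝ)..1, h x * |v x - v c| ^ p ≤ ∫ x in (0 : ℝ)..1, h x * |v' x| ^ p := by
  have hvc : Continuous v := continuous_iff_continuousAt.2 fun x => (hv x).continuousAt
  have hp0 : 0 ≤ p := by linarith
  have h0 : ∀ h, LeftIneq p Λ 0 h := fun h v v' _ _ => by simp
  have hA := isClosed_leftIneq (Λ := Λ) hp hh
  have hB := (isClosed_leftIneq (Λ := Λ) hp hh.reflect).preimage
    (f := fun c : ℝ => 1 - c) (by fun_prop)
  obtain ⟨c, hc, ⟨-, hcA⟩, ⟨-, hcB⟩⟩ := isPreconnected_closed_iff.1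
    (isPreconnected_Icc (a := (0 : ℝ)) (b := 1)) _ _ hA hB (by
      intro c hc
      rcases eq_or_lt_of_le hc.1 with rfl | h1
      · exact Or.inl ⟨hc, h0 _⟩
      rcases eq_or_lt_of_le hc.2 with rfl | h2
      · exact Or.inr ⟨by simp, by simpa using h0 _⟩
      rcases H c ⟨h1, h2⟩ with h3 | h3
      · exact Or.inl ⟨hc, h3⟩
      · exact Or.inr ⟨⟨by linarith, by linarith⟩, h3⟩)
    ⟨0, by simp, by simp, h0 _⟩ ⟨1, by simp, ⟨by simp, by simpa using h0 _⟩⟩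
  refine ⟨c, hc, ?_⟩
  have h1 := hcA v v' hv hv'
  have h2 := rightIneq_of_leftIneq hcB v v' hv hv'
  have l : (0 : ℝ) ∈ Icc (0 : ℝ) 1 := by simp
  have r : (1 : ℝ) ∈ Icc (0 : ℝ) 1 := by simp
  have g1 : Continuous fun x => |v x - v c| ^ p :=
    ((hvc.sub continuous_const).abs).rpow_const fun _ => Or.inr hp0
  have g2 : Continuous fun x => |v' x| ^ p := hv'.abs.rpow_const fun _ => Or.inr hp0
  rw [← intervalIntegral.integral_add_adjacent_intervals
    (hh.intervalIntegrable g1 l hc) (hh.intervalIntegrable g1 hc r),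
    ← intervalIntegral.integral_add_adjacent_intervals
    (hh.intervalIntegrable g2 l hc) (hh.intervalIntegrable g2 hc r)]
  linarith

theorem leftIneq_of_supersolution {p Λ c : ℝ} (hp : 1 < p) (hc : c ∈ Ioc (0 : ℝ) 1)
    {h : ℝ → ℝ} (hh : IsLogConcaveWeight h) {κ θ θ' : ℝ → ℝ} (hκ : Continuous κ)
    (hmono : ∀ x y, 0 < x → x ≤ y → y < c →
      ∫ t in x..y, κ t ≤ Real.log (h y) - Real.log (h x))
    (hθ : ∀ x, HasDerivAt θ (θ' x) x) (hθ' : Continuous θ') (hθ0 : ∀ x ∈ Icc 0 c, 0 ≤ θ x)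
    (hric : ∀ x ∈ Ioo 0 c, Λ - κ x * θ x + (p - 1) * θ x ^ (p / (p - 1)) ≤ θ' x) :
    LeftIneq p Λ c h := by
  intro v v' hv hv'
  obtain ⟨C, hC⟩ := hh.bdd
  have hsub : Ioo 0 c ⊆ Ioo 0 1 := Ioo_subset_Ioo_right hc.2
  have hκd : ∀ x, HasDerivAt (fun x => ∫ t in (0 : ℝ)..x, κ t) (κ x) x := fun x =>
    intervalIntegral.integral_hasDerivAt_right (hκ.intervalIntegrable _ _)
      (hκ.stronglyMeasurableAtFilter _ _) hκ.continuousAt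
  have hκc : Continuous fun x => ∫ t in (0 : ℝ)..x, κ t :=
    continuous_iff_continuousAt.2 fun x => (hκd x).continuousAt
  rw [intervalIntegral.integral_of_le hc.1.le, intervalIntegral.integral_of_le hc.1.le,
    integral_Ioc_eq_integral_Ioo, integral_Ioc_eq_integral_Ioo]
  refine integral_left_le hp hc.1.le (C := C) (ω := fun x => Real.exp (∫ t in (0 : ℝ)..x, κ t))
    (fun x => (hκd x).exp) (by fun_prop) (fun x => Real.exp_pos _) ?_
    (fun x hx => (hh.pos x (hsub hx)).le) (fun x hx => hC x (hsub hx)) hθ hθ' hθ0 ?_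
    (fun x => (hv x).sub_const (v c)) hv' (sub_self _)
  · intro x hx y hy hxy
    have h1 := hmono x y hx.1 hxy hy.2
    rw [← intervalIntegral.integral_interval_sub_left (hκ.intervalIntegrable 0 _)
        (hκ.intervalIntegrable _ _)] at h1
    simp only
    rw [div_le_div_iff₀ (Real.exp_pos _) (Real.exp_pos _)]
    rw [← Real.exp_log (hh.pos x (hsub hx)), ← Real.exp_log (hh.pos y (hsub hy)),
      ← Real.exp_add, ← Real.exp_add, Real.exp_le_exp]
    linarith
  · intro x hx
    have := mul_le_mul_of_nonneg_left (hric x hx) (Real.exp_pos (∫ t in (0 : ℝ)..x, κ t)).le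
    nlinarith

theorem ConcaveOn.exists_supergradient {f : ℝ → ℝ} (hf : ConcaveOn ℝ (Ioo 0 1) f) {c : ℝ}
    (hc : c ∈ Ioo (0 : ℝ) 1) :
    ∃ k, (∀ x y, 0 < x → x ≤ y → y ≤ c → k * (y - x) ≤ f y - f x) ∧
      ∀ x y, c ≤ x → x ≤ y → y < 1 → f y - f x ≤ k * (y - x) := by
  have hg := hf.neg
  have hci : c ∈ interior (Ioo (0 : ℝ) 1) := by rwa [interior_Ioo]
  set k := -derivWithin (-f) (Ioi c) c with hk
  have hr : ∀ y, c < y → y < 1 → f y - f c ≤ k * (y - c) := by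
    intro y hy hy1
    have := hg.rightDeriv_le_slope_of_mem_interior hci ⟨hc.1.trans hy, hy1⟩ hy
    rw [slope_def_field, le_div_iff₀ (by linarith)] at this
    simp only [Pi.neg_apply] at this
    rw [hk]; linarith
  have hl : ∀ x, 0 < x → x < c → k * (c - x) ≤ f c - f x := by
    intro x hx0 hx
    have h1 := hg.slope_le_leftDeriv_of_mem_interior ⟨hx0, hx.trans hc.2⟩ hci hx
    have h2 := h1.trans (hg.leftDeriv_le_rightDeriv_of_mem_interior hci)
    rw [slope_def_field, div_le_iff₀ (by linarith)] at h2
    simp only [Pi.neg_apply] at h2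
    rw [hk]; linarith
  refine ⟨k, fun x y hx hxy hyc => ?_, fun x y hcx hxy hy => ?_⟩
  · rcases eq_or_lt_of_le hxy with rfl | hxy
    · simp
    rcases eq_or_lt_of_le hyc with rfl | hyc
    · exact hl x hx hxy
    have h1 := hf.slope_anti_adjacent ⟨hx, hxy.trans (hyc.trans hc.2)⟩ hc hxy hyc
    have h2 := hl y (hx.trans hxy) hyc
    rw [← le_div_iff₀ (by linarith)] at h2 ⊢
    exact h2.trans h1
  · rcases eq_or_lt_of_le hxy with rfl | hxy
    · simp
    rcases eq_or_lt_of_le hcx with rfl | hcx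
    · exact hr y hxy hy
    have h1 := hf.slope_anti_adjacent hc ⟨hc.1.trans (hcx.trans hxy), hy⟩ hcx hxy
    have h2 := hr x hcx (hxy.trans hy)
    rw [← div_le_iff₀ (by linarith)] at h2 ⊢
    exact h1.trans h2

/-- The right-hand side of the Riccati equation with drift `k`. -/
noncomputable def riccati (p Λ k t : ℝ) : ℝ := Λ - k * t + (p - 1) * t ^ (p / (p - 1))

theorem continuous_riccati {p : ℝ} (hp : 1 < p) (Λ k : ℝ) : Continuous (riccati p Λ k) := by
  have hp1 : 0 < p - 1 := by linarith
  have : Continuous fun t : ℝ => t ^ (p / (p - 1)) :=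
    continuous_id.rpow_const fun _ => Or.inr (by positivity)
  unfold riccati; fun_prop

/-- If the inequality on `(0, c)` fails, the Riccati flow with drift `k` is positive and its
blow-up time is at most `c`. -/
theorem riccati_of_not_leftIneq {p Λ c k : ℝ} (hp : 1 < p) (hc : c ∈ Ioc (0 : ℝ) 1)
    {h : ℝ → ℝ} (hh : IsLogConcaveWeight h)
    (hk : ∀ x y, 0 < x → x ≤ y → y ≤ c → k * (y - x) ≤ Real.log (h y) - Real.log (h x))
    (hneg : ¬ LeftIneq p Λ c h) :
    (∀ t, 0 ≤ t → 0 < riccati p Λ k t) ∧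
      ∀ S, 0 ≤ S → ∫ t in (0 : ℝ)..S, (riccati p Λ k t)⁻¹ < c := by
  have hmono : ∀ x y, 0 < x → x ≤ y → y < c →
      ∫ _ in x..y, k ≤ Real.log (h y) - Real.log (h x) := by
    intro x y hx hxy hy
    rw [intervalIntegral.integral_const, smul_eq_mul, mul_comm]
    exact hk x y hx hxy hy.le
  have hpos : ∀ t, 0 ≤ t → 0 < riccati p Λ k t := by
    intro t ht
    by_contra hcon
    refine hneg (leftIneq_of_supersolution hp hc hh (κ := fun _ => k) (θ := fun _ => t)
      (θ' := fun _ => 0) continuous_const hmono (fun x => hasDerivAt_const x t) continuous_const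
      (fun _ _ => ht) fun x _ => not_lt.1 hcon)
  refine ⟨hpos, fun S hS => ?_⟩
  by_contra hcon
  rw [not_lt] at hcon
  obtain ⟨θ, θ', hθ, hθ', hmon, hval, hode⟩ := exists_ode_solution hS
    (continuous_riccati hp Λ k).continuousOn fun t ht => hpos t ht.1
  have h0 : θ 0 = 0 := by simpa using hval 0 ⟨le_rfl, hS⟩
  have hrange : ∀ x ∈ Icc 0 c, θ x ∈ Icc 0 S := fun x hx =>
    ⟨by rw [← h0]; exact hmon.monotone hx.1,
     by rw [← hval S ⟨hS, le_rfl⟩]; exact hmon.monotone (hx.2.trans hcon)⟩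
  refine hneg (leftIneq_of_supersolution hp hc hh (κ := fun _ => k) continuous_const hmono hθ hθ'
    (fun x hx => (hrange x hx).1) fun x hx => ?_)
  rw [hode x (hrange x ⟨hx.1.le, hx.2.le⟩)]; exact le_rfl

theorem riccati_zero_pos {p Λ : ℝ} (hp : 1 < p) (hΛ : 0 < Λ) {t : ℝ} (ht : 0 ≤ t) :
    0 < riccati p Λ 0 t := by
  have : 0 < p - 1 := by linarith
  have := Real.rpow_nonneg ht (p / (p - 1))
  unfold riccati; simp only [zero_mul, sub_zero]; positivity

theorem tendsto_riccati_zero {p Λ : ℝ} (hp : 1 < p) (hΛ : 0 < Λ) :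
    Tendsto (fun S : ℝ => 2 * ∫ t in (0 : ℝ)..S, (riccati p Λ 0 t)⁻¹) atTop
      (𝓝 (piP p * Λ ^ (-(1 / p)))) := by
  simpa [riccati] using tendsto_riccati_time hp hΛ

theorem intervalIntegrable_inv_riccati {p Λ k : ℝ} (hp : 1 < p)
    (h : ∀ t, 0 ≤ t → 0 < riccati p Λ k t) {a b : ℝ} (ha : 0 ≤ a) (hb : 0 ≤ b) :
    IntervalIntegrable (fun t => (riccati p Λ k t)⁻¹) volume a b := by
  refine ContinuousOn.intervalIntegrable ?_
  refine ((continuous_riccati hp Λ k).continuousOn).inv₀ fun t ht => (h t ?_).ne'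
  exact (le_inf ha hb).trans ht.1

theorem reflect_slope {h : ℝ → ℝ} {c k : ℝ}
    (hk : ∀ x y, c ≤ x → x ≤ y → y < 1 → Real.log (h y) - Real.log (h x) ≤ k * (y - x)) :
    ∀ x y, 0 < x → x ≤ y → y ≤ 1 - c →
      -k * (y - x) ≤ Real.log (h (1 - y)) - Real.log (h (1 - x)) := by
  intro x y hx hxy hy
  have := hk (1 - y) (1 - x) (by linarith) (by linarith) (by linarith)
  linarith

theorem riccati_time_le_of_not_leftIneq {p Λ c k k₀ : ℝ} (hp : 1 < p) (hΛ : 0 < Λ)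
    (hc : c ∈ Ioo (0 : ℝ) 1) {h : ℝ → ℝ} (hh : IsLogConcaveWeight h)
    (hkl : ∀ x y, 0 < x → x ≤ y → y ≤ c → k * (y - x) ≤ Real.log (h y) - Real.log (h x))
    (hkr : ∀ x y, c ≤ x → x ≤ y → y < 1 → Real.log (h y) - Real.log (h x) ≤ k * (y - x))
    (hl : ¬ LeftIneq p Λ c h) (hr : ¬ LeftIneq p Λ (1 - c) fun x => h (1 - x))
    (hk₀ : 0 ≤ k₀) (hkk : k₀ ≤ |k|) :
    piP p * Λ ^ (-(1 / p)) + 2 * k₀ ^ 2 / (3 * (Λ + (p - 1)) ^ 3) ≤ 1 := by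
  have hp1 : 0 < p - 1 := by linarith
  obtain ⟨hF1, hT1⟩ := riccati_of_not_leftIneq hp ⟨hc.1, hc.2.le⟩ hh hkl hl
  obtain ⟨hF2, hT2⟩ := riccati_of_not_leftIneq hp ⟨by linarith [hc.2], by linarith [hc.1]⟩
    hh.reflect (reflect_slope hkr) hr
  have hF0 : ∀ t, 0 ≤ t → 0 < riccati p Λ 0 t := fun t ht => riccati_zero_pos hp hΛ ht
  set H : ℝ → ℝ := fun t => (riccati p Λ k t)⁻¹ + (riccati p Λ (-k) t)⁻¹
    - 2 * (riccati p Λ 0 t)⁻¹ with hH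
  have hHint : ∀ a b : ℝ, 0 ≤ a → 0 ≤ b → IntervalIntegrable H volume a b := fun a b ha hb =>
    ((intervalIntegrable_inv_riccati hp hF1 ha hb).add
      (intervalIntegrable_inv_riccati hp hF2 ha hb)).sub
      ((intervalIntegrable_inv_riccati hp hF0 ha hb).const_mul 2)
  have hHlow : ∀ t, 0 ≤ t → 2 * k ^ 2 * t ^ 2 / riccati p Λ 0 t ^ 3 ≤ H t := by
    intro t ht
    have h1 := hF1 t ht
    have h2 := hF2 t ht
    have h0 := hF0 t ht
    have e1 : riccati p Λ k t = riccati p Λ 0 t - k * t := by unfold riccati; ring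
    have e2 : riccati p Λ (-k) t = riccati p Λ 0 t + k * t := by unfold riccati; ring
    simp only [hH]
    rw [e1] at h1 ⊢
    rw [e2] at h2 ⊢
    set F := riccati p Λ 0 t
    have hprod : 0 < (F - k * t) * (F + k * t) := mul_pos h1 h2
    have e3 : (F - k * t)⁻¹ + (F + k * t)⁻¹ - 2 * F⁻¹
        = 2 * k ^ 2 * t ^ 2 / (F * ((F - k * t) * (F + k * t))) := by
      field_simp; ring
    rw [e3]
    refine div_le_div_of_nonneg_left (by positivity) (by positivity) ?_
    have : (F - k * t) * (F + k * t) ≤ F ^ 2 := by nlinarith [sq_nonneg (k * t)]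
    calc F * ((F - k * t) * (F + k * t)) ≤ F * F ^ 2 := by gcongr
      _ = F ^ 3 := by ring
  have hHnn : ∀ t, 0 ≤ t → 0 ≤ H t := fun t ht =>
    le_trans (by have := hF0 t ht; positivity) (hHlow t ht)
  have hone : 2 * k₀ ^ 2 / (3 * (Λ + (p - 1)) ^ 3) ≤ ∫ t in (0 : ℝ)..1, H t := by
    have e : ∫ t in (0 : ℝ)..1, 2 * k₀ ^ 2 / (Λ + (p - 1)) ^ 3 * t ^ 2
        = 2 * k₀ ^ 2 / (3 * (Λ + (p - 1)) ^ 3) := by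
      rw [intervalIntegral.integral_const_mul, integral_pow]; field_simp; norm_num
    rw [← e]
    refine intervalIntegral.integral_mono_on zero_le_one
      (Continuous.intervalIntegrable (by fun_prop) _ _) (hHint 0 1 le_rfl zero_le_one) ?_
    intro t ht
    refine le_trans ?_ (hHlow t ht.1)
    have h0 := hF0 t ht.1
    have hle : riccati p Λ 0 t ≤ Λ + (p - 1) := by
      have : t ^ (p / (p - 1)) ≤ 1 := Real.rpow_le_one ht.1 ht.2 (by positivity)
      unfold riccati; nlinarith
    have hsq : k₀ ^ 2 ≤ k ^ 2 := by rw [← sq_abs k]; gcongr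
    rw [div_mul_eq_mul_div]
    gcongr
  have hS : ∀ S : ℝ, 1 ≤ S → 2 * (∫ t in (0 : ℝ)..S, (riccati p Λ 0 t)⁻¹)
      ≤ 1 - 2 * k₀ ^ 2 / (3 * (Λ + (p - 1)) ^ 3) := by
    intro S hS
    have hS0 : 0 ≤ S := by linarith
    have h1 := hT1 S hS0
    have h2 := hT2 S hS0
    have hsplit : ∫ t in (0 : ℝ)..S, H t = (∫ t in (0 : ℝ)..S, (riccati p Λ k t)⁻¹)
        + (∫ t in (0 : ℝ)..S, (riccati p Λ (-k) t)⁻¹)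
        - 2 * ∫ t in (0 : ℝ)..S, (riccati p Λ 0 t)⁻¹ := by
      rw [intervalIntegral.integral_sub ((intervalIntegrable_inv_riccati hp hF1 le_rfl hS0).add
        (intervalIntegrable_inv_riccati hp hF2 le_rfl hS0))
        ((intervalIntegrable_inv_riccati hp hF0 le_rfl hS0).const_mul 2),
        intervalIntegral.integral_add (intervalIntegrable_inv_riccati hp hF1 le_rfl hS0)
        (intervalIntegrable_inv_riccati hp hF2 le_rfl hS0), intervalIntegral.integral_const_mul]
    have hadj := intervalIntegral.integral_add_adjacent_intervals (hHint 0 1 le_rfl zero_le_one)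
      (hHint 1 S zero_le_one hS0)
    have hnn : 0 ≤ ∫ t in (1 : ℝ)..S, H t :=
      intervalIntegral.integral_nonneg hS fun t ht => hHnn t (by linarith [ht.1])
    linarith
  have := le_of_tendsto (tendsto_riccati_zero hp hΛ)
    (eventually_atTop.2 ⟨1, fun S h => hS S h⟩)
  linarith

theorem one_lt_piP_mul_rpow {p Λ : ℝ} (hp : 1 < p) (hΛ : 0 < Λ) (h : Λ < piP p ^ p) :
    1 < piP p * Λ ^ (-(1 / p)) := by
  have hp0 : 0 < p := by linarith
  have h1 : Λ ^ (1 / p) < piP p := by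
    have := Real.rpow_lt_rpow hΛ.le h (by positivity : 0 < 1 / p)
    rwa [← Real.rpow_mul (piP_pos hp).le, mul_one_div_cancel hp0.ne', Real.rpow_one] at this
  rw [Real.rpow_neg hΛ.le, ← div_eq_mul_inv, lt_div_iff₀ (by positivity), one_mul]
  exact h1

theorem exists_poincare {p Λ : ℝ} (hp : 1 < p) (hΛ : 0 < Λ) (hlt : Λ < piP p ^ p)
    {h : ℝ → ℝ} (hh : IsLogConcaveWeight h)
    {v v' : ℝ → ℝ} (hv : ∀ x, HasDerivAt v (v' x) x) (hv' : Continuous v') :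
    ∃ c ∈ Icc (0 : ℝ) 1, Λ * ∫ x in (0 : ℝ)..1, h x * |v x - v c| ^ p ≤ ∫ x in (0 : ℝ)..1, h x * |v' x| ^ p := by
  refine exists_poincare_of_cover hp hh (fun c hc => ?_) hv hv'
  by_contra hcon
  rw [not_or] at hcon
  obtain ⟨k, hk1, hk2⟩ := hh.concave.exists_supergradient hc
  have := riccati_time_le_of_not_leftIneq hp hΛ hc hh hk1 hk2 hcon.1 hcon.2 le_rfl (abs_nonneg k)
  have h2 := one_lt_piP_mul_rpow hp hΛ hlt
  simp at this
  simp at h2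
  linarith

/-- A bump supported in `[δ / 2, δ]`. -/
noncomputable def bump (δ x : ℝ) : ℝ := max 0 ((x - δ / 2) * (δ - x))

theorem continuous_bump (δ : ℝ) : Continuous (bump δ) := by unfold bump; fun_prop

theorem bump_nonneg (δ x : ℝ) : 0 ≤ bump δ x := le_max_left _ _

theorem bump_le_one {δ : ℝ} (h0 : 0 ≤ δ) (h : δ ≤ 1) (x : ℝ) : bump δ x ≤ 1 :=
  max_le zero_le_one (by nlinarith [sq_nonneg (x - δ), sq_nonneg (x - δ / 2)])

theorem bump_eq_zero {δ x : ℝ} (hδ : 0 ≤ δ) (hx : x ∉ Icc (δ / 2) δ) : bump δ x = 0 := by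
  refine max_eq_left ?_
  rw [mem_Icc, not_and_or, not_le, not_le] at hx
  rcases hx with hx | hx <;> nlinarith

theorem integral_bump_pos {δ : ℝ} (hδ : 0 < δ) : 0 < ∫ x in (0 : ℝ)..δ, bump δ x := by
  have hc := continuous_bump δ
  rw [← intervalIntegral.integral_add_adjacent_intervals (b := δ / 2)
    (hc.intervalIntegrable _ _) (hc.intervalIntegrable _ _)]
  have h1 : 0 ≤ ∫ x in (0 : ℝ)..(δ / 2), bump δ x :=
    intervalIntegral.integral_nonneg (by linarith) fun x _ => bump_nonneg δ x
  have h2 : 0 < ∫ x in (δ / 2)..δ, bump δ x := by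
    refine intervalIntegral.intervalIntegral_pos_of_pos_on (hc.intervalIntegrable _ _) ?_
      (by linarith)
    intro x hx
    exact lt_max_of_lt_right (mul_pos (by linarith [hx.1]) (by linarith [hx.2]))
  linarith

theorem riccati_time_lt_of_not_leftIneq_bump {p Λ c k δ₁ δ ε a s₀ : ℝ} (hp : 1 < p) (hΛ : 0 < Λ)
    (hδ₁ : 0 < δ₁) (hδ₁1 : δ₁ ≤ 1) (hc : c ∈ Icc δ₁ 1)
    (htime : 2 * δ₁ ≤ ∫ t in (0 : ℝ)..1, (riccati p Λ 0 t)⁻¹)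
    (hδ0 : 0 ≤ δ) (hδ1 : δ ≤ 1) (hε0 : 0 ≤ ε) (hε1 : ε ≤ 1 / 2) (ha : 0 ≤ a)
    (hεa : ε * (Λ + (p - 1)) ≤ a * (Λ * δ₁ / 4))
    (hkδ : ∀ t, 0 ≤ t → -(k * t) ≤ δ * riccati p Λ 0 t) (hka : k + a ≤ s₀)
    {h : ℝ → ℝ} (hh : IsLogConcaveWeight h)
    (hs : ∀ x y, 0 < x → x ≤ y → y ≤ δ₁ → s₀ * (y - x) ≤ Real.log (h y) - Real.log (h x))
    (hkl : ∀ x y, 0 < x → x ≤ y → y ≤ c → k * (y - x) ≤ Real.log (h y) - Real.log (h x))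
    (hl : ¬ LeftIneq p Λ c h) {S : ℝ} (hS1 : 1 ≤ S) (hSΛ : Λ * δ₁ / 4 ≤ S) :
    ∫ t in (0 : ℝ)..S, (riccati p Λ 0 t)⁻¹ < (1 + δ) * c - ε * ∫ x in (0 : ℝ)..δ₁, bump δ₁ x := by
  have hp1 : 0 < p - 1 := by linarith
  have hbc := continuous_bump δ₁
  have hc0 : 0 < c := hδ₁.trans_le hc.1
  by_contra hcon
  rw [not_lt] at hcon
  apply hl
  have hb1 : ∀ x, bump δ₁ x ≤ 1 := bump_le_one hδ₁.le hδ₁1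
  have hF0 : ∀ t, 0 ≤ t → 0 < riccati p Λ 0 t := fun t ht => riccati_zero_pos hp hΛ ht
  have hS0 : 0 ≤ S := by linarith
  obtain ⟨Θ, Θ', hΘ, hΘ', hmon, hval, hode⟩ := exists_ode_solution hS0
    (continuous_riccati hp Λ 0).continuousOn fun t ht => hF0 t ht.1
  have hΘ0 : Θ 0 = 0 := by simpa using hval 0 ⟨le_rfl, hS0⟩
  set y : ℝ → ℝ := fun x => (1 + δ) * x - ε * ∫ t in (0 : ℝ)..x, bump δ₁ t with hy
  have hyd : ∀ x, HasDerivAt y ((1 + δ) - ε * bump δ₁ x) x := by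
    intro x
    have h1 : HasDerivAt (fun x => ∫ t in (0 : ℝ)..x, bump δ₁ t) (bump δ₁ x) x :=
      intervalIntegral.integral_hasDerivAt_right (hbc.intervalIntegrable _ _)
        (hbc.stronglyMeasurableAtFilter _ _) hbc.continuousAt
    exact (((hasDerivAt_id x).const_mul (1 + δ)).sub (h1.const_mul ε)).congr_deriv (by simp)
  have hyc : Continuous y := continuous_iff_continuousAt.2 fun x => (hyd x).continuousAt
  have hdpos : ∀ x, 1 / 2 ≤ (1 + δ) - ε * bump δ₁ x := by
    intro x
    have := mul_le_mul hε1 (hb1 x) (bump_nonneg _ _) (by norm_num)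
    linarith
  have hymono : Monotone y := monotone_of_deriv_nonneg (fun x => (hyd x).differentiableAt)
    fun x => by rw [(hyd x).deriv]; linarith [hdpos x]
  have hy0 : y 0 = 0 := by simp [hy]
  have hIb : ∀ x, 0 ≤ x → 0 ≤ ∫ t in (0 : ℝ)..x, bump δ₁ t := fun x hx =>
    intervalIntegral.integral_nonneg hx fun t _ => bump_nonneg _ _
  have hIb2 : ∀ x, 0 ≤ x → (∫ t in (0 : ℝ)..x, bump δ₁ t) ≤ x := fun x hx => by
    have := intervalIntegral.integral_mono_on hx (g := fun _ => (1 : ℝ))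
      (hbc.intervalIntegrable _ _) (intervalIntegrable_const (μ := volume)) fun t _ => hb1 t
    simpa using this
  have hylow : ∀ x, 0 ≤ x → x / 2 ≤ y x := fun x hx => by
    have h1 := hIb2 x hx
    have h2 := hIb x hx
    simp only [hy]; nlinarith
  have hyup : ∀ x, 0 ≤ x → y x ≤ 2 * x := fun x hx => by
    have h2 := hIb x hx
    simp only [hy]; nlinarith
  have hycS : y c ≤ ∫ t in (0 : ℝ)..S, (riccati p Λ 0 t)⁻¹ := by
    refine le_trans ?_ hcon
    have h1 : (∫ x in (0 : ℝ)..δ₁, bump δ₁ x) ≤ ∫ x in (0 : ℝ)..c, bump δ₁ x :=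
      intervalIntegral.integral_mono_interval le_rfl hδ₁.le hc.1
        (Eventually.of_forall fun t => bump_nonneg _ _) (hbc.intervalIntegrable _ _)
    simp only [hy]
    nlinarith
  have hrange : ∀ x ∈ Icc 0 c, Θ (y x) ∈ Icc 0 S := fun x hx =>
    ⟨by rw [← hΘ0, ← hy0]; exact hmon.monotone (hymono hx.1),
     by rw [← hval S ⟨hS0, le_rfl⟩]; exact hmon.monotone ((hymono hx.2).trans hycS)⟩
  refine leftIneq_of_supersolution hp ⟨hc0, hc.2⟩ hh (κ := fun x => k + a * bump δ₁ x)
    (θ := fun x => Θ (y x)) (θ' := fun x => Θ' (y x) * ((1 + δ) - ε * bump δ₁ x))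
    (by fun_prop) ?_ (fun x => (hΘ (y x)).comp x (hyd x)) (by fun_prop)
    (fun x hx => (hrange x hx).1) ?_
  · have hκc : Continuous fun x => k + a * bump δ₁ x := by fun_prop
    have hA : ∀ x y, 0 < x → x ≤ y → y ≤ δ₁ →
        ∫ t in x..y, (k + a * bump δ₁ t) ≤ Real.log (h y) - Real.log (h x) := by
      intro x z hx hxz hz
      refine le_trans ?_ (hs x z hx hxz hz)
      have := intervalIntegral.integral_mono_on hxz (g := fun _ => s₀)
        (hκc.intervalIntegrable _ _) (intervalIntegrable_const (μ := volume)) fun t _ => by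
          have := mul_le_mul_of_nonneg_left (hb1 t) ha
          linarith
      rw [intervalIntegral.integral_const, smul_eq_mul, mul_comm] at this
      exact this
    have hB : ∀ x y, δ₁ ≤ x → x ≤ y → y < c →
        ∫ t in x..y, (k + a * bump δ₁ t) ≤ Real.log (h y) - Real.log (h x) := by
      intro x z hx hxz hz
      refine le_trans ?_ (hkl x z (hδ₁.trans_le hx) hxz hz.le)
      have := intervalIntegral.integral_mono_on_of_le_Ioo hxz (g := fun _ => k)
        (hκc.intervalIntegrable _ _) (intervalIntegrable_const (μ := volume)) fun t ht => by
          rw [bump_eq_zero hδ₁.le fun h => absurd h.2 (not_le.2 (hx.trans_lt ht.1))]; simp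
      rw [intervalIntegral.integral_const, smul_eq_mul, mul_comm] at this
      exact this
    intro x z hx hxz hz
    rcases le_total z δ₁ with h1 | h1
    · exact hA x z hx hxz h1
    rcases le_total δ₁ x with h2 | h2
    · exact hB x z h2 hxz hz
    rw [← intervalIntegral.integral_add_adjacent_intervals (b := δ₁)
      (hκc.intervalIntegrable _ _) (hκc.intervalIntegrable _ _)]
    have := hA x δ₁ hx h2 le_rfl
    have := hB δ₁ z le_rfl h1 hz
    linarith
  · intro x hx
    have hr := hrange x ⟨hx.1.le, hx.2.le⟩
    rw [hode _ hr]
    have hF := hF0 _ hr.1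
    have e : Λ - (k + a * bump δ₁ x) * Θ (y x) + (p - 1) * Θ (y x) ^ (p / (p - 1))
        = riccati p Λ 0 (Θ (y x)) - (k + a * bump δ₁ x) * Θ (y x) := by
      simp only [riccati]; ring
    rw [e]
    have h1 := hkδ _ hr.1
    suffices h2 : ε * bump δ₁ x * riccati p Λ 0 (Θ (y x)) ≤ a * bump δ₁ x * Θ (y x) by
      nlinarith
    by_cases hx1 : x ∈ Icc (δ₁ / 2) δ₁
    · have hΘ1 : Θ (y x) ≤ 1 := by
        rw [← hval 1 ⟨zero_le_one, hS1⟩]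
        refine hmon.monotone (((hyup x hx.1.le).trans ?_).trans htime)
        linarith [hx1.2]
      have hF1 : riccati p Λ 0 (Θ (y x)) ≤ Λ + (p - 1) := by
        have : Θ (y x) ^ (p / (p - 1)) ≤ 1 := Real.rpow_le_one hr.1 hΘ1 (by positivity)
        unfold riccati; nlinarith
      have hlow : Λ * δ₁ / 4 ≤ Θ (y x) := by
        have hs0 : 0 ≤ Λ * δ₁ / 4 := by positivity
        rw [← hval (Λ * δ₁ / 4) ⟨hs0, hSΛ⟩]
        refine hmon.monotone ?_
        have h3 := intervalIntegral.integral_mono_on hs0 (g := fun _ => Λ⁻¹)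
          (intervalIntegrable_inv_riccati hp hF0 le_rfl hs0)
          (intervalIntegrable_const (μ := volume)) fun t ht => by
            refine inv_anti₀ hΛ ?_
            have := Real.rpow_nonneg ht.1 (p / (p - 1))
            unfold riccati; nlinarith
        refine h3.trans ?_
        rw [intervalIntegral.integral_const, smul_eq_mul]
        have := hylow x hx.1.le
        have e3 : (Λ * δ₁ / 4 - 0) * Λ⁻¹ = δ₁ / 4 := by field_simp; ring
        rw [e3]; linarith [hx1.1]
      have hb := bump_nonneg δ₁ x
      calc ε * bump δ₁ x * riccati p Λ 0 (Θ (y x)) ≤ ε * bump δ₁ x * (Λ + (p - 1)) := by gcongr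
        _ = bump δ₁ x * (ε * (Λ + (p - 1))) := by ring
        _ ≤ bump δ₁ x * (a * (Λ * δ₁ / 4)) := by gcongr
        _ = a * bump δ₁ x * (Λ * δ₁ / 4) := by ring
        _ ≤ _ := by gcongr
    · rw [bump_eq_zero hδ₁.le hx1]; simp

theorem le_mul_riccati_zero {p Λ Λ₀ : ℝ} (hp : 1 < p) (hΛ₀ : 0 < Λ₀) (hΛ : Λ₀ ≤ Λ) {t : ℝ}
    (ht : 0 ≤ t) : t ≤ (1 / Λ₀ + 1 / (p - 1)) * riccati p Λ 0 t := by
  have hp1 : 0 < p - 1 := by linarith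
  have hq : 1 < p / (p - 1) := by rw [lt_div_iff₀ hp1]; linarith
  have hr := Real.rpow_nonneg ht (p / (p - 1))
  have e : riccati p Λ 0 t = Λ + (p - 1) * t ^ (p / (p - 1)) := by unfold riccati; ring
  rw [e, add_mul]
  rcases le_total t 1 with h1 | h1
  · have a1 : 1 ≤ 1 / Λ₀ * (Λ + (p - 1) * t ^ (p / (p - 1))) := by
      rw [one_div, ← div_eq_inv_mul, le_div_iff₀ hΛ₀]; nlinarith
    have a2 : 0 ≤ 1 / (p - 1) * (Λ + (p - 1) * t ^ (p / (p - 1))) := by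
      have : 0 < Λ := hΛ₀.trans_le hΛ
      positivity
    linarith
  · have a1 : t ≤ 1 / (p - 1) * (Λ + (p - 1) * t ^ (p / (p - 1))) := by
      have h3 : t ≤ t ^ (p / (p - 1)) := by
        nth_rw 1 [← Real.rpow_one t]
        exact Real.rpow_le_rpow_of_exponent_le h1 hq.le
      rw [one_div, ← div_eq_inv_mul, le_div_iff₀ hp1]; nlinarith
    have a2 : 0 ≤ 1 / Λ₀ * (Λ + (p - 1) * t ^ (p / (p - 1))) := by
      have : 0 < Λ := hΛ₀.trans_le hΛ
      positivity
    linarith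

theorem exists_gain {p s₀ δ₁ : ℝ} (hp : 1 < p) (hs₀ : 0 < s₀) (hδ₁ : 0 < δ₁) (hδ₁1 : δ₁ < 1) :
    ∃ g : ℝ, 0 < g ∧ ∀ h : ℝ → ℝ, IsLogConcaveWeight h →
      (∀ x y, 0 < x → x ≤ y → y ≤ δ₁ → s₀ * (y - x) ≤ Real.log (h y) - Real.log (h x)) →
      ∀ v v' : ℝ → ℝ, (∀ x, HasDerivAt v (v' x) x) → Continuous v' →
      ∃ c ∈ Icc (0 : ℝ) 1, (piP p ^ p + g) * ∫ x in (0 : ℝ)..1, h x * |v x - v c| ^ p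
        ≤ ∫ x in (0 : ℝ)..1, h x * |v' x| ^ p := by
  have hp1 : 0 < p - 1 := by linarith
  have hp0 : 0 < p := by linarith
  have hπ := piP_pos hp
  set Λ₀ := piP p ^ p with hΛ₀def
  have hΛ₀ : 0 < Λ₀ := by positivity
  set L := Λ₀ + p with hL
  have hL0 : 0 < L := by positivity
  set d := min δ₁ (1 / (2 * L)) with hd
  have hd0 : 0 < d := by positivity
  have hdδ : d ≤ δ₁ := min_le_left _ _
  have hdL : 2 * d ≤ 1 / L := by
    have : d ≤ 1 / (2 * L) := min_le_right _ _
    rw [one_div, mul_inv] at this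
    rw [one_div]; linarith
  set a := s₀ / 2 with ha
  set ε := min (1 / 2) (a * (Λ₀ * d / 4) / L) with hε
  have hε0 : 0 < ε := by positivity
  set B := ∫ x in (0 : ℝ)..d, bump d x with hB
  have hB0 : 0 < B := integral_bump_pos hd0
  set δ := min 1 (ε * B / 2) with hδ
  have hδ0 : 0 < δ := by positivity
  set gm := 1 / Λ₀ + 1 / (p - 1) with hgm
  have hgm0 : 0 < gm := by positivity
  set k₀ := min (s₀ / 2) (δ / gm) with hk₀
  have hk₀0 : 0 < k₀ := by positivity
  set τ := min (ε * B / 2) (2 * k₀ ^ 2 / (3 * L ^ 3)) with hτ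
  have hτ0 : 0 < τ := by positivity
  have hone : piP p * Λ₀ ^ (-(1 / p)) = 1 := by
    rw [hΛ₀def, ← Real.rpow_mul hπ.le, show p * -(1 / p) = -1 by field_simp, Real.rpow_neg_one,
      mul_inv_cancel₀ hπ.ne']
  obtain ⟨g, hg0, hg1, hgτ⟩ : ∃ g : ℝ, 0 < g ∧ g ≤ 1 ∧
      1 - τ < piP p * (Λ₀ + g) ^ (-(1 / p)) := by
    have hcont : ContinuousAt (fun g : ℝ => piP p * (Λ₀ + g) ^ (-(1 / p))) 0 := by
      refine continuousAt_const.mul (ContinuousAt.rpow_const (by fun_prop) (Or.inl ?_))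
      simpa using hΛ₀.ne'
    have hev : ∀ᶠ g in 𝓝 (0 : ℝ), 1 - τ < piP p * (Λ₀ + g) ^ (-(1 / p)) := by
      refine hcont.eventually (lt_mem_nhds ?_)
      simp only [add_zero]; rw [hone]; linarith
    have hev2 : ∀ᶠ g in 𝓝[>] (0 : ℝ), 1 - τ < piP p * (Λ₀ + g) ^ (-(1 / p)) :=
      nhdsWithin_le_nhds hev
    obtain ⟨g, h1, h2, h3⟩ := (hev2.and ((Ioc_mem_nhdsGT one_pos))).exists
    exact ⟨g, h2, h3, h1⟩
  refine ⟨g, hg0, fun h hh hs v v' hv hv' => ?_⟩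
  set Λ := Λ₀ + g with hΛ
  have hΛ0 : 0 < Λ := by positivity
  have hΛL : Λ + (p - 1) ≤ L := by rw [hΛ, hL]; linarith
  refine exists_poincare_of_cover hp hh (fun c hc => ?_) hv hv'
  by_contra hcon
  rw [not_or] at hcon
  obtain ⟨k, hk1, hk2⟩ := hh.concave.exists_supergradient hc
  rcases le_or_gt k₀ |k| with hk | hk
  · have h1 := riccati_time_le_of_not_leftIneq hp hΛ0 hc hh hk1 hk2 hcon.1 hcon.2 hk₀0.le hk
    have h2 : 2 * k₀ ^ 2 / (3 * L ^ 3) ≤ 2 * k₀ ^ 2 / (3 * (Λ + (p - 1)) ^ 3) := by gcongr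
    have h3 : τ ≤ 2 * k₀ ^ 2 / (3 * L ^ 3) := min_le_right _ _
    linarith
  · obtain ⟨hka, hkb⟩ := abs_lt.1 hk
    have hk₀s : k₀ ≤ s₀ / 2 := min_le_left _ _
    have hk₀g : k₀ * gm ≤ δ := by rw [← le_div_iff₀ hgm0]; exact min_le_right _ _
    have hF0 : ∀ t, 0 ≤ t → 0 < riccati p Λ 0 t := fun t ht => riccati_zero_pos hp hΛ0 ht
    have hcd : d ≤ c := by
      by_contra hlt
      rw [not_le] at hlt
      have h1 := hs c d hc.1 hlt.le hdδ
      have h2 := hk2 c d le_rfl hlt.le (hdδ.trans_lt hδ₁1)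
      nlinarith
    have hkδ : ∀ t, 0 ≤ t → |k| * t ≤ δ * riccati p Λ 0 t := by
      intro t ht
      have h1 := le_mul_riccati_zero hp hΛ₀ (by linarith : Λ₀ ≤ Λ) ht
      calc |k| * t ≤ k₀ * (gm * riccati p Λ 0 t) := by gcongr
        _ = k₀ * gm * riccati p Λ 0 t := by ring
        _ ≤ δ * riccati p Λ 0 t := by have := hF0 t ht; gcongr
    have htime : 2 * d ≤ ∫ t in (0 : ℝ)..1, (riccati p Λ 0 t)⁻¹ := by
      have := intervalIntegral.integral_mono_on zero_le_one (f := fun _ => 1 / L)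
        (intervalIntegrable_const (μ := volume))
        (intervalIntegrable_inv_riccati hp hF0 le_rfl zero_le_one) fun t ht => by
          rw [one_div]
          refine inv_anti₀ (hF0 t ht.1) (le_trans ?_ hΛL)
          have : t ^ (p / (p - 1)) ≤ 1 := Real.rpow_le_one ht.1 ht.2 (by positivity)
          unfold riccati; nlinarith
      simp only [intervalIntegral.integral_const, sub_zero, one_smul] at this
      exact hdL.trans this
    have hεa : ε * (Λ + (p - 1)) ≤ a * (Λ * d / 4) := by
      have h1 : ε ≤ a * (Λ₀ * d / 4) / L := min_le_right _ _
      rw [le_div_iff₀ hL0] at h1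
      calc ε * (Λ + (p - 1)) ≤ ε * L := by gcongr
        _ ≤ _ := h1
        _ ≤ _ := by rw [hΛ]; gcongr; linarith
    have hδ1 : δ ≤ 1 := min_le_left _ _
    have hδB : δ ≤ ε * B / 2 := min_le_right _ _
    have hleft : ∀ S, 1 ≤ S → Λ * d / 4 ≤ S →
        ∫ t in (0 : ℝ)..S, (riccati p Λ 0 t)⁻¹ < (1 + δ) * c - ε * B := fun S hS1 hS2 =>
      riccati_time_lt_of_not_leftIneq_bump hp hΛ0 hd0 (by linarith) ⟨hcd, hc.2.le⟩ htime hδ0.le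
        hδ1 hε0.le (min_le_left _ _) (by positivity) hεa
        (fun t ht => le_trans (by
          rw [← neg_mul]; exact mul_le_mul_of_nonneg_right (neg_le_abs k) ht) (hkδ t ht)) (by linarith) hh
        (fun x y hx hxy hy => hs x y hx hxy (hy.trans hdδ)) hk1 hcon.1 hS1 hS2
    obtain ⟨hF2, hT2⟩ := riccati_of_not_leftIneq hp ⟨by linarith [hc.2], by linarith [hc.1]⟩
      hh.reflect (reflect_slope hk2) hcon.2
    have hright : ∀ S, 0 ≤ S →
        ∫ t in (0 : ℝ)..S, (riccati p Λ 0 t)⁻¹ ≤ (1 + δ) * (1 - c) := by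
      intro S hS
      refine le_trans ?_ (mul_le_mul_of_nonneg_left (hT2 S hS).le (by linarith))
      rw [← intervalIntegral.integral_const_mul]
      refine intervalIntegral.integral_mono_on hS (intervalIntegrable_inv_riccati hp hF0 le_rfl hS)
        ((intervalIntegrable_inv_riccati hp hF2 le_rfl hS).const_mul _) fun t ht => ?_
      have h1 := hF0 t ht.1
      have h2 := hF2 t ht.1
      have h3 := hkδ t ht.1
      have e2 : riccati p Λ (-k) t = riccati p Λ 0 t + k * t := by unfold riccati; ring
      rw [← div_eq_mul_inv, le_div_iff₀ h2, ← div_eq_inv_mul, div_le_iff₀ h1, e2]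
      have : k * t ≤ |k| * t := mul_le_mul_of_nonneg_right (le_abs_self k) ht.1
      linarith
    have hlim := le_of_tendsto (tendsto_riccati_zero hp hΛ0) (b := 1 + δ - ε * B)
      (eventually_atTop.2 ⟨max 1 (Λ * d / 4), fun S hS => by
        have h1 := hleft S ((le_max_left _ _).trans hS) ((le_max_right _ _).trans hS)
        have h2 := hright S (zero_le_one.trans ((le_max_left _ _).trans hS))
        linarith⟩)
    have h3 : τ ≤ ε * B / 2 := min_le_left _ _
    linarith

/-- The logarithmic slopes of `h` are at most `s₀` in the outward sense away from the ends. -/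
def IsFlat (s₀ δ₁ : ℝ) (h : ℝ → ℝ) : Prop :=
  (∀ x y, δ₁ ≤ x → x ≤ y → y < 1 → Real.log (h y) - Real.log (h x) ≤ s₀ * (y - x)) ∧
  ∀ x y, 0 < x → x ≤ y → y ≤ 1 - δ₁ → Real.log (h x) - Real.log (h y) ≤ s₀ * (y - x)

/-- The weighted Poincaré inequality with constant `Λ` on the unit interval. -/
def HasPoincare (p Λ : ℝ) (h : ℝ → ℝ) : Prop :=
  ∀ v v' : ℝ → ℝ, (∀ x, HasDerivAt v (v' x) x) → Continuous v' →
    ∃ c ∈ Icc (0 : ℝ) 1, Λ * ∫ x in (0 : ℝ)..1, h x * |v x - v c| ^ p ≤ ∫ x in (0 : ℝ)..1, h x * |v' x| ^ p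

theorem hasPoincare_reflect {p Λ : ℝ} {h : ℝ → ℝ} (H : HasPoincare p Λ fun x => h (1 - x)) :
    HasPoincare p Λ h := by
  intro v v' hv hv'
  obtain ⟨c, hc, hκ⟩ := H (fun x => v (1 - x)) (fun x => -v' (1 - x))
    (fun x => by
      simpa [Function.comp_def] using (hv (1 - x)).comp x ((hasDerivAt_id x).const_sub 1))
    (by fun_prop)
  refine ⟨1 - c, ⟨by linarith [hc.2], by linarith [hc.1]⟩, ?_⟩
  have e1 := intervalIntegral.integral_comp_sub_left (a := 0) (b := 1)
    (fun x => h x * |v x - v (1 - c)| ^ p) 1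
  have e2 := intervalIntegral.integral_comp_sub_left (a := 0) (b := 1)
    (fun x => h x * |v' x| ^ p) 1
  simp only [sub_self, sub_zero, abs_neg] at hκ e1 e2
  rwa [e1, e2] at hκ

theorem slope_ge_of_slope_gt {f : ℝ → ℝ} (hf : ConcaveOn ℝ (Ioo 0 1) f) {s₀ δ₁ x y : ℝ}
    (hδ : δ₁ ≤ x) (hxy : x ≤ y) (hy : y < 1) (h : s₀ * (y - x) < f y - f x) :
    ∀ a b, 0 < a → a ≤ b → b ≤ δ₁ → s₀ * (b - a) ≤ f b - f a := by
  intro a b ha hab hb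
  rcases eq_or_lt_of_le hab with rfl | hab
  · simp
  have hxy' : x < y := lt_of_le_of_ne hxy (by rintro rfl; simp at h)
  have ha0 : a ∈ Ioo (0 : ℝ) 1 := ⟨ha, by linarith⟩
  have hb0 : b ∈ Ioo (0 : ℝ) 1 := ⟨by linarith, by linarith⟩
  have hx0 : x ∈ Ioo (0 : ℝ) 1 := ⟨by linarith, by linarith⟩
  have hy0 : y ∈ Ioo (0 : ℝ) 1 := ⟨by linarith, by linarith⟩
  have h3 : s₀ < (f y - f x) / (y - x) := by rwa [lt_div_iff₀ (by linarith)]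
  rw [← le_div_iff₀ (by linarith)]
  refine h3.le.trans ?_
  rcases eq_or_lt_of_le (hb.trans hδ) with rfl | hbx
  · exact hf.slope_anti_adjacent ha0 hy0 hab hxy'
  · exact (hf.slope_anti_adjacent hb0 hy0 hbx hxy').trans
      (hf.slope_anti_adjacent ha0 hx0 hab hbx)

theorem exists_gain_of_not_isFlat {p s₀ δ₁ : ℝ} (hp : 1 < p) (hs₀ : 0 < s₀) (hδ₁ : 0 < δ₁)
    (hδ₁1 : δ₁ < 1) :
    ∃ g : ℝ, 0 < g ∧ ∀ h : ℝ → ℝ, IsLogConcaveWeight h → ¬ IsFlat s₀ δ₁ h →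
      HasPoincare p (piP p ^ p + g) h := by
  obtain ⟨g, hg, H⟩ := exists_gain hp hs₀ hδ₁ hδ₁1
  refine ⟨g, hg, fun h hh hnf => ?_⟩
  rw [IsFlat, not_and_or] at hnf
  rcases hnf with hnf | hnf
  · push Not at hnf
    obtain ⟨x, y, h1, h2, h3, h4⟩ := hnf
    exact H h hh (slope_ge_of_slope_gt hh.concave h1 h2 h3 h4)
  · push Not at hnf
    obtain ⟨x, y, h1, h2, h3, h4⟩ := hnf
    refine hasPoincare_reflect (H _ hh.reflect
      (slope_ge_of_slope_gt hh.reflect.concave (x := 1 - y) (y := 1 - x)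
        (by linarith) (by linarith) (by linarith) ?_))
    simp only [sub_sub_cancel]; linarith

/-- Rescaling of the Poincaré inequality to the interval `(α, β)`. -/
theorem HasPoincare.rescale {p Λ α β : ℝ} (hαβ : α < β) {h : ℝ → ℝ}
    (H : HasPoincare p Λ fun x => h (α + (β - α) * x))
    {v v' : ℝ → ℝ} (hv : ∀ x, HasDerivAt v (v' x) x) (hv' : Continuous v') :
    ∃ c ∈ Icc α β, Λ * ∫ x in α..β, h x * |v x - v c| ^ p
      ≤ (β - α) ^ p * ∫ x in α..β, h x * |v' x| ^ p := by
  set X := β - α with hX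
  have hX0 : 0 < X := by linarith
  obtain ⟨c, hc, hκ⟩ := H (fun x => v (α + X * x)) (fun x => v' (α + X * x) * X)
    (fun x => by
      have h1 : HasDerivAt (fun x => α + X * x) X x := by
        simpa using ((hasDerivAt_id x).const_mul X).const_add α
      exact (hv (α + X * x)).comp x h1)
    (by fun_prop)
  refine ⟨α + X * c, ⟨by nlinarith [hc.1], by nlinarith [hc.2]⟩, ?_⟩
  have e1 := intervalIntegral.integral_comp_add_mul (a := 0) (b := 1)
    (fun x => h x * |v x - v (α + X * c)| ^ p) hX0.ne' α
  have e2 := intervalIntegral.integral_comp_add_mul (a := 0) (b := 1)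
    (fun x => h x * |v' x| ^ p) hX0.ne' α
  have e3 : ∀ x, h (α + X * x) * |v' (α + X * x) * X| ^ p
      = X ^ p * (h (α + X * x) * |v' (α + X * x)| ^ p) := by
    intro x
    rw [abs_mul, abs_of_pos hX0, Real.mul_rpow (abs_nonneg _) hX0.le]; ring
  have e4 : α + X * 1 = β := by rw [hX]; ring
  simp only [e3, intervalIntegral.integral_const_mul] at hκ
  rw [e1, e2, e4, mul_zero, add_zero, smul_eq_mul, smul_eq_mul, mul_left_comm,
    mul_left_comm (X ^ p)] at hκ
  exact le_of_mul_le_mul_left hκ (by positivity)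

theorem hasPoincare_of_lt {p Λ : ℝ} (hp : 1 < p) (hΛ : 0 < Λ) (hlt : Λ < piP p ^ p)
    {h : ℝ → ℝ} (hh : IsLogConcaveWeight h) : HasPoincare p Λ h :=
  fun _ _ hv hv' => exists_poincare hp hΛ hlt hh hv hv'

/-- A nonempty bounded open convex subset of the line is an open interval. -/
theorem exists_eq_Ioo_of_convex {S : Set ℝ} (ho : IsOpen S) (hc : Convex ℝ S)
    (hb : Bornology.IsBounded S) (hne : S.Nonempty) : ∃ a b, a < b ∧ S = Ioo a b := by
  have hba := hb.bddAbove
  have hbb := hb.bddBelow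
  have hsub : ∀ x ∈ S, sInf S < x ∧ x < sSup S := by
    intro x hx
    obtain ⟨ε, hε, hball⟩ := Metric.isOpen_iff.1 ho x hx
    have h1 : x - ε / 2 ∈ S := hball (by simp [abs_of_pos hε, hε])
    have h2 : x + ε / 2 ∈ S := hball (by simp [abs_of_pos hε, hε])
    have := csInf_le hbb h1
    have := le_csSup hba h2
    constructor <;> linarith
  refine ⟨sInf S, sSup S, ?_, ?_⟩
  · obtain ⟨x, hx⟩ := hne
    exact (hsub x hx).1.trans (hsub x hx).2
  · ext x
    refine ⟨hsub x, fun hx => ?_⟩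
    obtain ⟨s, hs, hsx⟩ := exists_lt_of_csInf_lt hne hx.1
    obtain ⟨t, ht, hxt⟩ := exists_lt_of_lt_csSup hne hx.2
    exact hc.ordConnected.out hs ht ⟨hsx.le, hxt.le⟩

/-- The one-dimensional Brunn–Minkowski inequality for intervals. -/
theorem volume_combo_le {A B C : Set ℝ} {l : ℝ} (hl0 : 0 < l) (hl1 : l < 1)
    (hAo : IsOpen A) (hAc : Convex ℝ A) (hAb : Bornology.IsBounded A) (hA : A.Nonempty)
    (hBo : IsOpen B) (hBc : Convex ℝ B) (hBb : Bornology.IsBounded B) (hB : B.Nonempty)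
    (hC : ∀ a ∈ A, ∀ b ∈ B, (1 - l) * a + l * b ∈ C) :
    ENNReal.ofReal (1 - l) * volume A + ENNReal.ofReal l * volume B ≤ volume C := by
  obtain ⟨a, a', haa, rfl⟩ := exists_eq_Ioo_of_convex hAo hAc hAb hA
  obtain ⟨b, b', hbb, rfl⟩ := exists_eq_Ioo_of_convex hBo hBc hBb hB
  have hsub : Ioo ((1 - l) * a + l * b) ((1 - l) * a' + l * b') ⊆ C := by
    intro x hx
    have hD : 0 < (1 - l) * (a' - a) + l * (b' - b) := by nlinarith [hx.1, hx.2]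
    set s := (x - ((1 - l) * a + l * b)) / ((1 - l) * (a' - a) + l * (b' - b)) with hs
    have hs0 : 0 < s := div_pos (by linarith [hx.1]) hD
    have hs1 : s < 1 := by rw [hs, div_lt_one hD]; linarith [hx.2]
    have hsx : s * ((1 - l) * (a' - a) + l * (b' - b)) = x - ((1 - l) * a + l * b) :=
      div_mul_cancel₀ _ hD.ne'
    have := hC (a + s * (a' - a)) ⟨by nlinarith, by nlinarith⟩
      (b + s * (b' - b)) ⟨by nlinarith, by nlinarith⟩
    convert this using 1
    linarith
  refine le_trans (le_of_eq ?_) (measure_mono hsub)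
  rw [Real.volume_Ioo, Real.volume_Ioo, Real.volume_Ioo, ← ENNReal.ofReal_mul (by linarith),
    ← ENNReal.ofReal_mul hl0.le, ← ENNReal.ofReal_add]
  · congr 1; ring
  · nlinarith
  · nlinarith

/-- A nonnegative function on the line whose positive superlevel sets are bounded open
intervals. -/
structure IsIntervalProfile (f : ℝ → ℝ) : Prop where
  nonneg : ∀ y, 0 ≤ f y
  isOpen : ∀ t, 0 ≤ t → IsOpen {y | t < f y}
  convex : ∀ t, 0 ≤ t → Convex ℝ {y | t < f y}
  isBounded : Bornology.IsBounded {y | 0 < f y}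

theorem IsIntervalProfile.measurable {f : ℝ → ℝ} (hf : IsIntervalProfile f) : Measurable f := by
  refine measurable_of_Ioi fun t => ?_
  rcases le_or_gt 0 t with ht | ht
  · exact (hf.isOpen t ht).measurableSet
  · convert MeasurableSet.univ
    ext y
    simpa using ht.trans_le (hf.nonneg y)

theorem IsIntervalProfile.lintegral_combo_le {f g k : ℝ → ℝ} {l : ℝ} (hl0 : 0 < l) (hl1 : l < 1)
    (hf : IsIntervalProfile f) (hg : IsIntervalProfile g) (hk : IsIntervalProfile k)
    (hf1 : ∀ y, f y ≤ 1) (hg1 : ∀ y, g y ≤ 1)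
    (hf2 : ∀ t < 1, ∃ y, t < f y) (hg2 : ∀ t < 1, ∃ y, t < g y)
    (h : ∀ t, 0 ≤ t → ∀ y z, t < f y → t < g z → t < k ((1 - l) * y + l * z)) :
    ENNReal.ofReal (1 - l) * (∫⁻ y, ENNReal.ofReal (f y)) +
      ENNReal.ofReal l * ∫⁻ y, ENNReal.ofReal (g y) ≤ ∫⁻ y, ENNReal.ofReal (k y) := by
  rw [lintegral_eq_lintegral_meas_lt _ (.of_forall hf.nonneg) hf.measurable.aemeasurable,
    lintegral_eq_lintegral_meas_lt _ (.of_forall hg.nonneg) hg.measurable.aemeasurable,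
    lintegral_eq_lintegral_meas_lt _ (.of_forall hk.nonneg) hk.measurable.aemeasurable]
  have hanti : ∀ f : ℝ → ℝ, Measurable fun t : ℝ => volume {a | t < f a} := fun f =>
    Antitone.measurable fun s t hst => measure_mono fun a (ha : t < f a) => hst.trans_lt ha
  rw [← lintegral_const_mul _ (hanti f), ← lintegral_const_mul _ (hanti g),
    ← lintegral_add_left ((hanti f).const_mul _)]
  refine setLIntegral_mono (hanti k) fun t ht => ?_
  have ht : 0 < t := ht
  rcases lt_or_ge t 1 with ht1 | ht1
  · exact volume_combo_le hl0 hl1 (hf.isOpen t ht.le) (hf.convex t ht.le)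
      (hf.isBounded.subset fun y (hy : t < f y) => ht.trans hy) (hf2 t ht1)
      (hg.isOpen t ht.le) (hg.convex t ht.le)
      (hg.isBounded.subset fun y (hy : t < g y) => ht.trans hy) (hg2 t ht1)
      fun a ha b hb => h t ht.le a b ha hb
  · have e1 : {a | t < f a} = ∅ := by ext y; simpa using (hf1 y).trans ht1
    have e2 : {a | t < g a} = ∅ := by ext y; simpa using (hg1 y).trans ht1
    simp [e1, e2]

theorem IsIntervalProfile.div_const {f : ℝ → ℝ} (hf : IsIntervalProfile f) {M : ℝ} (hM : 0 < M) :
    IsIntervalProfile fun y => f y / M := by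
  have e : ∀ t, {y | t < f y / M} = {y | t * M < f y} := fun t => by
    ext y; exact lt_div_iff₀ hM
  refine ⟨fun y => div_nonneg (hf.nonneg y) hM.le, fun t ht => ?_, fun t ht => ?_, ?_⟩
  · rw [e]; exact hf.isOpen _ (by positivity)
  · rw [e]; exact hf.convex _ (by positivity)
  · rw [e]; simpa using hf.isBounded

theorem IsIntervalProfile.integrable {f : ℝ → ℝ} (hf : IsIntervalProfile f) {C : ℝ}
    (hC : ∀ y, f y ≤ C) : Integrable f := by
  have h1 : IntegrableOn f {y | 0 < f y} := by
    refine Measure.integrableOn_of_bounded (M := C) hf.isBounded.measure_lt_top.ne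
      hf.measurable.aestronglyMeasurable (.of_forall fun y => ?_)
    rw [Real.norm_of_nonneg (hf.nonneg y)]
    exact hC y
  refine (integrableOn_iff_integrable_of_support_subset fun y hy => ?_).1 h1
  exact lt_of_le_of_ne (hf.nonneg y) (Ne.symm hy)

/-- The integral of a log-concave combination, normalised by the suprema. -/
theorem IsIntervalProfile.integral_combo_le {f g k : ℝ → ℝ} {l M N : ℝ} (hl0 : 0 < l)
    (hl1 : l < 1) (hf : IsIntervalProfile f) (hg : IsIntervalProfile g) (hk : IsIntervalProfile k)
    (hM : 0 < M) (hN : 0 < N) (hf1 : IsLUB (range f) M) (hg1 : IsLUB (range g) N)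
    {C : ℝ} (hC : ∀ y, k y ≤ C)
    (h : ∀ y z, 0 < f y → 0 < g z → f y ^ (1 - l) * g z ^ l ≤ k ((1 - l) * y + l * z)) :
    M ^ (1 - l) * N ^ l * ((1 - l) * ((∫ y, f y) / M) + l * ((∫ y, g y) / N)) ≤ ∫ y, k y := by
  have hfM : ∀ y, f y ≤ M := fun y => hf1.1 (mem_range_self y)
  have hgN : ∀ y, g y ≤ N := fun y => hg1.1 (mem_range_self y)
  have hP : 0 < M ^ (1 - l) * N ^ l := by positivity
  have key := IsIntervalProfile.lintegral_combo_le hl0 hl1 (hf.div_const hM) (hg.div_const hN)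
    (hk.div_const hP) (fun y => (div_le_one hM).2 (hfM y)) (fun y => (div_le_one hN).2 (hgN y))
    (fun t ht => by
      obtain ⟨_, ⟨y, rfl⟩, hy, -⟩ := hf1.exists_between (show t * M < M by nlinarith)
      exact ⟨y, (lt_div_iff₀ hM).2 hy⟩)
    (fun t ht => by
      obtain ⟨_, ⟨y, rfl⟩, hy, -⟩ := hg1.exists_between (show t * N < N by nlinarith)
      exact ⟨y, (lt_div_iff₀ hN).2 hy⟩)
    (fun t ht y z hy hz => by
      rw [lt_div_iff₀ hM] at hy
      rw [lt_div_iff₀ hN] at hz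
      have hy0 : 0 < f y := lt_of_le_of_lt (by positivity) hy
      have hz0 : 0 < g z := lt_of_le_of_lt (by positivity) hz
      rw [lt_div_iff₀ hP]
      refine lt_of_lt_of_le ?_ (h y z hy0 hz0)
      have e : t * (M ^ (1 - l) * N ^ l) = (t * M) ^ (1 - l) * (t * N) ^ l := by
        rw [Real.mul_rpow ht hM.le, Real.mul_rpow ht hN.le]
        have : t ^ (1 - l) * t ^ l = t := by
          rw [← Real.rpow_add' ht (by norm_num)]; simp
        calc t * (M ^ (1 - l) * N ^ l) = (t ^ (1 - l) * t ^ l) * (M ^ (1 - l) * N ^ l) := by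
              rw [this]
          _ = _ := by ring
      rw [e]
      exact mul_lt_mul'' (Real.rpow_lt_rpow (by positivity) hy (by linarith))
        (Real.rpow_lt_rpow (by positivity) hz hl0) (by positivity) (by positivity))
  have iF := ((hf.integrable hfM).div_const M)
  have iG := ((hg.integrable hgN).div_const N)
  have iK := ((hk.integrable hC).div_const (M ^ (1 - l) * N ^ l))
  rw [← ofReal_integral_eq_lintegral_ofReal iF (.of_forall (hf.div_const hM).nonneg),
    ← ofReal_integral_eq_lintegral_ofReal iG (.of_forall (hg.div_const hN).nonneg),
    ← ofReal_integral_eq_lintegral_ofReal iK (.of_forall (hk.div_const hP).nonneg),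
    ← ENNReal.ofReal_mul (by linarith), ← ENNReal.ofReal_mul hl0.le, ← ENNReal.ofReal_add,
    ENNReal.ofReal_le_ofReal_iff, integral_div, integral_div, integral_div,
    le_div_iff₀ hP] at key
  · linarith
  · exact integral_nonneg (hk.div_const hP).nonneg
  · exact mul_nonneg (by linarith) (integral_nonneg (hf.div_const hM).nonneg)
  · exact mul_nonneg (by linarith) (integral_nonneg (hg.div_const hN).nonneg)

/-- A positive bounded weight on a bounded open convex set whose `m`-th root is concave. -/
structure PowConcave (m : ℕ) (K : Set (ℝ × ℝ)) (φ : ℝ × ℝ → ℝ) : Prop where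
  m_pos : 0 < m
  isOpen : IsOpen K
  convex : Convex ℝ K
  isBounded : Bornology.IsBounded K
  pos : ∀ z ∈ K, 0 < φ z
  concave : ConcaveOn ℝ K fun z => φ z ^ (1 / (m : ℝ))
  bdd : ∃ C, ∀ z ∈ K, φ z ≤ C

/-- The vertical slice of a planar set. -/
def slice (K : Set (ℝ × ℝ)) (x : ℝ) : Set ℝ := {y | (x, y) ∈ K}

/-- The length of the vertical slice. -/
noncomputable def width (K : Set (ℝ × ℝ)) (x : ℝ) : ℝ := volume.real (slice K x)

/-- The marginal of a weight on the horizontal axis. -/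
noncomputable def marg (K : Set (ℝ × ℝ)) (φ : ℝ × ℝ → ℝ) (x : ℝ) : ℝ :=
  ∫ y, K.indicator φ (x, y)

theorem isOpen_slice {K : Set (ℝ × ℝ)} (hK : IsOpen K) (x : ℝ) : IsOpen (slice K x) :=
  hK.preimage (Continuous.prodMk_right x)

theorem convex_slice {K : Set (ℝ × ℝ)} (hK : Convex ℝ K) (x : ℝ) : Convex ℝ (slice K x) := by
  intro y hy z hz a b ha hb hab
  have := hK hy hz ha hb hab
  simp only [Prod.smul_mk, Prod.mk_add_mk, ← add_smul, hab, one_smul] at this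
  exact this

theorem isBounded_slice {K : Set (ℝ × ℝ)} (hK : Bornology.IsBounded K) (x : ℝ) :
    Bornology.IsBounded (slice K x) :=
  hK.image_snd.subset fun y hy => ⟨(x, y), hy, rfl⟩

/-- The horizontal projection of a bounded open convex set is an open interval. -/
theorem exists_image_fst_eq_Ioo {K : Set (ℝ × ℝ)} (ho : IsOpen K) (hc : Convex ℝ K)
    (hb : Bornology.IsBounded K) (hne : K.Nonempty) : ∃ a b, a < b ∧ Prod.fst '' K = Ioo a b :=
  exists_eq_Ioo_of_convex (isOpenMap_fst _ ho) (hc.linear_image (LinearMap.fst ℝ ℝ ℝ))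
    hb.image_fst (hne.image _)

namespace PowConcave

variable {m : ℕ} {K : Set (ℝ × ℝ)} {φ : ℝ × ℝ → ℝ}

theorem mono (h : PowConcave m K φ) {L : Set (ℝ × ℝ)} (hL : L ⊆ K) (ho : IsOpen L)
    (hc : Convex ℝ L) : PowConcave m L φ :=
  ⟨h.m_pos, ho, hc, h.isBounded.subset hL, fun z hz => h.pos z (hL hz), h.concave.subset hL hc,
    h.bdd.imp fun _ hC z hz => hC z (hL hz)⟩

theorem root_pow (h : PowConcave m K φ) {z : ℝ × ℝ} (hz : z ∈ K) :
    (φ z ^ (1 / (m : ℝ))) ^ m = φ z := by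
  rw [one_div]
  exact Real.rpow_inv_natCast_pow (h.pos z hz).le h.m_pos.ne'

theorem continuousOn (h : PowConcave m K φ) : ContinuousOn φ K :=
  ((h.concave.continuousOn h.isOpen).pow m).congr fun _ hz => (h.root_pow hz).symm

theorem geom_le (h : PowConcave m K φ) {z w : ℝ × ℝ} (hz : z ∈ K) (hw : w ∈ K) {l : ℝ}
    (hl0 : 0 ≤ l) (hl1 : l ≤ 1) :
    φ z ^ (1 - l) * φ w ^ l ≤ φ ((1 - l) • z + l • w) := by
  have hzw := h.convex hz hw (sub_nonneg.2 hl1) hl0 (by ring)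
  have h1 := h.concave.2 hz hw (sub_nonneg.2 hl1) hl0 (by ring)
  simp only [smul_eq_mul] at h1
  have pz := Real.rpow_nonneg (h.pos z hz).le (1 / (m : ℝ))
  have pw := Real.rpow_nonneg (h.pos w hw).le (1 / (m : ℝ))
  have h2 := (Real.geom_mean_le_arith_mean2_weighted (sub_nonneg.2 hl1) hl0 pz pw
    (by ring)).trans h1
  have h3 := pow_le_pow_left₀ (by positivity) h2 m
  rw [h.root_pow hzw, mul_pow, ← Real.rpow_mul_natCast pz, ← Real.rpow_mul_natCast pw,
    mul_comm (1 - l), mul_comm l, Real.rpow_mul pz, Real.rpow_mul pw, Real.rpow_natCast,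
    Real.rpow_natCast, h.root_pow hz, h.root_pow hw] at h3
  exact h3

theorem pow_mul_le (h : PowConcave m K φ) {z w : ℝ × ℝ} (hz : z ∈ K) (hw : w ∈ K) {l : ℝ}
    (hl0 : 0 ≤ l) (hl1 : l ≤ 1) : (1 - l) ^ m * φ z ≤ φ ((1 - l) • z + l • w) := by
  have hzw := h.convex hz hw (sub_nonneg.2 hl1) hl0 (by ring)
  have h1 := h.concave.2 hz hw (sub_nonneg.2 hl1) hl0 (by ring)
  simp only [smul_eq_mul] at h1
  have pz := Real.rpow_nonneg (h.pos z hz).le (1 / (m : ℝ))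
  have pw := Real.rpow_nonneg (h.pos w hw).le (1 / (m : ℝ))
  have h2 : (1 - l) * φ z ^ (1 / (m : ℝ)) ≤ φ ((1 - l) • z + l • w) ^ (1 / (m : ℝ)) := by
    nlinarith
  have h3 := pow_le_pow_left₀ (mul_nonneg (sub_nonneg.2 hl1) pz) h2 m
  rwa [h.root_pow hzw, mul_pow, h.root_pow hz] at h3

theorem setOf_lt_indicator {t : ℝ} (ht : 0 ≤ t) :
    {z | t < K.indicator φ z} = {z ∈ K | t < φ z} := by
  ext z
  by_cases hz : z ∈ K <;> simp [hz, ht]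

theorem isOpen_levelSet (h : PowConcave m K φ) {t : ℝ} (ht : 0 ≤ t) :
    IsOpen {z | t < K.indicator φ z} := by
  rw [setOf_lt_indicator ht]
  exact h.continuousOn.isOpen_inter_preimage h.isOpen isOpen_Ioi

theorem convex_levelSet (h : PowConcave m K φ) {t : ℝ} (ht : 0 ≤ t) :
    Convex ℝ {z | t < K.indicator φ z} := by
  have e : {z ∈ K | t < φ z} = {z ∈ K | t ^ (1 / (m : ℝ)) < φ z ^ (1 / (m : ℝ))} := by
    ext z
    simp only [mem_ofPred_eq]
    refine and_congr_right fun hz => (Real.rpow_lt_rpow_iff ht (h.pos z hz).le ?_).symm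
    have := h.m_pos
    positivity
  rw [setOf_lt_indicator ht, e]
  exact h.concave.convex_gt _

theorem isIntervalProfile (h : PowConcave m K φ) (x : ℝ) :
    IsIntervalProfile fun y => K.indicator φ (x, y) := by
  refine ⟨fun y => indicator_nonneg (fun z hz => (h.pos z hz).le) _,
    fun t ht => isOpen_slice (h.isOpen_levelSet ht) x,
    fun t ht => convex_slice (h.convex_levelSet ht) x, ?_⟩
  refine (isBounded_slice h.isBounded x).subset fun y (hy : 0 < K.indicator φ (x, y)) => ?_
  by_contra hn
  rw [indicator_of_notMem (show (x, y) ∉ K from hn)] at hy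
  exact lt_irrefl _ hy

theorem exists_bound (h : PowConcave m K φ) : ∃ C, 0 < C ∧ ∀ z, K.indicator φ z ≤ C := by
  obtain ⟨C, hC⟩ := h.bdd
  refine ⟨max C 1, by positivity, fun z => ?_⟩
  by_cases hz : z ∈ K
  · rw [indicator_of_mem hz]; exact (hC z hz).trans (le_max_left _ _)
  · rw [indicator_of_notMem hz]; positivity

theorem exists_isLUB (h : PowConcave m K φ) {x : ℝ} (hx : (slice K x).Nonempty) :
    ∃ M, 0 < M ∧ IsLUB (range fun y => K.indicator φ (x, y)) M := by
  obtain ⟨C, -, hC⟩ := h.exists_bound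
  have hb : IsLUB (range fun y => K.indicator φ (x, y)) _ :=
    isLUB_ciSup ⟨C, by rintro _ ⟨y, rfl⟩; exact hC _⟩
  refine ⟨_, ?_, hb⟩
  obtain ⟨y, hy⟩ := hx
  refine lt_of_lt_of_le ?_ (hb.1 ⟨y, rfl⟩)
  change 0 < K.indicator φ (x, y)
  rw [indicator_of_mem (show (x, y) ∈ K from hy)]
  exact h.pos _ hy

theorem integrable_slice (h : PowConcave m K φ) (x : ℝ) :
    Integrable fun y => K.indicator φ (x, y) := by
  obtain ⟨C, -, hC⟩ := h.exists_bound
  exact (h.isIntervalProfile x).integrable fun y => hC _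

theorem marg_pos (h : PowConcave m K φ) {x : ℝ} (hx : (slice K x).Nonempty) :
    0 < marg K φ x := by
  refine (integral_pos_iff_support_of_nonneg (h.isIntervalProfile x).nonneg
    (h.integrable_slice x)).2 ?_
  refine ((isOpen_slice h.isOpen x).measure_pos volume hx).trans_le (measure_mono fun y hy => ?_)
  rw [Function.mem_support, indicator_of_mem (show (x, y) ∈ K from hy)]
  exact (h.pos _ hy).ne'

theorem marg_combo (h : PowConcave m K φ) {x₁ x₃ M N l : ℝ} (hl0 : 0 < l) (hl1 : l < 1)
    (hM : 0 < M) (hN : 0 < N)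
    (h1 : IsLUB (range fun y => K.indicator φ (x₁, y)) M)
    (h3 : IsLUB (range fun y => K.indicator φ (x₃, y)) N) :
    M ^ (1 - l) * N ^ l * ((1 - l) * (marg K φ x₁ / M) + l * (marg K φ x₃ / N)) ≤
      marg K φ ((1 - l) * x₁ + l * x₃) := by
  obtain ⟨C, -, hC⟩ := h.exists_bound
  refine IsIntervalProfile.integral_combo_le hl0 hl1 (h.isIntervalProfile x₁)
    (h.isIntervalProfile x₃) (h.isIntervalProfile _) hM hN h1 h3 (fun y => hC _) ?_
  intro y z hy hz
  have hmem : ∀ w, 0 < K.indicator φ w → w ∈ K := fun w hw => by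
    by_contra hn
    rw [indicator_of_notMem hn] at hw
    exact lt_irrefl _ hw
  have hy' := hmem _ hy
  have hz' := hmem _ hz
  have := h.geom_le hy' hz' hl0.le hl1.le
  have hzw := h.convex hy' hz' (sub_nonneg.2 hl1.le) hl0.le (by ring)
  simp only [Prod.smul_mk, Prod.mk_add_mk, smul_eq_mul] at this hzw
  rwa [indicator_of_mem hy', indicator_of_mem hz', indicator_of_mem hzw]

theorem marg_log_combo (h : PowConcave m K φ) {x₁ x₃ l : ℝ} (hl0 : 0 < l) (hl1 : l < 1)
    (h1 : (slice K x₁).Nonempty) (h3 : (slice K x₃).Nonempty) :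
    (1 - l) * Real.log (marg K φ x₁) + l * Real.log (marg K φ x₃) ≤
      Real.log (marg K φ ((1 - l) * x₁ + l * x₃)) := by
  obtain ⟨M, hM, hM'⟩ := h.exists_isLUB h1
  obtain ⟨N, hN, hN'⟩ := h.exists_isLUB h3
  have p1 := h.marg_pos h1
  have p3 := h.marg_pos h3
  have key := h.marg_combo hl0 hl1 hM hN hM' hN'
  have amgm := Real.geom_mean_le_arith_mean2_weighted (sub_nonneg.2 hl1.le) hl0.le
    (div_pos p1 hM).le (div_pos p3 hN).le (by ring)
  have h4 := (mul_le_mul_of_nonneg_left amgm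
    (by positivity : 0 ≤ M ^ (1 - l) * N ^ l)).trans key
  have h5 := Real.log_le_log (by positivity) h4
  rw [Real.log_mul (by positivity) (by positivity), Real.log_mul (by positivity) (by positivity),
    Real.log_mul (by positivity) (by positivity), Real.log_rpow hM, Real.log_rpow hN,
    Real.log_rpow (by positivity), Real.log_rpow (by positivity), Real.log_div p1.ne' hM.ne',
    Real.log_div p3.ne' hN.ne'] at h5
  linarith

theorem exists_subinterval (h : PowConcave m K φ) {x y₀ : ℝ} (hy₀ : y₀ ∈ slice K x) :
    ∃ a b, a < b ∧ y₀ ∈ Ioo a b ∧ b - a = 3 / 4 * width K x ∧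
      ∀ y ∈ Ioo a b, y ∈ slice K x ∧ (1 / 4) ^ m * φ (x, y₀) ≤ φ (x, y) := by
  obtain ⟨a, b, hab, e⟩ := exists_eq_Ioo_of_convex (isOpen_slice h.isOpen x)
    (convex_slice h.convex x) (isBounded_slice h.isBounded x) ⟨y₀, hy₀⟩
  have hy : y₀ ∈ Ioo a b := e ▸ hy₀
  have hw : width K x = b - a := by
    rw [width, e, Measure.real, Real.volume_Ioo, ENNReal.toReal_ofReal (by linarith)]
  refine ⟨y₀ + 3 / 4 * (a - y₀), y₀ + 3 / 4 * (b - y₀), by linarith,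
    ⟨by linarith [hy.1], by linarith [hy.2]⟩, by rw [hw]; ring, fun y hy' => ?_⟩
  have hmem : y₀ + 4 / 3 * (y - y₀) ∈ slice K x := by
    rw [e]; exact ⟨by linarith [hy'.1], by linarith [hy'.2]⟩
  have hcomb : ((1 - 3 / 4 : ℝ) • (x, y₀) + (3 / 4 : ℝ) • (x, y₀ + 4 / 3 * (y - y₀))) = (x, y) := by
    simp only [Prod.smul_mk, Prod.mk_add_mk, smul_eq_mul]
    congr 1 <;> ring
  have h1 := h.pow_mul_le (z := (x, y₀)) hy₀ hmem (l := 3 / 4) (by norm_num) (by norm_num)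
  have h2 := h.convex (x := (x, y₀)) hy₀ hmem (a := 1 - 3 / 4) (b := 3 / 4) (by norm_num)
    (by norm_num) (by norm_num)
  rw [hcomb] at h1 h2
  exact ⟨h2, by norm_num at h1 ⊢; exact h1⟩

theorem marg_le_mul_width (h : PowConcave m K φ) {x M : ℝ}
    (hM : IsLUB (range fun y => K.indicator φ (x, y)) M) : marg K φ x ≤ M * width K x := by
  have e : (fun y => K.indicator φ (x, y)) = (slice K x).indicator fun y => φ (x, y) := by
    ext y
    by_cases hy : (x, y) ∈ K
    · rw [indicator_of_mem hy, indicator_of_mem (show y ∈ slice K x from hy)]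
    · rw [indicator_of_notMem hy, indicator_of_notMem (show y ∉ slice K x from hy)]
  have hb := (isBounded_slice h.isBounded x).measure_lt_top (μ := volume)
  have hms := (isOpen_slice h.isOpen x).measurableSet
  have hi := h.integrable_slice x
  have e' : marg K φ x = ∫ y, (fun y => K.indicator φ (x, y)) y := rfl
  rw [e, integrable_indicator_iff hms] at hi
  rw [e', e, integral_indicator hms]
  refine (setIntegral_mono_on hi (integrableOn_const hb.ne) hms (g := fun _ => M)
    fun y hy => ?_).trans ?_
  · have := hM.1 ⟨y, rfl⟩
    simpa only [indicator_of_mem (show (x, y) ∈ K from hy)] using this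
  · simp [width, mul_comm]

theorem mul_width_le_marg (h : PowConcave m K φ) {x M : ℝ}
    (hx : (slice K x).Nonempty)
    (hM : IsLUB (range fun y => K.indicator φ (x, y)) M) :
    3 / 4 * (1 / 4) ^ m * (M * width K x) ≤ marg K φ x := by
  obtain ⟨y₁, hy₁⟩ := hx
  have hw : 0 < width K x := by
    obtain ⟨a, b, hab, -, hlen, -⟩ := h.exists_subinterval hy₁
    linarith
  have hc : 0 < 3 / 4 * (1 / 4 : ℝ) ^ m * width K x := by positivity
  suffices M ≤ marg K φ x / (3 / 4 * (1 / 4) ^ m * width K x) by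
    rw [le_div_iff₀ hc] at this
    linarith
  refine hM.2 ?_
  rintro _ ⟨y₀, rfl⟩
  have h0 : 0 ≤ marg K φ x := integral_nonneg (h.isIntervalProfile x).nonneg
  by_cases hy₀ : (x, y₀) ∈ K
  · simp only [indicator_of_mem hy₀]
    rw [le_div_iff₀ hc]
    obtain ⟨a, b, hab, -, hlen, hI⟩ := h.exists_subinterval (x := x) hy₀
    calc φ (x, y₀) * (3 / 4 * (1 / 4) ^ m * width K x)
        = ∫ y in Ioo a b, (1 / 4) ^ m * φ (x, y₀) := by
          rw [setIntegral_const, Measure.real, Real.volume_Ioo,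
            ENNReal.toReal_ofReal (by linarith), hlen, smul_eq_mul]
          ring
      _ ≤ ∫ y in Ioo a b, K.indicator φ (x, y) := by
          refine setIntegral_mono_on (integrableOn_const (by simp))
            (h.integrable_slice x).integrableOn measurableSet_Ioo fun y hy => ?_
          rw [indicator_of_mem (show (x, y) ∈ K from (hI y hy).1)]
          exact (hI y hy).2
      _ ≤ marg K φ x := setIntegral_le_integral (h.integrable_slice x)
          (.of_forall (h.isIntervalProfile x).nonneg)
  · simp only [indicator_of_notMem hy₀]
    positivity

/-- If the marginal at the midpoint hardly exceeds the marginals at the two ends, then the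
slices at the ends have comparable lengths. -/
theorem width_le_of_marg_le (h : PowConcave m K φ) {x₁ x₃ : ℝ}
    (h1 : (slice K x₁).Nonempty) (h3 : (slice K x₃).Nonempty)
    (hl : marg K φ ((x₁ + x₃) / 2) ≤ 21 / 20 * marg K φ x₁)
    (hr : marg K φ ((x₁ + x₃) / 2) ≤ 21 / 20 * marg K φ x₃) :
    3 / 8 * (1 / 4) ^ m * width K x₃ ≤ width K x₁ := by
  obtain ⟨M, hM, hM'⟩ := h.exists_isLUB h1
  obtain ⟨N, hN, hN'⟩ := h.exists_isLUB h3
  have p1 := h.marg_pos h1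
  have p3 := h.marg_pos h3
  have key := h.marg_combo (l := 1 / 2) (by norm_num) (by norm_num) hM hN hM' hN'
  rw [show (1 - 1 / 2) * x₁ + 1 / 2 * x₃ = (x₁ + x₃) / 2 by ring,
    show (1 - 1 / 2 : ℝ) = 1 / 2 by norm_num, ← Real.sqrt_eq_rpow, ← Real.sqrt_eq_rpow] at key
  have u1 := h.marg_le_mul_width hM'
  have l3 := h.mul_width_le_marg h3 hN'
  set W := marg K φ x₁ / M with hW
  set V := marg K φ x₃ / N with hV
  have eW : marg K φ x₁ = M * W := by rw [hW]; field_simp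
  have eV : marg K φ x₃ = N * V := by rw [hV]; field_simp
  have hWp : 0 < W := div_pos p1 hM
  have hVp : 0 < V := div_pos p3 hN
  have a1 : W ≤ width K x₁ := by
    rw [eW] at u1
    exact le_of_mul_le_mul_left u1 hM
  have a3 : 3 / 4 * (1 / 4) ^ m * width K x₃ ≤ V := by
    rw [eV] at l3
    refine le_of_mul_le_mul_left ?_ hN
    linarith
  rw [eW] at hl
  rw [eV] at hr
  have sM := Real.sq_sqrt hM.le
  have sN := Real.sq_sqrt hN.le
  have q : M * N * ((W + V) / 2) ^ 2 ≤ (21 / 20) ^ 2 * (M * N * (W * V)) := by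
    have g0 : 0 ≤ √M * √N * (1 / 2 * W + 1 / 2 * V) := by positivity
    have g1 := key.trans hl
    have g2 := key.trans hr
    have g3 := mul_le_mul g1 g2 g0 (by positivity)
    calc M * N * ((W + V) / 2) ^ 2
        = √M * √N * (1 / 2 * W + 1 / 2 * V) * (√M * √N * (1 / 2 * W + 1 / 2 * V)) := by
          rw [← sM, ← sN]; simp only [Real.sqrt_sq (Real.sqrt_nonneg _)]; ring
      _ ≤ _ := g3
      _ = _ := by ring
  have q' : (W + V) ^ 2 ≤ 441 / 100 * (W * V) := by
    have hMN : 0 < M * N := by positivity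
    refine le_of_mul_le_mul_left ?_ hMN
    linarith
  have : V / 2 ≤ W := by
    by_contra hlt
    push Not at hlt
    nlinarith
  linarith

end PowConcave

theorem sgnPow_mul_self {p : ℝ} (hp : 1 < p) (a : ℝ) : sgnPow p a * a = |a| ^ p := by
  rcases eq_or_ne a 0 with rfl | ha
  · simp [Real.zero_rpow (by linarith : p ≠ 0)]
  · rw [sgnPow, mul_assoc, ← pow_two, ← sq_abs, ← Real.rpow_natCast, ← Real.rpow_add (abs_pos.2 ha)]
    norm_num

theorem sgnPow_neg (p a : ℝ) : sgnPow p (-a) = -sgnPow p a := by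
  simp [sgnPow]

/-- The tangent line inequality for `|t| ^ p`. -/
theorem tangent_abs_rpow_le {p : ℝ} (hp : 1 < p) (a b : ℝ) :
    |a| ^ p + p * sgnPow p a * (b - a) ≤ |b| ^ p := by
  have h := young_sgnPow hp zero_le_one (-a) b
  rw [sgnPow_neg, Real.one_rpow, abs_neg] at h
  have := sgnPow_mul_self hp a
  nlinarith

theorem abs_sub_rpow_le {p : ℝ} (hp : 1 < p) {v v' : ℝ → ℝ} (hv : ∀ x, HasDerivAt v (v' x) x)
    (hv' : Continuous v') {x z : ℝ} (hxz : x ≤ z) :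
    |v z - v x| ^ p ≤ (z - x) ^ (p - 1) * ∫ t in x..z, |v' t| ^ p := by
  rcases hxz.eq_or_lt with rfl | hlt
  · simp [Real.zero_rpow (by linarith : p ≠ 0)]
  have hd : 0 < z - x := by linarith
  set a := (v z - v x) / (z - x) with ha
  have hcont : Continuous fun t => |v' t| ^ p :=
    hv'.abs.rpow_const fun _ => Or.inr (by linarith)
  have h1 : ∫ t in x..z, (|a| ^ p + p * sgnPow p a * (v' t - a)) ≤ ∫ t in x..z, |v' t| ^ p :=
    intervalIntegral.integral_mono_on hxz (Continuous.intervalIntegrable (by fun_prop) _ _)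
      (hcont.intervalIntegrable _ _) fun t _ => tangent_abs_rpow_le hp a (v' t)
  have h2 : ∫ t in x..z, v' t = v z - v x :=
    intervalIntegral.integral_eq_sub_of_hasDerivAt (fun t _ => hv t) (hv'.intervalIntegrable _ _)
  rw [intervalIntegral.integral_add (by simp) (Continuous.intervalIntegrable (by fun_prop) _ _),
    intervalIntegral.integral_const_mul, intervalIntegral.integral_sub
      (hv'.intervalIntegrable _ _) (by simp), h2] at h1
  simp only [intervalIntegral.integral_const, smul_eq_mul] at h1
  have h3 : (z - x) * a = v z - v x := by rw [ha]; field_simp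
  rw [h3, sub_self, mul_zero, add_zero] at h1
  calc |v z - v x| ^ p = (z - x) ^ p * |a| ^ p := by
        rw [← h3, abs_mul, abs_of_pos hd, Real.mul_rpow hd.le (abs_nonneg _)]
    _ = (z - x) ^ (p - 1) * ((z - x) * |a| ^ p) := by
        rw [Real.rpow_sub_one hd.ne']; field_simp
    _ ≤ _ := by gcongr

theorem abs_sub_rpow_le_uIoc {p : ℝ} (hp : 1 < p) {v v' : ℝ → ℝ}
    (hv : ∀ x, HasDerivAt v (v' x) x) (hv' : Continuous v') (x z : ℝ) :
    |v x - v z| ^ p ≤ |x - z| ^ (p - 1) * ∫ t in uIoc x z, |v' t| ^ p := by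
  rcases le_total x z with h | h
  · rw [uIoc_of_le h, abs_sub_comm, abs_sub_comm x, abs_of_nonneg (sub_nonneg.2 h),
      ← intervalIntegral.integral_of_le h]
    exact abs_sub_rpow_le hp hv hv' h
  · rw [uIoc_of_ge h, abs_of_nonneg (sub_nonneg.2 h), ← intervalIntegral.integral_of_le h]
    exact abs_sub_rpow_le hp hv hv' h

/-- A weighted pointwise bound by averages over a set on which the weight is not much smaller. -/
theorem weight_mul_abs_rpow_le {p K L x : ℝ} (hp : 1 < p) {v v' ρ : ℝ → ℝ}
    (hv : ∀ x, HasDerivAt v (v' x) x) (hv' : Continuous v') {I Z : Set ℝ}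
    (hI : MeasurableSet I) (hZ : MeasurableSet Z) (hZI : Z ⊆ I) (hZf : volume Z ≠ ⊤)
    (hK : 0 ≤ K) (hρ : ∀ t ∈ I, 0 ≤ ρ t) (hx : x ∈ I)
    (hi : IntegrableOn (fun t => ρ t * |v t| ^ p) I)
    (hi' : IntegrableOn (fun t => ρ t * |v' t| ^ p) I)
    (hL : ∀ z ∈ Z, |x - z| ≤ L)
    (hcomp : ∀ z ∈ Z, ∀ t ∈ uIcc x z, t ∈ I ∧ ρ x ≤ K * ρ t) :
    ρ x * |v x| ^ p * volume.real Z ≤ 2 ^ (p - 1) * K *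
      ((∫ t in Z, ρ t * |v t| ^ p) + L ^ (p - 1) * volume.real Z * ∫ t in I, ρ t * |v' t| ^ p) := by
  set E := ∫ t in I, ρ t * |v' t| ^ p with hE
  have hE0 : 0 ≤ E := setIntegral_nonneg hI fun t ht => mul_nonneg (hρ t ht) (by positivity)
  have hpt : ∀ z ∈ Z, ρ x * |v x| ^ p ≤
      2 ^ (p - 1) * K * (ρ z * |v z| ^ p + L ^ (p - 1) * E) := by
    intro z hz
    have h1 : |v x| ^ p ≤ 2 ^ (p - 1) * (|v z| ^ p + |v x - v z| ^ p) := by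
      have t1 : |v x| ≤ |v z| + |v x - v z| := by
        have := abs_add_le (v z) (v x - v z); simpa using this
      refine (Real.rpow_le_rpow (abs_nonneg _) t1 (by linarith)).trans ?_
      exact_mod_cast NNReal.rpow_add_le_mul_rpow_add_rpow ⟨|v z|, abs_nonneg _⟩
        ⟨|v x - v z|, abs_nonneg _⟩ hp.le
    have h2 : ρ x * |v x - v z| ^ p ≤ K * (L ^ (p - 1) * E) := by
      have hsub : uIoc x z ⊆ I := fun t ht => (hcomp z hz t (uIoc_subset_uIcc ht)).1
      have hcont : Continuous fun t => |v' t| ^ p :=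
        hv'.abs.rpow_const fun _ => Or.inr (by linarith)
      have h3 : ρ x * ∫ t in uIoc x z, |v' t| ^ p ≤ K * E := by
        rw [← integral_const_mul, hE, ← integral_const_mul]
        refine (setIntegral_mono_on ?_ ((hi'.mono_set hsub).const_mul K) measurableSet_uIoc
          fun t ht => ?_).trans (setIntegral_mono_set (hi'.const_mul K) ?_ hsub.eventuallyLE)
        · exact ((continuous_const.mul hcont).integrableOn_uIcc).mono_set uIoc_subset_uIcc
        · rw [← mul_assoc]
          exact mul_le_mul_of_nonneg_right (hcomp z hz t (uIoc_subset_uIcc ht)).2 (by positivity)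
        · exact ae_restrict_of_forall_mem hI fun t ht =>
            mul_nonneg hK (mul_nonneg (hρ t ht) (by positivity))
      calc ρ x * |v x - v z| ^ p
          ≤ ρ x * (|x - z| ^ (p - 1) * ∫ t in uIoc x z, |v' t| ^ p) :=
            mul_le_mul_of_nonneg_left (abs_sub_rpow_le_uIoc hp hv hv' x z) (hρ x hx)
        _ = |x - z| ^ (p - 1) * (ρ x * ∫ t in uIoc x z, |v' t| ^ p) := by ring
        _ ≤ L ^ (p - 1) * (K * E) := by
            refine mul_le_mul (Real.rpow_le_rpow (abs_nonneg _) (hL z hz) (by linarith)) h3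
              (mul_nonneg (hρ x hx) (setIntegral_nonneg measurableSet_uIoc
                fun t _ => by positivity)) ?_
            exact Real.rpow_nonneg ((abs_nonneg _).trans (hL z hz)) _
        _ = _ := by ring
    have h4 : ρ x * |v z| ^ p ≤ K * (ρ z * |v z| ^ p) := by
      rw [← mul_assoc]
      exact mul_le_mul_of_nonneg_right (hcomp z hz z right_mem_uIcc).2 (by positivity)
    have h5 := mul_le_mul_of_nonneg_left h1 (hρ x hx)
    have h6 : (0 : ℝ) ≤ 2 ^ (p - 1) := by positivity
    have h7 := mul_le_mul_of_nonneg_left (add_le_add h4 h2) h6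
    linarith
  have hInt : IntegrableOn (fun z => ρ z * |v z| ^ p) Z := hi.mono_set hZI
  have hcst : ∀ c : ℝ, IntegrableOn (fun _ : ℝ => c) Z := fun c => integrableOn_const hZf
  have := setIntegral_mono_on (hcst _) ((hInt.add (hcst (L ^ (p - 1) * E))).const_mul
    (2 ^ (p - 1) * K)) hZ hpt
  simp only [Pi.add_apply] at this
  rw [setIntegral_const, integral_const_mul, integral_add hInt (hcst _),
    setIntegral_const] at this
  simp only [smul_eq_mul] at this
  calc _ = volume.real Z * (ρ x * |v x| ^ p) := by ring
    _ ≤ _ := this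
    _ = _ := by ring

namespace PowConcave

variable {m : ℕ} {K : Set (ℝ × ℝ)} {φ : ℝ × ℝ → ℝ}

theorem indicator_nonneg' (h : PowConcave m K φ) (z : ℝ × ℝ) : 0 ≤ K.indicator φ z :=
  indicator_nonneg (fun z hz => (h.pos z hz).le) z

theorem measurable_indicator (h : PowConcave m K φ) : Measurable (K.indicator φ) := by
  refine measurable_of_Ioi fun t => ?_
  rcases le_or_gt 0 t with ht | ht
  · exact (h.isOpen_levelSet ht).measurableSet
  · convert MeasurableSet.univ
    ext y
    simpa using ht.trans_le (h.indicator_nonneg' y)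

theorem integrable_mul (h : PowConcave m K φ) {F : ℝ × ℝ → ℝ} (hF : Continuous F) :
    Integrable fun z => K.indicator φ z * F z := by
  obtain ⟨C, hC0, hC⟩ := h.exists_bound
  obtain ⟨B, hB⟩ := h.isBounded.isCompact_closure.exists_bound_of_continuousOn hF.continuousOn
  have h1 : IntegrableOn (fun z => K.indicator φ z * F z) K := by
    refine Measure.integrableOn_of_bounded (M := C * B) h.isBounded.measure_lt_top.ne
      (h.measurable_indicator.mul hF.measurable).aestronglyMeasurable
      (ae_restrict_of_forall_mem h.isOpen.measurableSet fun z hz => ?_)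
    rw [norm_mul, Real.norm_of_nonneg (h.indicator_nonneg' z)]
    exact mul_le_mul (hC z) (hB z (subset_closure hz)) (norm_nonneg _) hC0.le
  refine (integrableOn_iff_integrable_of_support_subset fun z hz => ?_).1 h1
  by_contra hn
  exact hz (by simp only [indicator_of_notMem hn, zero_mul])

theorem integrable (h : PowConcave m K φ) : Integrable (K.indicator φ) := by
  simpa using h.integrable_mul (F := fun _ => 1) continuous_const

theorem setIntegral_eq (h : PowConcave m K φ) (F : ℝ × ℝ → ℝ) :
    ∫ z in K, φ z * F z = ∫ z, K.indicator φ z * F z := by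
  rw [← integral_indicator h.isOpen.measurableSet]
  exact integral_congr_ae (.of_forall fun z => indicator_mul_left _ _ _)

theorem integral_eq_iterated (h : PowConcave m K φ) {F : ℝ × ℝ → ℝ} (hF : Continuous F) :
    ∫ z, K.indicator φ z * F z = ∫ x, ∫ y, K.indicator φ (x, y) * F (x, y) :=
  integral_prod _ (h.integrable_mul hF)

theorem integral_fst_eq (h : PowConcave m K φ) {f : ℝ → ℝ} (hf : Continuous f) :
    ∫ z, K.indicator φ z * f z.1 = ∫ x, marg K φ x * f x := by
  rw [h.integral_eq_iterated (F := fun z => f z.1) (hf.comp continuous_fst)]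
  simp only [integral_mul_const, marg]

theorem integrable_marg_mul (h : PowConcave m K φ) {f : ℝ → ℝ} (hf : Continuous f) :
    Integrable fun x => marg K φ x * f x := by
  have := (h.integrable_mul (F := fun z => f z.1) (hf.comp continuous_fst)).integral_prod_left
  simpa only [integral_mul_const, marg] using this

theorem marg_nonneg (h : PowConcave m K φ) (x : ℝ) : 0 ≤ marg K φ x :=
  integral_nonneg fun _ => h.indicator_nonneg' _

theorem marg_eq_zero {x : ℝ} (hx : x ∉ Prod.fst '' K) : marg K φ x = 0 := by
  have : ∀ y, K.indicator φ (x, y) = 0 := fun y =>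
    indicator_of_notMem (fun hy => hx ⟨_, hy, rfl⟩) _
  simp [marg, this]

theorem integral_marg_eq {a b : ℝ} (hab : a ≤ b) (hK : Prod.fst '' K = Ioo a b)
    (f : ℝ → ℝ) : ∫ x, marg K φ x * f x = ∫ x in a..b, marg K φ x * f x := by
  rw [intervalIntegral.integral_of_le hab, setIntegral_eq_integral_of_forall_compl_eq_zero]
  intro x hx
  rw [marg_eq_zero, zero_mul]
  rw [hK]
  exact fun hx' => hx (Ioo_subset_Ioc_self hx')

/-- A continuous function on a thin set may be replaced by a function of the abscissa. -/
theorem abs_integral_sub_le (h : PowConcave m K φ) {F : ℝ × ℝ → ℝ} (hF : Continuous F)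
    {f : ℝ → ℝ} (hf : Continuous f) {ε : ℝ} (hε : ∀ z ∈ K, |F z - f z.1| ≤ ε) :
    |(∫ z, K.indicator φ z * F z) - ∫ x, marg K φ x * f x| ≤ ε * ∫ z, K.indicator φ z := by
  have i1 := h.integrable_mul hF
  have i2 := h.integrable_mul (F := fun z => f z.1) (hf.comp continuous_fst)
  rw [← h.integral_fst_eq hf, ← integral_sub i1 i2, ← integral_const_mul]
  refine (abs_integral_le_integral_abs).trans (integral_mono (i1.sub i2).abs
    (h.integrable.const_mul ε) fun z => ?_)
  simp only
  rw [← mul_sub, abs_mul, abs_of_nonneg (h.indicator_nonneg' z), mul_comm]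
  by_cases hz : z ∈ K
  · exact mul_le_mul_of_nonneg_right (hε z hz) (h.indicator_nonneg' z)
  · simp [indicator_of_notMem hz]

theorem slice_nonempty_iff {x : ℝ} : (slice K x).Nonempty ↔ x ∈ Prod.fst '' K := by
  constructor
  · rintro ⟨y, hy⟩; exact ⟨_, hy, rfl⟩
  · rintro ⟨⟨x, y⟩, hy, rfl⟩; exact ⟨y, hy⟩

theorem exists_marg_le (h : PowConcave m K φ) : ∃ C, ∀ x, marg K φ x ≤ C := by
  obtain ⟨C, hC0, hC⟩ := h.exists_bound
  refine ⟨C * volume.real (Prod.snd '' K), fun x => ?_⟩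
  by_cases hx : (slice K x).Nonempty
  · obtain ⟨M, hM, hM'⟩ := h.exists_isLUB hx
    refine (h.marg_le_mul_width hM').trans (mul_le_mul (hM'.2 ?_) ?_ measureReal_nonneg hC0.le)
    · rintro _ ⟨y, rfl⟩; exact hC _
    · exact measureReal_mono (fun y hy => ⟨_, hy, rfl⟩) h.isBounded.image_snd.measure_lt_top.ne
  · rw [slice_nonempty_iff] at hx
    rw [marg_eq_zero hx]
    positivity

theorem isLogConcaveWeight (h : PowConcave m K φ) {a b : ℝ} (hab : a < b)
    (hK : Prod.fst '' K = Ioo a b) :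
    IsLogConcaveWeight fun x => marg K φ (a + (b - a) * x) := by
  have hne : ∀ x ∈ Ioo (0 : ℝ) 1, (slice K (a + (b - a) * x)).Nonempty := by
    intro x hx
    rw [slice_nonempty_iff, hK]
    constructor <;> nlinarith [hx.1, hx.2]
  refine ⟨fun x hx => h.marg_pos (hne x hx), ?_, ?_⟩
  · rw [concaveOn_iff_forall_pos]
    refine ⟨convex_Ioo _ _, fun x hx y hy s t hs ht hst => ?_⟩
    have := h.marg_log_combo ht (by linarith) (hne x hx) (hne y hy)
    obtain rfl : s = 1 - t := by linarith
    simp only [smul_eq_mul]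
    rw [show a + (b - a) * ((1 - t) * x + t * y) =
      (1 - t) * (a + (b - a) * x) + t * (a + (b - a) * y) by ring]
    exact this
  · obtain ⟨C, hC⟩ := h.exists_marg_le
    exact ⟨C, fun x _ => hC _⟩

end PowConcave

/-- The integral over `K` with weight `φ`. -/
noncomputable def wint (K : Set (ℝ × ℝ)) (φ F : ℝ × ℝ → ℝ) : ℝ := ∫ z, K.indicator φ z * F z

/-- The total mass of the weight `φ` on `K`. -/
noncomputable def mass (K : Set (ℝ × ℝ)) (φ : ℝ × ℝ → ℝ) : ℝ := ∫ z, K.indicator φ z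

/-- `u` is continuously differentiable with partial derivatives `ux` and `uy`. -/
structure HasGrad (u ux uy : ℝ × ℝ → ℝ) : Prop where
  continuous_fst : Continuous ux
  continuous_snd : Continuous uy
  hasFDerivAt : ∀ z, HasFDerivAt u
    (ux z • ContinuousLinearMap.fst ℝ ℝ ℝ + uy z • ContinuousLinearMap.snd ℝ ℝ ℝ) z

/-- The `p`-th power of the Euclidean length of the gradient. -/
noncomputable def gradPow (p : ℝ) (ux uy : ℝ × ℝ → ℝ) (z : ℝ × ℝ) : ℝ :=
  (ux z ^ 2 + uy z ^ 2) ^ (p / 2)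

theorem HasGrad.continuous {u ux uy : ℝ × ℝ → ℝ} (h : HasGrad u ux uy) : Continuous u :=
  continuous_iff_continuousAt.2 fun z => (h.hasFDerivAt z).continuousAt

theorem HasGrad.continuous_gradPow {p : ℝ} (hp : 1 < p) {u ux uy : ℝ × ℝ → ℝ}
    (h : HasGrad u ux uy) : Continuous (gradPow p ux uy) :=
  ((h.continuous_fst.pow 2).add (h.continuous_snd.pow 2)).rpow_const
    fun _ => Or.inr (by linarith)

theorem gradPow_nonneg {p : ℝ} (ux uy : ℝ × ℝ → ℝ) (z : ℝ × ℝ) : 0 ≤ gradPow p ux uy z := by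
  unfold gradPow; positivity

theorem abs_rpow_eq_sq_rpow (t p : ℝ) : |t| ^ p = (t ^ 2) ^ (p / 2) := by
  rw [← sq_abs, ← Real.rpow_natCast, ← Real.rpow_mul (abs_nonneg t)]
  congr 1
  push_cast
  ring

theorem abs_directional_rpow_le {p : ℝ} (hp : 1 < p) (s : ℝ) (ux uy : ℝ × ℝ → ℝ) (z : ℝ × ℝ) :
    |ux z + s * uy z| ^ p ≤ (1 + s ^ 2) ^ (p / 2) * gradPow p ux uy z := by
  rw [abs_rpow_eq_sq_rpow, gradPow, ← Real.mul_rpow (by positivity) (by positivity)]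
  refine Real.rpow_le_rpow (by positivity) ?_ (by linarith)
  nlinarith [sq_nonneg (s * ux z - uy z)]

theorem HasGrad.hasDerivAt_line {u ux uy : ℝ × ℝ → ℝ} (h : HasGrad u ux uy) (y s a x : ℝ) :
    HasDerivAt (fun x => u (x, y + s * (x - a)))
      (ux (x, y + s * (x - a)) + s * uy (x, y + s * (x - a))) x := by
  have h1 : HasDerivAt (fun x : ℝ => (x, y + s * (x - a))) (1, s) x :=
    (hasDerivAt_id x).prodMk (((((hasDerivAt_id x).sub_const a).const_mul s).const_add y).congr_deriv
      (by simp))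
  exact ((h.hasFDerivAt (x, y + s * (x - a))).comp_hasDerivAt x h1).congr_deriv
    (by simp [mul_comm])

theorem HasGrad.swap {u ux uy : ℝ × ℝ → ℝ} (h : HasGrad u ux uy) :
    HasGrad (u ∘ Prod.swap) (uy ∘ Prod.swap) (ux ∘ Prod.swap) := by
  refine ⟨h.continuous_snd.comp continuous_swap, h.continuous_fst.comp continuous_swap,
    fun z => ?_⟩
  have h1 : HasFDerivAt (Prod.swap : ℝ × ℝ → ℝ × ℝ)
      ((ContinuousLinearMap.snd ℝ ℝ ℝ).prod (ContinuousLinearMap.fst ℝ ℝ ℝ)) z :=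
    ((ContinuousLinearMap.snd ℝ ℝ ℝ).prod (ContinuousLinearMap.fst ℝ ℝ ℝ)).hasFDerivAt
  refine ((h.hasFDerivAt z.swap).comp z h1).congr_fderiv ?_
  ext <;> simp

/-- Quantitative continuity of the integrands on a set. -/
def HasModulus (p : ℝ) (u ux uy : ℝ × ℝ → ℝ) (Q : Set (ℝ × ℝ)) (δ ε : ℝ) : Prop :=
  ∀ z ∈ Q, ∀ z' ∈ Q, dist z z' ≤ δ →
    (∀ w ∈ Q, |(|u z - u w| ^ p) - |u z' - u w| ^ p| ≤ ε) ∧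
    |(|u z| ^ p) - |u z'| ^ p| ≤ ε ∧ |gradPow p ux uy z - gradPow p ux uy z'| ≤ ε

theorem exists_hasModulus {p : ℝ} (hp : 1 < p) {u ux uy : ℝ × ℝ → ℝ} (h : HasGrad u ux uy)
    {Q : Set (ℝ × ℝ)} (hQ : IsCompact Q) {ε : ℝ} (hε : 0 < ε) :
    ∃ δ, 0 < δ ∧ HasModulus p u ux uy Q δ ε := by
  have c0 := h.continuous
  have pc : ∀ {X : Type} [TopologicalSpace X] {f : X → ℝ}, Continuous f →
      Continuous fun x => |f x| ^ p := fun hf => hf.abs.rpow_const fun _ => Or.inr (by linarith)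
  have u1 := (hQ.prod hQ).uniformContinuousOn_of_continuous
    (pc ((c0.comp continuous_fst).sub (c0.comp continuous_snd))).continuousOn
  have u2 := hQ.uniformContinuousOn_of_continuous (pc c0).continuousOn
  have u3 := hQ.uniformContinuousOn_of_continuous (h.continuous_gradPow hp).continuousOn
  rw [Metric.uniformContinuousOn_iff] at u1 u2 u3
  obtain ⟨d1, hd1, H1⟩ := u1 ε hε
  obtain ⟨d2, hd2, H2⟩ := u2 ε hε
  obtain ⟨d3, hd3, H3⟩ := u3 ε hε
  refine ⟨min d1 (min d2 d3) / 2, by positivity, fun z hz z' hz' hd => ?_⟩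
  have hlt : dist z z' < min d1 (min d2 d3) := hd.trans_lt (half_lt_self (by positivity))
  simp only [lt_min_iff] at hlt
  refine ⟨fun w hw => ?_, (H2 z hz z' hz' hlt.2.1).le, (H3 z hz z' hz' hlt.2.2).le⟩
  refine (H1 (z, w) ⟨hz, hw⟩ (z', w) ⟨hz', hw⟩ ?_).le
  rw [Prod.dist_eq]
  simp [hlt.1]

theorem HasModulus.mono {p : ℝ} {u ux uy : ℝ × ℝ → ℝ} {Q Q' : Set (ℝ × ℝ)} {δ δ' ε : ℝ}
    (h : HasModulus p u ux uy Q δ ε) (hQ : Q' ⊆ Q) (hδ : δ' ≤ δ) :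
    HasModulus p u ux uy Q' δ' ε := fun z hz z' hz' hd =>
  let H := h z (hQ hz) z' (hQ hz') (hd.trans hδ)
  ⟨fun w hw => H.1 w (hQ hw), H.2⟩

theorem HasModulus.swap {p : ℝ} {u ux uy : ℝ × ℝ → ℝ} {Q : Set (ℝ × ℝ)} {δ ε : ℝ}
    (h : HasModulus p u ux uy Q δ ε) :
    HasModulus p (u ∘ Prod.swap) (uy ∘ Prod.swap) (ux ∘ Prod.swap) (Prod.swap ⁻¹' Q) δ ε := by
  intro z hz z' hz' hd
  have H := h z.swap hz z'.swap hz' (by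
    rw [Prod.dist_eq] at hd ⊢
    simpa [max_comm] using hd)
  refine ⟨fun w hw => H.1 w.swap hw, H.2.1, ?_⟩
  simpa [gradPow, add_comm] using H.2.2

/-- The set `K` lies within vertical distance `δ` of a segment of slope at most one that joins
points of its closure over the end points of its projection. -/
structure Sheet (δ : ℝ) (K : Set (ℝ × ℝ)) (a b y s : ℝ) : Prop where
  lt : a < b
  proj : Prod.fst '' K = Ioo a b
  left : (a, y) ∈ closure K
  right : (b, y + s * (b - a)) ∈ closure K
  slope : |s| ≤ 1
  near : ∀ z ∈ K, |z.2 - (y + s * (z.1 - a))| ≤ δ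

theorem Sheet.line_mem {δ a b y s : ℝ} {K : Set (ℝ × ℝ)} (S : Sheet δ K a b y s)
    (hK : Convex ℝ K) {x : ℝ} (hx : x ∈ Icc a b) : (x, y + s * (x - a)) ∈ closure K := by
  have hab : 0 < b - a := sub_pos.2 S.lt
  have := hK.closure S.left S.right (a := (b - x) / (b - a)) (b := (x - a) / (b - a))
    (div_nonneg (by linarith [hx.2]) hab.le) (div_nonneg (by linarith [hx.1]) hab.le)
    (by field_simp; ring)
  convert this using 1
  simp only [Prod.smul_mk, Prod.mk_add_mk, smul_eq_mul]
  congr 1 <;> field_simp <;> ring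

/-- Subtracting a constant does not decrease the norm of a function with vanishing `p`-mean. -/
theorem PowConcave.wint_le_wint_sub {m : ℕ} {K : Set (ℝ × ℝ)} {φ : ℝ × ℝ → ℝ}
    (h : PowConcave m K φ) {p : ℝ} (hp : 1 < p) {u : ℝ × ℝ → ℝ} (hu : Continuous u)
    (hmean : wint K φ (fun z => sgnPow p (u z)) = 0) (κ : ℝ) :
    wint K φ (fun z => |u z| ^ p) ≤ wint K φ (fun z => |u z - κ| ^ p) := by
  have pc : ∀ {f : ℝ × ℝ → ℝ}, Continuous f → Continuous fun x => |f x| ^ p :=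
    fun hf => hf.abs.rpow_const fun _ => Or.inr (by linarith)
  have i1 := h.integrable_mul (pc hu)
  have i2 := h.integrable_mul (pc (f := fun z => u z - κ) (hu.sub continuous_const))
  have i3 := h.integrable_mul (F := fun z => sgnPow p (u z)) ((continuous_sgnPow hp).comp hu)
  unfold wint at hmean ⊢
  beta_reduce at hmean ⊢
  have : ∫ z, (K.indicator φ z * |u z| ^ p - p * κ * (K.indicator φ z * sgnPow p (u z))) ≤
      ∫ z, K.indicator φ z * |u z - κ| ^ p := by
    refine integral_mono (i1.sub (i3.const_mul _)) i2 fun z => ?_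
    have := mul_le_mul_of_nonneg_left (tangent_abs_rpow_le hp (u z) (u z - κ))
      (h.indicator_nonneg' z)
    simp only
    linarith
  rw [integral_sub i1 (i3.const_mul _), integral_const_mul, hmean] at this
  linarith

/-- The Poincaré inequality on a thin convex set deduced from that of its marginal. -/
theorem Sheet.poincare {m : ℕ} {K Q : Set (ℝ × ℝ)} {φ u ux uy : ℝ × ℝ → ℝ} {p Λ δ ε a b y s : ℝ}
    (hp : 1 < p) (hK : PowConcave m K φ) (S : Sheet δ K a b y s) (hg : HasGrad u ux uy)
    (hmod : HasModulus p u ux uy Q δ ε) (hQ : closure K ⊆ Q) (hΛ : 0 ≤ Λ)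
    (hP : HasPoincare p Λ fun x => marg K φ (a + (b - a) * x))
    (hmean : wint K φ (fun z => sgnPow p (u z)) = 0) :
    Λ * wint K φ (fun z => |u z| ^ p) ≤
      ((b - a) ^ 2 * (1 + s ^ 2)) ^ (p / 2) * wint K φ (gradPow p ux uy) +
      ε * (Λ + ((b - a) ^ 2 * (1 + s ^ 2)) ^ (p / 2)) * mass K φ := by
  have hab : 0 < b - a := sub_pos.2 S.lt
  set ln : ℝ → ℝ × ℝ := fun x => (x, y + s * (x - a)) with hln
  have cln : Continuous ln := by rw [hln]; fun_prop
  have cv' : Continuous fun x => ux (ln x) + s * uy (ln x) :=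
    (hg.continuous_fst.comp cln).add ((hg.continuous_snd.comp cln).const_mul s)
  have cgp := hg.continuous_gradPow hp
  have cgl : Continuous fun x => gradPow p ux uy (ln x) := cgp.comp cln
  obtain ⟨c, hc, hcell⟩ := hP.rescale S.lt (v := fun x => u (ln x))
    (v' := fun x => ux (ln x) + s * uy (ln x)) (fun x => hg.hasDerivAt_line y s a x) cv'
  have hlnQ : ∀ x ∈ Icc a b, ln x ∈ Q := fun x hx => hQ (S.line_mem hK.convex hx)
  have hproj : ∀ z ∈ K, z.1 ∈ Icc a b := fun z hz =>
    Ioo_subset_Icc_self (S.proj ▸ ⟨z, hz, rfl⟩)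
  have hnear : ∀ z ∈ K, dist z (ln z.1) ≤ δ := by
    intro z hz
    rw [Prod.dist_eq, hln]
    simp only [dist_self]
    rw [Real.dist_eq]
    exact max_le ((abs_nonneg _).trans (S.near z hz)) (S.near z hz)
  have pc : ∀ {X : Type} [TopologicalSpace X] {f : X → ℝ}, Continuous f →
      Continuous fun x => |f x| ^ p := fun hf => hf.abs.rpow_const fun _ => Or.inr (by linarith)
  have e1 := hK.abs_integral_sub_le (F := fun z => |u z - u (ln c)| ^ p)
    (pc (hg.continuous.sub continuous_const)) (f := fun x => |u (ln x) - u (ln c)| ^ p)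
    (pc ((hg.continuous.comp cln).sub continuous_const)) (ε := ε) fun z hz =>
      (hmod z (hQ (subset_closure hz)) _ (hlnQ _ (hproj z hz)) (hnear z hz)).1 _ (hlnQ c hc)
  have e2 := hK.abs_integral_sub_le (F := gradPow p ux uy) cgp cgl (ε := ε) fun z hz =>
      (hmod z (hQ (subset_closure hz)) _ (hlnQ _ (hproj z hz)) (hnear z hz)).2.2
  have e3 := hK.wint_le_wint_sub hp hg.continuous hmean (u (ln c))
  rw [abs_le] at e1 e2
  have e4 : ∫ x, marg K φ x * |ux (ln x) + s * uy (ln x)| ^ p ≤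
      (1 + s ^ 2) ^ (p / 2) * ∫ x, marg K φ x * gradPow p ux uy (ln x) := by
    rw [← integral_const_mul]
    refine integral_mono (hK.integrable_marg_mul (pc cv'))
      ((hK.integrable_marg_mul cgl).const_mul _) fun x => ?_
    have := mul_le_mul_of_nonneg_left (abs_directional_rpow_le hp s ux uy (ln x))
      (hK.marg_nonneg x)
    simp only
    linarith
  rw [← PowConcave.integral_marg_eq S.lt.le S.proj (fun x => |u (ln x) - u (ln c)| ^ p),
    ← PowConcave.integral_marg_eq S.lt.le S.proj
      (fun x => |ux (ln x) + s * uy (ln x)| ^ p)] at hcell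
  have e5 : ((b - a) ^ 2 * (1 + s ^ 2)) ^ (p / 2) = (b - a) ^ p * (1 + s ^ 2) ^ (p / 2) := by
    rw [Real.mul_rpow (by positivity) (by positivity), ← abs_rpow_eq_sq_rpow, abs_of_pos hab]
  rw [e5]
  have hX : 0 ≤ (b - a) ^ p := by positivity
  have hS : 0 ≤ (1 + s ^ 2) ^ (p / 2) := by positivity
  change _ ≤ _ * (∫ z, K.indicator φ z * gradPow p ux uy z) + _ * (∫ z, K.indicator φ z)
  change wint K φ (fun z => |u z| ^ p) ≤ ∫ z, K.indicator φ z * |u z - u (ln c)| ^ p at e3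
  have f1 := mul_le_mul_of_nonneg_left (e3.trans (sub_le_iff_le_add.1 e1.2)) hΛ
  have f2 := mul_le_mul_of_nonneg_left e4 hX
  have f3 := mul_le_mul_of_nonneg_left (neg_le_sub_iff_le_add.1 e2.1) (mul_nonneg hX hS)
  linarith

theorem ball_subset_of_triangle {C : Set (ℝ × ℝ)} (hC : Convex ℝ C) {a b y s x y' : ℝ}
    (hA : (a, y) ∈ C) (hB : (b, y + s * (b - a)) ∈ C) (hP : (x, y') ∈ C) (hax : a ≤ x)
    (hxb : x ≤ b) (hs : |s| ≤ 1) (ht : 0 < |y' - (y + s * (x - a))|)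
    (hle : |y' - (y + s * (x - a))| ≤ b - a) :
    ∃ z, Metric.ball z (|y' - (y + s * (x - a))| / 15) ⊆ C := by
  set τ := y' - (y + s * (x - a)) with hτ
  set t := |τ| with htd
  have hX : 0 < b - a := ht.trans_le hle
  have hτ0 : τ ≠ 0 := abs_pos.1 ht
  refine ⟨((a + b + x) / 3, (y + (y + s * (b - a)) + y') / 3), fun z hz => ?_⟩
  rw [Metric.mem_ball, Prod.dist_eq, max_lt_iff, Real.dist_eq, Real.dist_eq] at hz
  obtain ⟨h1, h2⟩ := hz
  simp only at h1 h2
  set dx := z.1 - (a + b + x) / 3 with hdx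
  set dy := z.2 - (y + (y + s * (b - a)) + y') / 3 with hdy
  have hsd : |s * dx| ≤ t / 15 := by
    rw [abs_mul]
    calc |s| * |dx| ≤ 1 * (t / 15) := mul_le_mul hs h1.le (abs_nonneg _) zero_le_one
      _ = t / 15 := one_mul _
  set e := (dy - s * dx) / τ with he
  have heτ : e * τ = dy - s * dx := div_mul_cancel₀ _ hτ0
  have he1 : |e| ≤ 2 / 15 := by
    rw [he, abs_div, div_le_iff₀ ht]
    calc |dy - s * dx| ≤ |dy| + |s * dx| := abs_sub _ _
      _ ≤ 2 / 15 * |τ| := by linarith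
  set r := (x - a) / (b - a) with hr
  have hr0 : 0 ≤ r := div_nonneg (by linarith) hX.le
  have hr1 : r ≤ 1 := (div_le_one hX).2 (by linarith)
  have hrX : r * (b - a) = x - a := div_mul_cancel₀ _ hX.ne'
  set f := dx / (b - a) with hf
  have hfX : f * (b - a) = dx := div_mul_cancel₀ _ hX.ne'
  have hf1 : |f| ≤ 1 / 15 := by
    rw [hf, abs_div, abs_of_pos hX, div_le_iff₀ hX]
    linarith
  have her : |e * r| ≤ 2 / 15 := by
    rw [abs_mul, abs_of_nonneg hr0]
    nlinarith [abs_nonneg e]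
  rw [abs_le] at he1 hf1 her
  have hmem := hC.sum_mem (t := Finset.univ) (w := ![1 / 3 - e - f + e * r, 1 / 3 + f - e * r, 1 / 3 + e])
    (z := ![(a, y), (b, y + s * (b - a)), (x, y')])
    (by
      intro i _
      fin_cases i <;> simp <;> linarith [he1.1, he1.2, hf1.1, hf1.2, her.1, her.2])
    (by simp [Fin.sum_univ_three]; ring)
    (by
      intro i _
      fin_cases i
      · exact hA
      · exact hB
      · exact hP)
  convert hmem using 1
  have hz1 : z.1 = dx + (a + b + x) / 3 := by rw [hdx]; ring
  have hz2 : z.2 = dy + (y + (y + s * (b - a)) + y') / 3 := by rw [hdy]; ring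
  have hx : x = a + r * (b - a) := by linarith
  have hy' : y' = τ + (y + s * (x - a)) := by rw [hτ]; ring
  have hdy' : dy = e * τ + s * dx := by linarith
  simp only [Fin.sum_univ_three, Matrix.cons_val_zero, Matrix.cons_val_one, Matrix.cons_val,
    Prod.smul_mk, Prod.mk_add_mk, smul_eq_mul]
  ext
  · simp only
    rw [hz1, hx, ← hfX]
    ring
  · simp only
    rw [hz2, hdy', hy', hx, ← hfX]
    ring

theorem exists_sheet {K : Set (ℝ × ℝ)} (ho : IsOpen K) (hc : Convex ℝ K)
    (hb : Bornology.IsBounded K) (hne : K.Nonempty) {δ a b a' b' : ℝ}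
    (hδ : ∀ z, ¬ Metric.ball z δ ⊆ K) (hab : a < b) (hx : Prod.fst '' K = Ioo a b)
    (hy : Prod.snd '' K = Ioo a' b') (hle : b' - a' ≤ b - a) :
    ∃ y s, Sheet (15 * δ) K a b y s := by
  have hcomp := hb.isCompact_closure
  have hproj : Icc a b ⊆ Prod.fst '' closure K := by
    rw [← closure_Ioo hab.ne, ← hx]
    exact closure_minimal (image_mono subset_closure) (hcomp.image continuous_fst).isClosed
  have hsnd : ∀ z ∈ closure K, z.2 ∈ Icc a' b' := by
    intro z hz
    refine closure_minimal (t := Prod.snd ⁻¹' Icc a' b') (fun w hw => ?_)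
      (isClosed_Icc.preimage continuous_snd) hz
    exact Ioo_subset_Icc_self (hy ▸ ⟨w, hw, rfl⟩)
  obtain ⟨⟨_, y⟩, hA, rfl⟩ := hproj (left_mem_Icc.2 hab.le)
  obtain ⟨⟨_, yB⟩, hB, rfl⟩ := hproj (right_mem_Icc.2 hab.le)
  rename_i a b
  simp only at *
  have hX : 0 < b - a := sub_pos.2 hab
  set s := (yB - y) / (b - a) with hs
  have hsX : s * (b - a) = yB - y := div_mul_cancel₀ _ hX.ne'
  have hA2 := hsnd _ hA
  have hB2 := hsnd _ hB
  have hsl : |s| ≤ 1 := by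
    rw [hs, abs_div, abs_of_pos hX, div_le_one hX, abs_le]
    constructor <;> linarith [hA2.1, hA2.2, hB2.1, hB2.2]
  have hB' : (b, y + s * (b - a)) ∈ closure K := by rw [hsX]; simpa using hB
  refine ⟨y, s, hab, hx, hA, hB', hsl, ?_⟩
  rintro ⟨x, y'⟩ hz
  simp only
  by_contra hlt
  push Not at hlt
  have hδ0 : 0 < δ := by
    by_contra h0
    exact hδ (a, y) (by rw [Metric.ball_eq_empty.2 (not_lt.1 h0)]; exact empty_subset _)
  have hxm : x ∈ Ioo a b := hx ▸ ⟨_, hz, rfl⟩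
  have hym : y' ∈ Icc a' b' := hsnd _ (subset_closure hz)
  have hr : s * (x - a) = (x - a) / (b - a) * (yB - y) := by rw [hs]; field_simp
  have hline : y + s * (x - a) ∈ Icc a' b' := by
    have h0 : 0 ≤ (x - a) / (b - a) := div_nonneg (by linarith [hxm.1]) hX.le
    have h1 : (x - a) / (b - a) ≤ 1 := (div_le_one hX).2 (by linarith [hxm.2])
    rw [hr]
    exact ⟨by nlinarith [hA2.1, hB2.1], by nlinarith [hA2.2, hB2.2]⟩
  obtain ⟨w, hw⟩ := ball_subset_of_triangle hc.closure hA hB' (subset_closure hz) hxm.1.le hxm.2.le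
    hsl (by linarith) (by
      rw [abs_le]; constructor <;> linarith [hym.1, hym.2, hline.1, hline.2])
  refine hδ w ?_
  have h1 : Metric.ball w δ ⊆ interior (closure K) :=
    interior_maximal ((Metric.ball_subset_ball (by linarith)).trans hw) Metric.isOpen_ball
  rwa [hc.interior_closure_eq_interior_of_nonempty_interior (by rwa [ho.interior_eq]),
    ho.interior_eq] at h1

/-- The open half plane through `z` with inner normal `(cos θ, sin θ)`. -/
def halfPlane (z : ℝ × ℝ) (θ : ℝ) : Set (ℝ × ℝ) :=
  {w | 0 < Real.cos θ * (w.1 - z.1) + Real.sin θ * (w.2 - z.2)}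

theorem isOpen_halfPlane (z : ℝ × ℝ) (θ : ℝ) : IsOpen (halfPlane z θ) :=
  isOpen_lt continuous_const (by fun_prop)

theorem convex_halfPlane (z : ℝ × ℝ) (θ : ℝ) : Convex ℝ (halfPlane z θ) := by
  intro w hw w' hw' a b ha hb hab
  simp only [halfPlane, mem_ofPred_eq] at hw hw' ⊢
  have e : Real.cos θ * ((a • w + b • w').1 - z.1) + Real.sin θ * ((a • w + b • w').2 - z.2) =
      a * (Real.cos θ * (w.1 - z.1) + Real.sin θ * (w.2 - z.2)) +
      b * (Real.cos θ * (w'.1 - z.1) + Real.sin θ * (w'.2 - z.2)) := by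
    obtain rfl : a = 1 - b := by linarith
    simp only [Prod.fst_add, Prod.snd_add, Prod.smul_fst, Prod.smul_snd, smul_eq_mul]
    ring
  rw [e]
  rcases ha.eq_or_lt with rfl | ha
  · obtain rfl : b = 1 := by linarith
    simpa using hw'
  · exact add_pos_of_pos_of_nonneg (mul_pos ha hw) (mul_nonneg hb hw'.le)

theorem mem_halfPlane_add_pi {z w : ℝ × ℝ} {θ : ℝ} : w ∈ halfPlane z (θ + Real.pi) ↔
    Real.cos θ * (w.1 - z.1) + Real.sin θ * (w.2 - z.2) < 0 := by
  simp only [halfPlane, mem_ofPred_eq, Real.cos_add_pi, Real.sin_add_pi]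
  constructor <;> intro h <;> linarith

theorem volume_line_eq_zero (z : ℝ × ℝ) (θ : ℝ) :
    volume {w : ℝ × ℝ | Real.cos θ * (w.1 - z.1) + Real.sin θ * (w.2 - z.2) = 0} = 0 := by
  let L : ℝ × ℝ →ₗ[ℝ] ℝ := Real.cos θ • LinearMap.fst ℝ ℝ ℝ + Real.sin θ • LinearMap.snd ℝ ℝ ℝ
  have h := Measure.addHaar_affineSubspace (volume : Measure (ℝ × ℝ))
    (AffineSubspace.mk' z (LinearMap.ker L)) (by
      intro htop
      have : z + (Real.cos θ, Real.sin θ) ∈ AffineSubspace.mk' z (LinearMap.ker L) := by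
        rw [htop]; trivial
      rw [AffineSubspace.mem_mk'] at this
      simp only [vsub_eq_sub, add_sub_cancel_left, LinearMap.mem_ker, L, LinearMap.add_apply,
        LinearMap.smul_apply, LinearMap.fst_apply, LinearMap.snd_apply, smul_eq_mul] at this
      nlinarith [Real.cos_sq_add_sin_sq θ])
  convert h using 2
  ext w
  simp [AffineSubspace.mem_mk', L]

theorem nonempty_inter_halfPlane {K : Set (ℝ × ℝ)} (hK : IsOpen K) {z : ℝ × ℝ} (hz : z ∈ K)
    (θ : ℝ) : (K ∩ halfPlane z θ).Nonempty := by
  have hc : Tendsto (fun t : ℝ => z + t • (Real.cos θ, Real.sin θ)) (𝓝[>] 0) (𝓝 z) := by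
    have : Continuous fun t : ℝ => z + t • (Real.cos θ, Real.sin θ) := by fun_prop
    simpa using (this.tendsto 0).mono_left nhdsWithin_le_nhds
  obtain ⟨t, ht, ht0⟩ := ((hc.eventually (hK.mem_nhds hz)).and self_mem_nhdsWithin).exists
  refine ⟨_, ht, ?_⟩
  simp only [halfPlane, mem_ofPred_eq, Prod.fst_add, Prod.snd_add, Prod.smul_fst, Prod.smul_snd,
    smul_eq_mul, add_sub_cancel_left]
  have ht0 : 0 < t := ht0
  nlinarith [Real.cos_sq_add_sin_sq θ]

theorem PowConcave.wint_inter_add {m : ℕ} {K : Set (ℝ × ℝ)} {φ F : ℝ × ℝ → ℝ}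
    (h : PowConcave m K φ) (hF : Continuous F) (z : ℝ × ℝ) (θ : ℝ) :
    wint (K ∩ halfPlane z θ) φ F + wint (K ∩ halfPlane z (θ + Real.pi)) φ F = wint K φ F := by
  have hm : ∀ θ, PowConcave m (K ∩ halfPlane z θ) φ := fun θ => h.mono inter_subset_left
    (h.isOpen.inter (isOpen_halfPlane z θ)) (h.convex.inter (convex_halfPlane z θ))
  unfold wint
  rw [← integral_add ((hm θ).integrable_mul hF) ((hm _).integrable_mul hF)]
  refine integral_congr_ae ?_
  have : ∀ᵐ w, w ∉ {w : ℝ × ℝ | Real.cos θ * (w.1 - z.1) + Real.sin θ * (w.2 - z.2) = 0} :=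
    measure_eq_zero_iff_ae_notMem.1 (volume_line_eq_zero z θ)
  filter_upwards [this] with w hw
  rw [← add_mul]
  congr 1
  rw [inter_comm, inter_comm K, ← indicator_indicator, ← indicator_indicator]
  rcases lt_or_gt_of_ne (show Real.cos θ * (w.1 - z.1) + Real.sin θ * (w.2 - z.2) ≠ 0 from hw)
    with h1 | h1
  · rw [indicator_of_notMem (s := halfPlane z θ) (not_lt.2 h1.le),
      indicator_of_mem (mem_halfPlane_add_pi.2 h1), zero_add]
  · rw [indicator_of_mem (s := halfPlane z θ) h1,
      indicator_of_notMem (fun hh => h1.le.not_gt (mem_halfPlane_add_pi.1 hh)), add_zero]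

theorem PowConcave.continuous_wint_inter {m : ℕ} {K : Set (ℝ × ℝ)} {φ F : ℝ × ℝ → ℝ}
    (h : PowConcave m K φ) (hF : Continuous F) (z : ℝ × ℝ) :
    Continuous fun θ => wint (K ∩ halfPlane z θ) φ F := by
  have hm : ∀ θ, PowConcave m (K ∩ halfPlane z θ) φ := fun θ => h.mono inter_subset_left
    (h.isOpen.inter (isOpen_halfPlane z θ)) (h.convex.inter (convex_halfPlane z θ))
  refine continuous_iff_continuousAt.2 fun θ => ?_
  refine continuousAt_of_dominated (bound := fun w => |K.indicator φ w * F w|)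
    (.of_forall fun θ => ((hm θ).integrable_mul hF).aestronglyMeasurable)
    (.of_forall fun θ => .of_forall fun w => ?_) (h.integrable_mul hF).abs ?_
  · rw [Real.norm_eq_abs, abs_mul, abs_mul, inter_comm, ← indicator_indicator]
    refine mul_le_mul_of_nonneg_right ?_ (abs_nonneg _)
    simpa only [Real.norm_eq_abs] using
      norm_indicator_le_norm_self (s := halfPlane z _) (K.indicator φ) w
  · have : ∀ᵐ w, w ∉ {w : ℝ × ℝ | Real.cos θ * (w.1 - z.1) + Real.sin θ * (w.2 - z.2) = 0} :=
      measure_eq_zero_iff_ae_notMem.1 (volume_line_eq_zero z θ)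
    filter_upwards [this] with w hw
    have hc : Continuous fun θ => Real.cos θ * (w.1 - z.1) + Real.sin θ * (w.2 - z.2) := by
      fun_prop
    refine ContinuousAt.mul ?_ continuousAt_const
    rcases lt_or_gt_of_ne (show Real.cos θ * (w.1 - z.1) + Real.sin θ * (w.2 - z.2) ≠ 0 from hw)
      with h1 | h1
    · refine (continuousAt_const (y := (0 : ℝ))).congr ?_
      filter_upwards [hc.continuousAt.eventually_lt continuousAt_const h1] with θ' h2
      rw [indicator_of_notMem fun hh => (not_lt.2 h2.le) hh.2]
    · refine (continuousAt_const (y := K.indicator φ w)).congr ?_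
      filter_upwards [continuousAt_const.eventually_lt hc.continuousAt h1] with θ' h2
      rw [inter_comm, ← indicator_indicator, indicator_of_mem (s := halfPlane z θ') h2]

theorem PowConcave.exists_bisection {m : ℕ} {K : Set (ℝ × ℝ)} {φ F : ℝ × ℝ → ℝ}
    (h : PowConcave m K φ) (hF : Continuous F) (hmean : wint K φ F = 0) (z : ℝ × ℝ) :
    ∃ θ, wint (K ∩ halfPlane z θ) φ F = 0 ∧ wint (K ∩ halfPlane z (θ + Real.pi)) φ F = 0 := by
  have hc := h.continuous_wint_inter hF z
  have hadd : ∀ θ, wint (K ∩ halfPlane z (θ + Real.pi)) φ F = -wint (K ∩ halfPlane z θ) φ F :=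
    fun θ => by linarith [h.wint_inter_add hF z θ]
  have : (0 : ℝ) ∈ range fun θ => wint (K ∩ halfPlane z θ) φ F := by
    rcases le_total (wint (K ∩ halfPlane z 0) φ F) 0 with h0 | h0
    · exact mem_range_of_exists_le_of_exists_ge hc ⟨0, h0⟩ ⟨0 + Real.pi, by linarith [hadd 0]⟩
    · exact mem_range_of_exists_le_of_exists_ge hc ⟨0 + Real.pi, by linarith [hadd 0]⟩ ⟨0, h0⟩
  obtain ⟨θ, hθ⟩ := this
  exact ⟨θ, hθ, by rw [hadd]; simpa using hθ⟩

/-- A finite family of disjoint open convex sets that exhausts `Ω` up to a null set and on each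
of which `F` has vanishing weighted mean. -/
structure IsConvexPartition (Ω : Set (ℝ × ℝ)) (φ F : ℝ × ℝ → ℝ) (P : Finset (Set (ℝ × ℝ))) :
    Prop where
  isOpen : ∀ K ∈ P, IsOpen K
  convex : ∀ K ∈ P, Convex ℝ K
  nonempty : ∀ K ∈ P, K.Nonempty
  subset : ∀ K ∈ P, K ⊆ Ω
  mean : ∀ K ∈ P, wint K φ F = 0
  disjoint : ∀ K ∈ P, ∀ L ∈ P, K ≠ L → Disjoint K L
  null : volume (Ω \ ⋃ K ∈ P, K) = 0

open Classical in
theorem PowConcave.exists_partition_avoiding {m : ℕ} {Ω : Set (ℝ × ℝ)} {φ F : ℝ × ℝ → ℝ}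
    (h : PowConcave m Ω φ) (hne : Ω.Nonempty) (hF : Continuous F) (hmean : wint Ω φ F = 0)
    (Z : Finset (ℝ × ℝ)) :
    ∃ P, IsConvexPartition Ω φ F P ∧ ∀ z ∈ Z, ∀ K ∈ P, z ∉ K := by
  induction Z using Finset.induction_on with
  | empty =>
    refine ⟨{Ω}, ⟨?_, ?_, ?_, ?_, ?_, ?_, ?_⟩, by simp⟩ <;>
      simp [h.isOpen, h.convex, hne, hmean]
  | insert z Z _ ih =>
    obtain ⟨P, hP, hZ⟩ := ih
    by_cases hz : ∃ K ∈ P, z ∈ K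
    · obtain ⟨K, hK, hzK⟩ := hz
      have hKc := h.mono (hP.subset K hK) (hP.isOpen K hK) (hP.convex K hK)
      obtain ⟨θ, h1, h2⟩ := hKc.exists_bisection hF (hP.mean K hK) z
      have hz1 : ∀ θ, z ∉ halfPlane z θ := fun θ => by simp [halfPlane]
      have hdisj : Disjoint (K ∩ halfPlane z θ) (K ∩ halfPlane z (θ + Real.pi)) := by
        rw [Set.disjoint_left]
        rintro w ⟨-, hw⟩ ⟨-, hw'⟩
        exact (mem_halfPlane_add_pi.1 hw').not_gt hw
      have hother : ∀ L ∈ P.erase K, Disjoint L K := fun L hL =>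
        hP.disjoint L (Finset.mem_of_mem_erase hL) K hK (Finset.ne_of_mem_erase hL)
      have hsplit : ∀ L, L ∈ insert (K ∩ halfPlane z θ)
          (insert (K ∩ halfPlane z (θ + Real.pi)) (P.erase K)) ↔
          L = K ∩ halfPlane z θ ∨ L = K ∩ halfPlane z (θ + Real.pi) ∨ L ∈ P.erase K := by simp
      refine ⟨insert (K ∩ halfPlane z θ) (insert (K ∩ halfPlane z (θ + Real.pi)) (P.erase K)),
        ⟨?_, ?_, ?_, ?_, ?_, ?_, ?_⟩, ?_⟩
      · intro L hL
        rcases (hsplit L).1 hL with rfl | rfl | hL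
        · exact hKc.isOpen.inter (isOpen_halfPlane _ _)
        · exact hKc.isOpen.inter (isOpen_halfPlane _ _)
        · exact hP.isOpen L (Finset.mem_of_mem_erase hL)
      · intro L hL
        rcases (hsplit L).1 hL with rfl | rfl | hL
        · exact hKc.convex.inter (convex_halfPlane _ _)
        · exact hKc.convex.inter (convex_halfPlane _ _)
        · exact hP.convex L (Finset.mem_of_mem_erase hL)
      · intro L hL
        rcases (hsplit L).1 hL with rfl | rfl | hL
        · exact nonempty_inter_halfPlane hKc.isOpen hzK _
        · exact nonempty_inter_halfPlane hKc.isOpen hzK _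
        · exact hP.nonempty L (Finset.mem_of_mem_erase hL)
      · intro L hL
        rcases (hsplit L).1 hL with rfl | rfl | hL
        · exact inter_subset_left.trans (hP.subset K hK)
        · exact inter_subset_left.trans (hP.subset K hK)
        · exact hP.subset L (Finset.mem_of_mem_erase hL)
      · intro L hL
        rcases (hsplit L).1 hL with rfl | rfl | hL
        · exact h1
        · exact h2
        · exact hP.mean L (Finset.mem_of_mem_erase hL)
      · intro L hL L' hL' hLL
        rcases (hsplit L).1 hL with rfl | rfl | hL <;>
          rcases (hsplit L').1 hL' with rfl | rfl | hL'
        · exact absurd rfl hLL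
        · exact hdisj
        · exact ((hother L' hL').symm).mono_left inter_subset_left
        · exact hdisj.symm
        · exact absurd rfl hLL
        · exact ((hother L' hL').symm).mono_left inter_subset_left
        · exact (hother L hL).mono_right inter_subset_left
        · exact (hother L hL).mono_right inter_subset_left
        · exact hP.disjoint L (Finset.mem_of_mem_erase hL) L' (Finset.mem_of_mem_erase hL') hLL
      · refine measure_mono_null ?_ (measure_union_null hP.null (volume_line_eq_zero z θ))
        rintro w ⟨hw, hw'⟩
        by_cases hwl : w ∈ ⋃ K ∈ P, K
        · right
          simp only [mem_iUnion, exists_prop] at hwl hw'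
          push Not at hw'
          obtain ⟨L, hL, hwL⟩ := hwl
          by_cases hLK : L = K
          · subst hLK
            have g1 : w ∉ halfPlane z θ := fun hh => hw' _ ((hsplit _).2 (Or.inl rfl)) ⟨hwL, hh⟩
            have g2 : w ∉ halfPlane z (θ + Real.pi) := fun hh =>
              hw' _ ((hsplit _).2 (Or.inr (Or.inl rfl))) ⟨hwL, hh⟩
            rw [mem_halfPlane_add_pi] at g2
            exact le_antisymm (not_lt.1 g1) (not_lt.1 g2)
          · exact absurd hwL (hw' L ((hsplit L).2 (Or.inr (Or.inr
              (Finset.mem_erase.2 ⟨hLK, hL⟩)))))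
        · exact Or.inl ⟨hw, hwl⟩
      · intro w hw L hL
        rcases Finset.mem_insert.1 hw with rfl | hw
        · rcases (hsplit L).1 hL with rfl | rfl | hL
          · exact fun hh => hz1 _ hh.2
          · exact fun hh => hz1 _ hh.2
          · exact fun hh => Set.disjoint_left.1 (hother L hL) hh hzK
        · rcases (hsplit L).1 hL with rfl | rfl | hL
          · exact fun hh => hZ w hw K hK hh.1
          · exact fun hh => hZ w hw K hK hh.1
          · exact hZ w hw L (Finset.mem_of_mem_erase hL)
    · push Not at hz
      refine ⟨P, hP, fun w hw K hK => ?_⟩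
      rcases Finset.mem_insert.1 hw with rfl | hw
      · exact hz K hK
      · exact hZ w hw K hK

/-- Partitions into cells without interior balls of a given radius. -/
theorem PowConcave.exists_fine_partition {m : ℕ} {Ω : Set (ℝ × ℝ)} {φ F : ℝ × ℝ → ℝ}
    (h : PowConcave m Ω φ) (hne : Ω.Nonempty) (hF : Continuous F) (hmean : wint Ω φ F = 0)
    {δ : ℝ} (hδ : 0 < δ) :
    ∃ P, IsConvexPartition Ω φ F P ∧ ∀ K ∈ P, ∀ z, ¬ Metric.ball z δ ⊆ K := by
  obtain ⟨Z, hZf, hZ⟩ := Metric.totallyBounded_iff.1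
    ((Metric.isCompact_of_isClosed_isBounded isClosed_closure h.isBounded.closure).totallyBounded.subset
      subset_closure) δ hδ
  obtain ⟨P, hP, hPZ⟩ := h.exists_partition_avoiding hne hF hmean hZf.toFinset
  refine ⟨P, hP, fun K hK z hz => ?_⟩
  have hzK : z ∈ K := hz (Metric.mem_ball_self hδ)
  obtain ⟨w, hw, hzw⟩ := mem_iUnion₂.1 (hZ (hP.subset K hK hzK))
  exact hPZ w (hZf.mem_toFinset.2 hw) K hK (hz (Metric.mem_ball'.2 hzw))

theorem IsConvexPartition.ae_indicator_eq {Ω : Set (ℝ × ℝ)} {φ F : ℝ × ℝ → ℝ}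
    {P : Finset (Set (ℝ × ℝ))} (hP : IsConvexPartition Ω φ F P) :
    ∀ᵐ w, ∑ K ∈ P, K.indicator φ w = Ω.indicator φ w := by
  filter_upwards [measure_eq_zero_iff_ae_notMem.1 hP.null] with w hw
  by_cases hwΩ : w ∈ Ω
  · have : w ∈ ⋃ K ∈ P, K := by
      by_contra hn
      exact hw ⟨hwΩ, hn⟩
    simp only [mem_iUnion, exists_prop] at this
    obtain ⟨K, hK, hwK⟩ := this
    rw [Finset.sum_eq_single_of_mem K hK, indicator_of_mem hwK, indicator_of_mem hwΩ]
    intro L hL hLK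
    exact indicator_of_notMem (fun hwL => Set.disjoint_left.1 (hP.disjoint L hL K hK hLK) hwL hwK) _
  · rw [indicator_of_notMem hwΩ]
    exact Finset.sum_eq_zero fun K hK => indicator_of_notMem (fun hh => hwΩ (hP.subset K hK hh)) _

theorem IsConvexPartition.sum_setIntegral {m : ℕ} {Ω : Set (ℝ × ℝ)} {φ F G : ℝ × ℝ → ℝ}
    {P : Finset (Set (ℝ × ℝ))} (hP : IsConvexPartition Ω φ F P) (h : PowConcave m Ω φ)
    (hG : Continuous G) (A : Set (ℝ × ℝ)) :
    ∑ K ∈ P, ∫ z in A, K.indicator φ z * G z = ∫ z in A, Ω.indicator φ z * G z := by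
  have hm : ∀ K ∈ P, PowConcave m K φ := fun K hK =>
    h.mono (hP.subset K hK) (hP.isOpen K hK) (hP.convex K hK)
  rw [← integral_finsetSum _ fun K hK => ((hm K hK).integrable_mul hG).integrableOn]
  refine integral_congr_ae (ae_restrict_of_ae ?_)
  filter_upwards [hP.ae_indicator_eq] with w hw
  rw [← Finset.sum_mul, hw]

theorem IsConvexPartition.sum_wint {m : ℕ} {Ω : Set (ℝ × ℝ)} {φ F G : ℝ × ℝ → ℝ}
    {P : Finset (Set (ℝ × ℝ))} (hP : IsConvexPartition Ω φ F P) (h : PowConcave m Ω φ)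
    (hG : Continuous G) : ∑ K ∈ P, wint K φ G = wint Ω φ G := by
  simpa only [setIntegral_univ, wint] using hP.sum_setIntegral h hG univ

theorem PowConcave.swap {m : ℕ} {K : Set (ℝ × ℝ)} {φ : ℝ × ℝ → ℝ} (h : PowConcave m K φ) :
    PowConcave m (Prod.swap ⁻¹' K) (φ ∘ Prod.swap) := by
  have hl : IsLinearMap ℝ (Prod.swap : ℝ × ℝ → ℝ × ℝ) := ⟨fun _ _ => rfl, fun _ _ => rfl⟩
  refine ⟨h.m_pos, h.isOpen.preimage continuous_swap, h.convex.is_linear_preimage hl, ?_,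
    fun z hz => h.pos _ hz, ?_, ?_⟩
  · rw [← Set.image_swap_eq_preimage_swap]
    have := (Metric.isCompact_of_isClosed_isBounded isClosed_closure h.isBounded.closure).image
      (continuous_swap (X := ℝ) (Y := ℝ))
    exact this.isBounded.subset (image_mono subset_closure)
  · exact h.concave.comp_linearMap hl.mk'
  · obtain ⟨C, hC⟩ := h.bdd
    exact ⟨C, fun z hz => hC _ hz⟩

theorem wint_swap (K : Set (ℝ × ℝ)) (φ F : ℝ × ℝ → ℝ) :
    wint (Prod.swap ⁻¹' K) (φ ∘ Prod.swap) (F ∘ Prod.swap) = wint K φ F := by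
  have := (Measure.measurePreserving_swap (μ := (volume : Measure ℝ))
    (ν := (volume : Measure ℝ))).integral_comp'
    (f := MeasurableEquiv.prodComm) (fun z => K.indicator φ z * F z)
  exact this

theorem mass_eq_wint (K : Set (ℝ × ℝ)) (φ : ℝ × ℝ → ℝ) : mass K φ = wint K φ fun _ => 1 := by
  simp [mass, wint]

theorem mass_swap (K : Set (ℝ × ℝ)) (φ : ℝ × ℝ → ℝ) :
    mass (Prod.swap ⁻¹' K) (φ ∘ Prod.swap) = mass K φ := by
  rw [mass_eq_wint, mass_eq_wint, ← wint_swap K φ]; rfl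

theorem PowConcave.wint_nonneg {m : ℕ} {K : Set (ℝ × ℝ)} {φ F : ℝ × ℝ → ℝ} (h : PowConcave m K φ)
    (hF : ∀ z, 0 ≤ F z) : 0 ≤ wint K φ F :=
  integral_nonneg fun z => mul_nonneg (h.indicator_nonneg' z) (hF z)

theorem PowConcave.mass_nonneg {m : ℕ} {K : Set (ℝ × ℝ)} {φ : ℝ × ℝ → ℝ} (h : PowConcave m K φ) :
    0 ≤ mass K φ :=
  integral_nonneg fun z => h.indicator_nonneg' z

/-- A thin convex set satisfies the sharp inequality up to an error. -/
theorem Sheet.poincare_piP {m : ℕ} {K Q : Set (ℝ × ℝ)} {φ u ux uy : ℝ × ℝ → ℝ}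
    {p δ ε a b y s : ℝ} (hp : 1 < p) (hK : PowConcave m K φ) (S : Sheet δ K a b y s)
    (hg : HasGrad u ux uy) (hmod : HasModulus p u ux uy Q δ ε) (hQ : closure K ⊆ Q)
    (hmean : wint K φ (fun z => sgnPow p (u z)) = 0) :
    piP p ^ p * wint K φ (fun z => |u z| ^ p) ≤
      ((b - a) ^ 2 * (1 + s ^ 2)) ^ (p / 2) * wint K φ (gradPow p ux uy) +
      ε * (piP p ^ p + ((b - a) ^ 2 * (1 + s ^ 2)) ^ (p / 2)) * mass K φ := by
  have hπ : 0 < piP p ^ p := Real.rpow_pos_of_pos (piP_pos hp) p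
  have hc : Continuous fun Λ : ℝ => ((b - a) ^ 2 * (1 + s ^ 2)) ^ (p / 2) *
      wint K φ (gradPow p ux uy) +
      ε * (Λ + ((b - a) ^ 2 * (1 + s ^ 2)) ^ (p / 2)) * mass K φ -
      Λ * wint K φ (fun z => |u z| ^ p) := by fun_prop
  have hev : ∀ᶠ Λ in 𝓝[<] (piP p ^ p), 0 ≤ ((b - a) ^ 2 * (1 + s ^ 2)) ^ (p / 2) *
      wint K φ (gradPow p ux uy) +
      ε * (Λ + ((b - a) ^ 2 * (1 + s ^ 2)) ^ (p / 2)) * mass K φ -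
      Λ * wint K φ (fun z => |u z| ^ p) := by
    filter_upwards [Ioo_mem_nhdsLT hπ] with Λ hΛ
    rw [sub_nonneg]
    exact S.poincare hp hK hg hmod hQ hΛ.1.le
      (hasPoincare_of_lt hp hΛ.1 hΛ.2 (hK.isLogConcaveWeight S.lt S.proj)) hmean
  exact sub_nonneg.1 (ge_of_tendsto (hc.continuousWithinAt (s := Iio (piP p ^ p))) hev)

theorem rpow_half_le_one_sub {p t ℓ : ℝ} (hp : 1 < p) (ht : t ≤ 1) (hℓ : 0 ≤ ℓ)
    (h : ℓ ≤ 1 - t) (ht0 : 0 ≤ t) : ℓ ^ (p / 2) ≤ 1 - t / 2 := by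
  calc ℓ ^ (p / 2) ≤ (1 - t) ^ (p / 2) := Real.rpow_le_rpow hℓ h (by linarith)
    _ ≤ (1 - t) ^ (1 / 2 : ℝ) := Real.rpow_le_rpow_of_exponent_ge_of_imp (by linarith)
        (by linarith) (by linarith) (fun h1 h2 => by linarith)
    _ ≤ 1 - t / 2 := by
        rw [← Real.sqrt_eq_rpow]
        refine Real.sqrt_le_iff.2 ⟨by linarith, by nlinarith [sq_nonneg t]⟩

/-- Short cells enjoy an improved constant. -/
theorem Sheet.gain_of_short {m : ℕ} {K Q : Set (ℝ × ℝ)} {φ u ux uy : ℝ × ℝ → ℝ}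
    {p δ ε a b y s t : ℝ} (hp : 1 < p) (hK : PowConcave m K φ) (S : Sheet δ K a b y s)
    (hg : HasGrad u ux uy) (hmod : HasModulus p u ux uy Q δ ε) (hQ : closure K ⊆ Q)
    (hmean : wint K φ (fun z => sgnPow p (u z)) = 0) (hε : 0 ≤ ε) (ht0 : 0 ≤ t) (ht : t ≤ 1)
    (hshort : (b - a) ^ 2 * (1 + s ^ 2) ≤ 1 - t) :
    (piP p ^ p * (1 + t / 2)) * wint K φ (fun z => |u z| ^ p) ≤
      wint K φ (gradPow p ux uy) + 2 * ε * (piP p ^ p + 1) * mass K φ := by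
  have h1 := S.poincare_piP hp hK hg hmod hQ hmean
  have hL := rpow_half_le_one_sub hp ht (by positivity) hshort ht0
  have hL0 : 0 ≤ ((b - a) ^ 2 * (1 + s ^ 2)) ^ (p / 2) := by positivity
  set L := ((b - a) ^ 2 * (1 + s ^ 2)) ^ (p / 2)
  set E := wint K φ (gradPow p ux uy)
  have hE : 0 ≤ E := hK.wint_nonneg (gradPow_nonneg ux uy)
  have hμ := hK.mass_nonneg
  have hπ : 0 < piP p ^ p := Real.rpow_pos_of_pos (piP_pos hp) p
  have h2 : piP p ^ p * wint K φ (fun z => |u z| ^ p) ≤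
      (1 - t / 2) * E + ε * (piP p ^ p + 1) * mass K φ := by
    refine h1.trans ?_
    gcongr
    linarith
  have h3 := mul_le_mul_of_nonneg_left h2 (show 0 ≤ 1 + t / 2 by linarith)
  have h4 : (1 + t / 2) * ((1 - t / 2) * E) ≤ E := by nlinarith [sq_nonneg t]
  have h5 : (1 + t / 2) * (ε * (piP p ^ p + 1) * mass K φ) ≤
      2 * (ε * (piP p ^ p + 1) * mass K φ) := by gcongr; linarith
  linarith

/-- Cells whose marginal is not flat enjoy an improved constant. -/
theorem Sheet.gain_of_hasPoincare {m : ℕ} {K Q : Set (ℝ × ℝ)} {φ u ux uy : ℝ × ℝ → ℝ}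
    {p δ ε a b y s g : ℝ} (hp : 1 < p) (hK : PowConcave m K φ) (S : Sheet δ K a b y s)
    (hg : HasGrad u ux uy) (hmod : HasModulus p u ux uy Q δ ε) (hQ : closure K ⊆ Q)
    (hmean : wint K φ (fun z => sgnPow p (u z)) = 0) (hε : 0 ≤ ε) (hg0 : 0 ≤ g)
    (hlen : (b - a) ^ 2 * (1 + s ^ 2) ≤ 1)
    (hP : HasPoincare p (piP p ^ p + g) fun x => marg K φ (a + (b - a) * x)) :
    (piP p ^ p + g) * wint K φ (fun z => |u z| ^ p) ≤
      wint K φ (gradPow p ux uy) + ε * (piP p ^ p + g + 1) * mass K φ := by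
  have hπ : 0 < piP p ^ p := Real.rpow_pos_of_pos (piP_pos hp) p
  have h1 := S.poincare hp hK hg hmod hQ (by linarith) hP hmean
  have hL : ((b - a) ^ 2 * (1 + s ^ 2)) ^ (p / 2) ≤ 1 :=
    Real.rpow_le_one (by positivity) hlen (by linarith)
  have hE : 0 ≤ wint K φ (gradPow p ux uy) := hK.wint_nonneg (gradPow_nonneg ux uy)
  have hμ := hK.mass_nonneg
  refine h1.trans ?_
  have : ((b - a) ^ 2 * (1 + s ^ 2)) ^ (p / 2) * wint K φ (gradPow p ux uy) ≤
      wint K φ (gradPow p ux uy) := mul_le_of_le_one_left hE hL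
  gcongr

/-- A planar convex set of diameter one along the horizontal axis, with vertical chords of length
at most `η`. -/
structure NarrowDomain (η : ℝ) (Ω : Set (ℝ × ℝ)) : Prop where
  pos : 0 < η
  isOpen : IsOpen Ω
  convex : Convex ℝ Ω
  dist_le : ∀ z ∈ Ω, ∀ w ∈ Ω, (z.1 - w.1) ^ 2 + (z.2 - w.2) ^ 2 ≤ 1
  abs_snd_le : ∀ z ∈ Ω, |z.2| ≤ η
  fst_mem : ∀ z ∈ Ω, z.1 ∈ Ioo (0 : ℝ) 1
  width_le : ∀ x, width Ω x ≤ η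
  le_width : ∀ x ∈ Icc (0 : ℝ) 1, min x (1 - x) * η ≤ width Ω x

theorem NarrowDomain.dist_le_closure {η : ℝ} {Ω : Set (ℝ × ℝ)} (h : NarrowDomain η Ω)
    {z w : ℝ × ℝ} (hz : z ∈ closure Ω) (hw : w ∈ closure Ω) :
    (z.1 - w.1) ^ 2 + (z.2 - w.2) ^ 2 ≤ 1 := by
  have : (z, w) ∈ closure (Ω ×ˢ Ω) := by rw [closure_prod_eq]; exact ⟨hz, hw⟩
  refine closure_minimal (s := Ω ×ˢ Ω)
    (t := {q : (ℝ × ℝ) × ℝ × ℝ | (q.1.1 - q.2.1) ^ 2 + (q.1.2 - q.2.2) ^ 2 ≤ 1}) ?_ ?_ this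
  · rintro ⟨a, b⟩ ⟨ha, hb⟩
    exact h.dist_le a ha b hb
  · exact isClosed_le (by fun_prop) (by fun_prop)

theorem NarrowDomain.abs_snd_le_closure {η : ℝ} {Ω : Set (ℝ × ℝ)} (h : NarrowDomain η Ω)
    {z : ℝ × ℝ} (hz : z ∈ closure Ω) : |z.2| ≤ η :=
  closure_minimal (s := Ω) (t := {z : ℝ × ℝ | |z.2| ≤ η}) h.abs_snd_le
    (isClosed_le (by fun_prop) (by fun_prop)) hz

theorem NarrowDomain.fst_mem_closure {η : ℝ} {Ω : Set (ℝ × ℝ)} (h : NarrowDomain η Ω)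
    {z : ℝ × ℝ} (hz : z ∈ closure Ω) : z.1 ∈ Icc (0 : ℝ) 1 :=
  closure_minimal (s := Ω) (t := Prod.fst ⁻¹' Icc (0 : ℝ) 1)
    (fun z hz => Ioo_subset_Icc_self (h.fst_mem z hz)) (isClosed_Icc.preimage continuous_fst) hz

/-- A long thin cell with flat marginal. -/
def IsLongFlat (δ τ s₀ δ₁ : ℝ) (K : Set (ℝ × ℝ)) (φ : ℝ × ℝ → ℝ) (a b y s : ℝ) : Prop :=
  Sheet δ K a b y s ∧ 1 - τ < (b - a) ^ 2 * (1 + s ^ 2) ∧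
    IsFlat s₀ δ₁ fun x => marg K φ (a + (b - a) * x)

/-- Every thin cell of a narrow domain satisfies the sharp inequality up to an error, with an
improved constant unless the cell is long and flat. -/
theorem NarrowDomain.cell_inequality {m : ℕ} {η : ℝ} {Ω K Q : Set (ℝ × ℝ)}
    {φ u ux uy : ℝ × ℝ → ℝ} {p δ ε τ g κ s₀ δ₁ : ℝ} (hΩ : NarrowDomain η Ω) (hp : 1 < p)
    (hK : PowConcave m K φ) (hKΩ : K ⊆ Ω) (hne : K.Nonempty) (hg : HasGrad u ux uy)
    (hmod : HasModulus p u ux uy Q (15 * δ) ε) (hQ : closure K ⊆ Q)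
    (hball : ∀ z, ¬ Metric.ball z δ ⊆ K)
    (hmean : wint K φ (fun z => sgnPow p (u z)) = 0) (hε : 0 ≤ ε) (hg0 : 0 ≤ g)
    (hgain : ∀ h, IsLogConcaveWeight h → ¬ IsFlat s₀ δ₁ h → HasPoincare p (piP p ^ p + g) h)
    (hτ0 : 0 ≤ τ) (hτ : τ ≤ 1) (hητ : 8 * η ^ 2 ≤ 1 - τ) (hκ : κ ≤ g)
    (hκτ : κ ≤ piP p ^ p * (τ / 2)) :
    piP p ^ p * wint K φ (fun z => |u z| ^ p) ≤
      wint K φ (gradPow p ux uy) + 2 * ε * (piP p ^ p + g + 1) * mass K φ ∧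
    ((piP p ^ p + κ) * wint K φ (fun z => |u z| ^ p) ≤
      wint K φ (gradPow p ux uy) + 2 * ε * (piP p ^ p + g + 1) * mass K φ ∨
      ∃ a b y s, IsLongFlat (15 * δ) τ s₀ δ₁ K φ a b y s) := by
  have hπ : 0 < piP p ^ p := Real.rpow_pos_of_pos (piP_pos hp) p
  have hμ := hK.mass_nonneg
  have hM : 0 ≤ wint K φ (fun z => |u z| ^ p) := hK.wint_nonneg fun z => by positivity
  have herr : 2 * ε * (piP p ^ p + 1) * mass K φ ≤ 2 * ε * (piP p ^ p + g + 1) * mass K φ := by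
    gcongr; linarith
  have herr' : ε * (piP p ^ p + g + 1) * mass K φ ≤ 2 * ε * (piP p ^ p + g + 1) * mass K φ := by
    gcongr; linarith
  have weaken : ∀ {κ'}, κ ≤ κ' → (piP p ^ p + κ) * wint K φ (fun z => |u z| ^ p) ≤
      (piP p ^ p + κ') * wint K φ (fun z => |u z| ^ p) := fun h => by gcongr
  have weaken0 : ∀ {κ'}, 0 ≤ κ' → piP p ^ p * wint K φ (fun z => |u z| ^ p) ≤
      (piP p ^ p + κ') * wint K φ (fun z => |u z| ^ p) := fun h => by gcongr; linarith
  have e0 : piP p ^ p * (1 + τ / 2) = piP p ^ p + piP p ^ p * (τ / 2) := by ring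
  obtain ⟨a, b, hab, hx⟩ := exists_image_fst_eq_Ioo hK.isOpen hK.convex hK.isBounded hne
  obtain ⟨a', b', hab', hy⟩ := exists_image_fst_eq_Ioo hK.swap.isOpen hK.swap.convex
    hK.swap.isBounded (hne.preimage Prod.swap_surjective)
  have hy' : Prod.snd '' K = Ioo a' b' := by
    rw [← hy, ← Set.image_swap_eq_preimage_swap, image_image]; rfl
  have hx' : Prod.snd '' (Prod.swap ⁻¹' K) = Ioo a b := by
    rw [← hx, ← Set.image_swap_eq_preimage_swap, image_image]; rfl
  rcases le_or_gt (b' - a') (b - a) with hle | hlt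
  · obtain ⟨y, s, S⟩ := exists_sheet hK.isOpen hK.convex hK.isBounded hne hball hab hx hy' hle
    have hlen : (b - a) ^ 2 * (1 + s ^ 2) ≤ 1 := by
      have := hΩ.dist_le_closure (closure_mono hKΩ S.right) (closure_mono hKΩ S.left)
      simp only at this
      linarith
    refine ⟨?_, ?_⟩
    · have := S.gain_of_short hp hK hg hmod hQ hmean hε le_rfl zero_le_one (by linarith)
      simp only [zero_div, add_zero, mul_one] at this
      linarith
    · by_cases hs : (b - a) ^ 2 * (1 + s ^ 2) ≤ 1 - τ
      · left
        have := S.gain_of_short hp hK hg hmod hQ hmean hε hτ0 hτ hs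
        rw [e0] at this
        linarith [weaken hκτ]
      · by_cases hf : IsFlat s₀ δ₁ fun x => marg K φ (a + (b - a) * x)
        · exact Or.inr ⟨a, b, y, s, S, not_le.1 hs, hf⟩
        · left
          have := S.gain_of_hasPoincare hp hK hg hmod hQ hmean hε hg0 hlen
            (hgain _ (hK.isLogConcaveWeight hab hx) hf)
          linarith [weaken hκ]
  · have hball' : ∀ z, ¬ Metric.ball z δ ⊆ Prod.swap ⁻¹' K := by
      intro z hz
      refine hball z.swap fun w hw => ?_
      have := hz (show w.swap ∈ Metric.ball z δ by
        rw [Metric.mem_ball, Prod.dist_eq] at hw ⊢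
        simpa [and_comm] using hw)
      simpa using this
    obtain ⟨y, s, S⟩ := exists_sheet hK.swap.isOpen hK.swap.convex hK.swap.isBounded
      (hne.preimage Prod.swap_surjective) hball' hab' hy hx' hlt.le
    have hcl : ∀ {z : ℝ × ℝ}, z ∈ closure (Prod.swap ⁻¹' K) → z.swap ∈ closure K := fun hz =>
      continuous_swap.closure_preimage_subset K hz
    have hext : b' - a' ≤ 2 * η := by
      have h1 := abs_le.1 (hΩ.abs_snd_le_closure (closure_mono hKΩ (hcl S.left)))
      have h2 := abs_le.1 (hΩ.abs_snd_le_closure (closure_mono hKΩ (hcl S.right)))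
      simp only [Prod.swap_prod_mk] at h1 h2
      linarith
    have hshort : (b' - a') ^ 2 * (1 + s ^ 2) ≤ 1 - τ := by
      have h1 : (b' - a') ^ 2 ≤ (2 * η) ^ 2 := pow_le_pow_left₀ (sub_nonneg.2 hab'.le) hext 2
      have h2 : s ^ 2 ≤ 1 := (sq_le_one_iff_abs_le_one s).2 S.slope
      nlinarith [sq_nonneg (b' - a'), sq_nonneg η]
    have hmean' : wint (Prod.swap ⁻¹' K) (φ ∘ Prod.swap)
        (fun z => sgnPow p ((u ∘ Prod.swap) z)) = 0 :=
      (wint_swap K φ fun z => sgnPow p (u z)).trans hmean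
    have key := S.gain_of_short hp hK.swap hg.swap hmod.swap (fun z hz => hQ (hcl hz)) hmean' hε
      hτ0 hτ hshort
    have hM' : wint (Prod.swap ⁻¹' K) (φ ∘ Prod.swap) (fun z => |(u ∘ Prod.swap) z| ^ p) =
      wint K φ fun z => |u z| ^ p := wint_swap K φ fun z => |u z| ^ p
    have hE' : wint (Prod.swap ⁻¹' K) (φ ∘ Prod.swap)
        (gradPow p (uy ∘ Prod.swap) (ux ∘ Prod.swap)) = wint K φ (gradPow p ux uy) := by
      rw [← wint_swap K φ (gradPow p ux uy)]
      congr 1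
      funext z
      simp [gradPow, add_comm]
    rw [hM', hE', mass_swap, e0] at key
    have hτ' : 0 ≤ piP p ^ p * (τ / 2) := by positivity
    exact ⟨by linarith [weaken0 hτ'], Or.inl (by linarith [weaken hκτ])⟩

theorem Continuous.abs_rpow_const {X : Type*} [TopologicalSpace X] {f : X → ℝ} {p : ℝ}
    (hp : 1 < p) (hf : Continuous f) : Continuous fun x => |f x| ^ p :=
  hf.abs.rpow_const fun _ => Or.inr (by linarith)

namespace PowConcave

variable {m : ℕ} {K : Set (ℝ × ℝ)} {φ : ℝ × ℝ → ℝ}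

theorem integrable_slice_mul (h : PowConcave m K φ) (x : ℝ) {f : ℝ → ℝ} (hf : Continuous f) :
    Integrable fun y => K.indicator φ (x, y) * f y := by
  obtain ⟨C, hC0, hC⟩ := h.exists_bound
  have hb := isBounded_slice h.isBounded x
  obtain ⟨B, hB⟩ := hb.isCompact_closure.exists_bound_of_continuousOn hf.continuousOn
  have h1 : IntegrableOn (fun y => K.indicator φ (x, y) * f y) (slice K x) := by
    refine Measure.integrableOn_of_bounded (M := C * B) hb.measure_lt_top.ne
      ((h.measurable_indicator.comp measurable_prodMk_left).mul
        hf.measurable).aestronglyMeasurable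
      (ae_restrict_of_forall_mem (isOpen_slice h.isOpen x).measurableSet fun y hy => ?_)
    rw [norm_mul, Real.norm_of_nonneg (h.indicator_nonneg' _)]
    exact mul_le_mul (hC _) (hB y (subset_closure hy)) (norm_nonneg _) hC0.le
  refine (integrableOn_iff_integrable_of_support_subset fun y hy => ?_).1 h1
  by_contra hn
  refine hy ?_
  beta_reduce
  rw [indicator_of_notMem (show (x, y) ∉ K from hn), zero_mul]

theorem setIntegral_fst_preimage (h : PowConcave m K φ) {F : ℝ × ℝ → ℝ} (hF : Continuous F)
    (T : Set ℝ) : ∫ z in Prod.fst ⁻¹' T, K.indicator φ z * F z =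
      ∫ x in T, ∫ y, K.indicator φ (x, y) * F (x, y) := by
  rw [← prod_univ, Measure.volume_eq_prod, setIntegral_prod _ (h.integrable_mul hF).integrableOn]
  simp

/-- On a slice, the weighted norm is controlled by that on a subset of at least half the length and
by the derivative. -/
theorem slice_estimate (h : PowConcave m K φ) {p : ℝ} (hp : 1 < p) {v v' : ℝ → ℝ}
    (hv : ∀ y, HasDerivAt v (v' y) y) (hv' : Continuous v') {x η : ℝ} {G : Set ℝ}
    (hG : MeasurableSet G) (hwη : width K x ≤ η)
    (hGw : width K x / 2 ≤ volume.real (slice K x ∩ G)) :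
    ∫ y, K.indicator φ (x, y) * |v y| ^ p ≤ 2 ^ (p + 1) * 4 ^ m *
      ((∫ y in G, K.indicator φ (x, y) * |v y| ^ p) +
        η ^ p * ∫ y, K.indicator φ (x, y) * |v' y| ^ p) := by
  set ρ : ℝ → ℝ := fun y => K.indicator φ (x, y) with hρdef
  have hvc : Continuous v := continuous_iff_continuousAt.2 fun y => (hv y).continuousAt
  have hρ0 : ∀ y, 0 ≤ ρ y := fun y => h.indicator_nonneg' _
  have i1 : Integrable fun y => ρ y * |v y| ^ p := h.integrable_slice_mul x (hvc.abs_rpow_const hp)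
  have i2 : Integrable fun y => ρ y * |v' y| ^ p :=
    h.integrable_slice_mul x (hv'.abs_rpow_const hp)
  set A := ∫ y in G, ρ y * |v y| ^ p with hA
  set B := ∫ y, ρ y * |v' y| ^ p with hB
  have hA0 : 0 ≤ A := integral_nonneg fun y => mul_nonneg (hρ0 y) (by positivity)
  have hB0 : 0 ≤ B := integral_nonneg fun y => mul_nonneg (hρ0 y) (by positivity)
  have hms := (isOpen_slice h.isOpen x).measurableSet
  have hfin : volume (slice K x) ≠ ⊤ := (isBounded_slice h.isBounded x).measure_lt_top.ne
  have hzero : ∀ y, y ∉ slice K x → ρ y = 0 := fun y hy =>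
    indicator_of_notMem (show (x, y) ∉ K from hy) _
  have hw0 : 0 ≤ width K x := measureReal_nonneg
  rcases hw0.eq_or_lt with hw | hw
  · have hnull : volume (slice K x) = 0 := by
      rcases (measureReal_eq_zero_iff hfin).1 hw.symm with h0
      exact h0
    have : ∫ y, ρ y * |v y| ^ p = 0 := by
      refine integral_eq_zero_of_ae ?_
      filter_upwards [measure_eq_zero_iff_ae_notMem.1 hnull] with y hy
      simp [hzero y hy]
    rw [this]
    have hη : 0 ≤ η := hw0.trans hwη
    positivity
  set w := width K x with hwdef
  have hpt : ∀ y ∈ slice K x, ρ y * |v y| ^ p ≤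
      2 ^ (p + 1) * 4 ^ m * (A / w + w ^ (p - 1) * B) := by
    intro y hy
    obtain ⟨a, b, hab, hyab, hlen, hS⟩ := h.exists_subinterval hy
    have hSs : Ioo a b ⊆ slice K x := fun t ht => (hS t ht).1
    set Z := G ∩ Ioo a b with hZdef
    have hZm : MeasurableSet Z := hG.inter measurableSet_Ioo
    have hZs : Z ⊆ slice K x := inter_subset_right.trans hSs
    have hZfin : volume Z ≠ ⊤ := ne_top_of_le_ne_top hfin (measure_mono hZs)
    have hZw : w / 4 ≤ volume.real Z := by
      have e1 : volume.real (Ioo a b) = 3 / 4 * w := by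
        rw [Real.volume_real_Ioo_of_le hab.le, hlen]
      have e2 := measureReal_union_add_inter (μ := volume) (s := slice K x ∩ G) (t := Ioo a b)
        measurableSet_Ioo (ne_top_of_le_ne_top hfin (measure_mono inter_subset_left))
        (by simp)
      have e3 : volume.real (slice K x ∩ G ∪ Ioo a b) ≤ w :=
        measureReal_mono (union_subset inter_subset_left hSs) hfin
      have e4 : slice K x ∩ G ∩ Ioo a b = Z := by
        rw [hZdef, inter_assoc, inter_eq_right]
        exact hZs
      rw [e4] at e2
      linarith
    have hxy : ∀ s ∈ slice K x, ∀ t ∈ slice K x, |s - t| ≤ w := by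
      obtain ⟨c, d, hcd, hsl⟩ := exists_eq_Ioo_of_convex (isOpen_slice h.isOpen x)
        (convex_slice h.convex x) (isBounded_slice h.isBounded x) ⟨y, hy⟩
      have : w = d - c := by
        rw [hwdef, width, hsl, Real.volume_real_Ioo_of_le hcd.le]
      rw [hsl, this]
      intro s hs t ht
      exact abs_le.2 ⟨by linarith [hs.1, hs.2, ht.1, ht.2], by linarith [hs.1, hs.2, ht.1, ht.2]⟩
    have key := weight_mul_abs_rpow_le (x := y) (ρ := ρ) (K := 4 ^ m) (L := w) hp hv hv' hms hZm hZs hZfin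
      (by positivity) (fun t _ => hρ0 t) hy i1.integrableOn i2.integrableOn
      (fun z hz => hxy y hy z (hZs hz)) (fun z hz t ht => by
        have hts : t ∈ Ioo a b := (ordConnected_Ioo.uIcc_subset hyab hz.2) ht
        refine ⟨hSs hts, ?_⟩
        have h1 := (hS t hts).2
        have e1 : ρ y = φ (x, y) := indicator_of_mem (show (x, y) ∈ K from hy) _
        have e2 : ρ t = φ (x, t) := indicator_of_mem (show (x, t) ∈ K from hSs hts) _
        rw [e1, e2]
        calc φ (x, y) = 4 ^ m * ((1 / 4) ^ m * φ (x, y)) := by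
              rw [← mul_assoc, ← mul_pow]; norm_num
          _ ≤ _ := by gcongr)
    have hZA : ∫ t in Z, ρ t * |v t| ^ p ≤ A :=
      setIntegral_mono_set i1.integrableOn (.of_forall fun t => mul_nonneg (hρ0 t) (by positivity))
        (ae_of_all _ (fun t ht => ht.1) : Z ≤ᵐ[volume] G)
    have hIB : ∫ t in slice K x, ρ t * |v' t| ^ p ≤ B :=
      setIntegral_le_integral i2 (.of_forall fun t => mul_nonneg (hρ0 t) (by positivity))
    have hZpos : 0 < volume.real Z := by linarith
    have h3 : (2 : ℝ) ^ (p + 1) = 4 * 2 ^ (p - 1) := by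
      rw [show p + 1 = 2 + (p - 1) by ring, Real.rpow_add two_pos]; norm_num
    have h2 : A ≤ volume.real Z * (4 * (A / w)) := by
      have : A = w / 4 * (4 * (A / w)) := by field_simp
      calc A = w / 4 * (4 * (A / w)) := this
        _ ≤ _ := by gcongr
    have h4 : ρ y * |v y| ^ p * volume.real Z ≤
        (2 ^ (p + 1) * 4 ^ m * (A / w + w ^ (p - 1) * B)) * volume.real Z := by
      refine key.trans ?_
      rw [h3]
      calc 2 ^ (p - 1) * 4 ^ m * ((∫ t in Z, ρ t * |v t| ^ p) +
            w ^ (p - 1) * volume.real Z * ∫ t in slice K x, ρ t * |v' t| ^ p)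
          ≤ 2 ^ (p - 1) * 4 ^ m * (volume.real Z * (4 * (A / w)) +
            w ^ (p - 1) * volume.real Z * (4 * B)) := by
            gcongr
            · exact hZA.trans h2
            · linarith
        _ = _ := by ring
    exact le_of_mul_le_mul_right h4 hZpos
  have hInt : ∫ y, ρ y * |v y| ^ p = ∫ y in slice K x, ρ y * |v y| ^ p :=
    (setIntegral_eq_integral_of_forall_compl_eq_zero fun y hy => by simp [hzero y hy]).symm
  rw [hInt]
  have hle : ∫ y in slice K x, ρ y * |v y| ^ p ≤
      ∫ y in slice K x, 2 ^ (p + 1) * 4 ^ m * (A / w + w ^ (p - 1) * B) :=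
    setIntegral_mono_on i1.integrableOn (integrableOn_const hfin) hms hpt
  refine hle.trans ?_
  rw [setIntegral_const, smul_eq_mul]
  change w * _ ≤ _
  have e5 : w * w ^ (p - 1) = w ^ p := by
    rw [mul_comm, ← Real.rpow_add_one hw.ne']; ring_nf
  have e6 : w ^ p ≤ η ^ p := Real.rpow_le_rpow hw.le hwη (by linarith)
  calc w * (2 ^ (p + 1) * 4 ^ m * (A / w + w ^ (p - 1) * B))
      = 2 ^ (p + 1) * 4 ^ m * (A + w * w ^ (p - 1) * B) := by field_simp
    _ ≤ _ := by rw [e5]; gcongr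

/-- The weighted norm over a vertical strip is controlled by that on a set meeting every vertical
chord of the strip in at least half its length. -/
theorem strip_estimate (h : PowConcave m K φ) {p : ℝ} (hp : 1 < p) {u ux uy : ℝ × ℝ → ℝ}
    (hg : HasGrad u ux uy) {η : ℝ} (hη : 0 ≤ η) {G : Set (ℝ × ℝ)} (hG : MeasurableSet G)
    {T : Set ℝ} (hT : MeasurableSet T) (hwη : ∀ x, width K x ≤ η)
    (hGw : ∀ x ∈ T, width K x / 2 ≤ volume.real (slice K x ∩ slice G x)) :
    ∫ z in Prod.fst ⁻¹' T, K.indicator φ z * |u z| ^ p ≤ 2 ^ (p + 1) * 4 ^ m *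
      ((∫ z in G, K.indicator φ z * |u z| ^ p) + η ^ p * wint K φ (gradPow p ux uy)) := by
  have cu := hg.continuous
  have cp := cu.abs_rpow_const hp
  have cq := hg.continuous_snd.abs_rpow_const hp
  have iu := h.integrable_mul cp
  have iq := h.integrable_mul cq
  have iuG : Integrable (G.indicator fun z => K.indicator φ z * |u z| ^ p) := iu.indicator hG
  rw [Measure.volume_eq_prod] at iu iq iuG
  have n1 : ∀ z, 0 ≤ K.indicator φ z * |u z| ^ p := fun z =>
    mul_nonneg (h.indicator_nonneg' z) (by positivity)
  have n2 : ∀ z, 0 ≤ K.indicator φ z * |uy z| ^ p := fun z =>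
    mul_nonneg (h.indicator_nonneg' z) (by positivity)
  have hGi : ∀ x, ∫ y in slice G x, K.indicator φ (x, y) * |u (x, y)| ^ p =
      ∫ y, G.indicator (fun z => K.indicator φ z * |u z| ^ p) (x, y) := fun x => by
    rw [← integral_indicator (show MeasurableSet (slice G x) from
      hG.preimage measurable_prodMk_left)]
    rfl
  rw [h.setIntegral_fst_preimage cp]
  have hC : (0 : ℝ) ≤ 2 ^ (p + 1) * 4 ^ m := by positivity
  have hη' : 0 ≤ η ^ p := by positivity
  have ile : Integrable fun x => 2 ^ (p + 1) * 4 ^ m *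
      ((∫ y, G.indicator (fun z => K.indicator φ z * |u z| ^ p) (x, y)) +
        η ^ p * ∫ y, K.indicator φ (x, y) * |uy (x, y)| ^ p) :=
    (iuG.integral_prod_left.add (iq.integral_prod_left.const_mul _)).const_mul _
  calc ∫ x in T, ∫ y, K.indicator φ (x, y) * |u (x, y)| ^ p
      ≤ ∫ x in T, 2 ^ (p + 1) * 4 ^ m *
      ((∫ y, G.indicator (fun z => K.indicator φ z * |u z| ^ p) (x, y)) +
        η ^ p * ∫ y, K.indicator φ (x, y) * |uy (x, y)| ^ p) := by
        refine setIntegral_mono_on iu.integral_prod_left.integrableOn ile.integrableOn hT ?_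
        intro x hx
        rw [← hGi x]
        refine h.slice_estimate hp (v := fun y => u (x, y)) (v' := fun y => uy (x, y))
          (fun y => ?_) (hg.continuous_snd.comp (by fun_prop)) (hG.preimage measurable_prodMk_left)
          (hwη x) (hGw x hx)
        have h1 : HasDerivAt (fun y : ℝ => (x, y)) (0, 1) y :=
          (hasDerivAt_const y x).prodMk (hasDerivAt_id y)
        exact ((hg.hasFDerivAt (x, y)).comp_hasDerivAt y h1).congr_deriv (by simp)
    _ ≤ ∫ x, 2 ^ (p + 1) * 4 ^ m *
      ((∫ y, G.indicator (fun z => K.indicator φ z * |u z| ^ p) (x, y)) +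
        η ^ p * ∫ y, K.indicator φ (x, y) * |uy (x, y)| ^ p) := by
        refine setIntegral_le_integral ile (.of_forall fun x => mul_nonneg hC (add_nonneg ?_ ?_))
        · exact integral_nonneg fun y => indicator_nonneg (fun z _ => n1 z) _
        · exact mul_nonneg hη' (integral_nonneg fun y => n2 _)
    _ = 2 ^ (p + 1) * 4 ^ m *
      ((∫ z in G, K.indicator φ z * |u z| ^ p) + η ^ p * wint K φ fun z => |uy z| ^ p) := by
        rw [integral_const_mul, integral_add iuG.integral_prod_left
          (iq.integral_prod_left.const_mul _), integral_const_mul, ← integral_prod _ iuG,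
          ← integral_prod _ iq, wint, Measure.volume_eq_prod, integral_indicator hG]
    _ ≤ _ := by
        gcongr
        refine integral_mono (h.integrable_mul cq) (h.integrable_mul (hg.continuous_gradPow hp))
          fun z => mul_le_mul_of_nonneg_left ?_ (h.indicator_nonneg' z)
        beta_reduce
        rw [abs_rpow_eq_sq_rpow]
        exact Real.rpow_le_rpow (sq_nonneg _) (by nlinarith [sq_nonneg (ux z)]) (by linarith)

end PowConcave

/-- A thin cell that nearly spans the unit interval and whose marginal is nearly constant away
from the far end. -/
structure LongCell (η τ δ δ₁ : ℝ) (K : Set (ℝ × ℝ)) (φ : ℝ × ℝ → ℝ) (a b y s : ℝ) : Prop where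
  sheet : Sheet δ K a b y s
  left_nonneg : 0 ≤ a
  left_le : a ≤ 5 * η ^ 2
  le_right : 1 - 5 * η ^ 2 ≤ b
  right_le : b ≤ 1
  slope_le : |s| ≤ 4 * η
  length : 1 - τ < (b - a) ^ 2 * (1 + s ^ 2)
  flat_right : ∀ x x', 2 * δ₁ ≤ x → x ≤ x' → x' < b → marg K φ x' ≤ 21 / 20 * marg K φ x
  flat_left : ∀ x x', a < x → x ≤ x' → x' ≤ 1 - 2 * δ₁ → marg K φ x ≤ 21 / 20 * marg K φ x'

theorem le_mul_of_log_sub_le {x y t : ℝ} (hx : 0 < x) (hy : 0 < y) (ht : t ≤ 1 / 25)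
    (h : Real.log x - Real.log y ≤ t) : x ≤ 21 / 20 * y := by
  have h1 : Real.exp (1 / 25) ≤ 21 / 20 := by
    have := Real.exp_bound' (x := 1 / 25) (by norm_num) (by norm_num) (n := 2) (by norm_num)
    norm_num [Finset.sum_range_succ] at this ⊢
    linarith
  have h2 : Real.log x ≤ Real.log (Real.exp (1 / 25) * y) := by
    rw [Real.log_mul (Real.exp_ne_zero _) hy.ne', Real.log_exp]; linarith
  have h3 := (Real.log_le_log_iff hx (by positivity)).1 h2
  exact h3.trans (by gcongr)

theorem NarrowDomain.longCell {m : ℕ} {η τ δ δ₁ a b y s : ℝ} {Ω K : Set (ℝ × ℝ)}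
    {φ : ℝ × ℝ → ℝ} (hΩ : NarrowDomain η Ω) (hK : PowConcave m K φ) (hKΩ : K ⊆ Ω)
    (hτ : τ ≤ η ^ 2) (hη : 5 * η ^ 2 ≤ δ₁) (hδ₁ : δ₁ ≤ 1 / 8)
    (h : IsLongFlat δ τ (1 / 25) δ₁ K φ a b y s) : LongCell η τ δ δ₁ K φ a b y s := by
  obtain ⟨S, hlen, hflat⟩ := h
  have hL := closure_mono hKΩ S.left
  have hR := closure_mono hKΩ S.right
  have ha := hΩ.fst_mem_closure hL
  have hb := hΩ.fst_mem_closure hR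
  have hy1 := abs_le.1 (hΩ.abs_snd_le_closure hL)
  have hy2 := abs_le.1 (hΩ.abs_snd_le_closure hR)
  simp only at ha hb hy1 hy2
  have hab := S.lt
  have hη0 := hΩ.pos
  have hd : |s * (b - a)| ≤ 2 * η := abs_le.2 ⟨by linarith, by linarith⟩
  have hd2 : (s * (b - a)) ^ 2 ≤ (2 * η) ^ 2 := by
    rw [← sq_abs]; exact pow_le_pow_left₀ (abs_nonneg _) hd 2
  have hba1 : b - a ≤ 1 := by linarith [ha.1, hb.2]
  have hba : 1 - 5 * η ^ 2 ≤ b - a := by nlinarith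
  have hslope : |s| ≤ 4 * η := by
    rw [abs_mul, abs_of_pos (sub_pos.2 hab)] at hd
    have : 1 / 2 ≤ b - a := by linarith
    nlinarith [abs_nonneg s]
  have hpos : ∀ x ∈ Ioo a b, 0 < marg K φ x := fun x hx =>
    hK.marg_pos (PowConcave.slice_nonempty_iff.2 (S.proj ▸ hx))
  have hba0 : 0 < b - a := sub_pos.2 hab
  have hsub : ∀ x, a + (b - a) * ((x - a) / (b - a)) = x := fun x => by field_simp; ring
  have ha5 : a ≤ 5 * η ^ 2 := by linarith [hb.2]
  have hb5 : 1 - 5 * η ^ 2 ≤ b := by linarith [ha.1]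
  have hδ0 : 0 < δ₁ := lt_of_lt_of_le (by positivity) hη
  refine ⟨S, ha.1, ha5, hb5, hb.2, hslope, hlen, ?_, ?_⟩
  · intro x x' hx hxx' hx'
    have hax : a < x := by linarith
    have h1 := hflat.1 ((x - a) / (b - a)) ((x' - a) / (b - a))
      ((le_div_iff₀ hba0).2 (by nlinarith)) (by gcongr) ((div_lt_one hba0).2 (by linarith))
    simp only [hsub] at h1
    refine le_mul_of_log_sub_le (hpos x' ⟨by linarith, hx'⟩) (hpos x ⟨hax, by linarith⟩) ?_ h1
    rw [← sub_div]
    have : (x' - a - (x - a)) / (b - a) ≤ 1 := (div_le_one hba0).2 (by linarith)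
    linarith
  · intro x x' hx hxx' hx'
    have hxb : x' < b := by linarith
    have h1 := hflat.2 ((x - a) / (b - a)) ((x' - a) / (b - a))
      (div_pos (by linarith) hba0) (by gcongr) ((div_le_iff₀ hba0).2 (by nlinarith))
    simp only [hsub] at h1
    refine le_mul_of_log_sub_le (hpos x ⟨hx, by linarith⟩) (hpos x' ⟨by linarith, hxb⟩) ?_ h1
    rw [← sub_div]
    have : (x' - a - (x - a)) / (b - a) ≤ 1 := (div_le_one hba0).2 (by linarith)
    linarith

/-- The ends of a long cell carry little of the weighted norm. -/
theorem LongCell.end_estimate {m : ℕ} {η τ δ δ₁ a b y s p ε σ : ℝ} {K Q : Set (ℝ × ℝ)}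
    {φ u ux uy : ℝ × ℝ → ℝ} (h : LongCell η τ δ δ₁ K φ a b y s) (hp : 1 < p)
    (hK : PowConcave m K φ) (hg : HasGrad u ux uy) (hmod : HasModulus p u ux uy Q δ ε)
    (hQ : closure K ⊆ Q) (hε : 0 ≤ ε) (hη : 5 * η ^ 2 ≤ δ₁) (hδ₁ : δ₁ ≤ 1 / 8) (hσ0 : 0 ≤ σ)
    (hσ : σ ≤ 1 / 4) :
    ∫ z in Prod.fst ⁻¹' (Icc 0 σ ∪ Icc (1 - σ) 1), K.indicator φ z * |u z| ^ p ≤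
      2 ^ (p + 3) * 2 ^ p * σ * (wint K φ (fun z => |u z| ^ p) + wint K φ (gradPow p ux uy)) +
      (2 ^ (p + 3) * 2 ^ p * σ * 2 + 1) * ε * mass K φ := by
  have S := h.sheet
  set T := Icc 0 σ ∪ Icc (1 - σ) 1 with hT
  have hTm : MeasurableSet T := measurableSet_Icc.union measurableSet_Icc
  set ln : ℝ → ℝ × ℝ := fun x => (x, y + s * (x - a)) with hln
  have cln : Continuous ln := by rw [hln]; fun_prop
  set v : ℝ → ℝ := fun x => u (ln x) with hvdef
  set v' : ℝ → ℝ := fun x => ux (ln x) + s * uy (ln x) with hv'def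
  have cv : Continuous v := hg.continuous.comp cln
  have cv' : Continuous v' :=
    (hg.continuous_fst.comp cln).add ((hg.continuous_snd.comp cln).const_mul s)
  have cgp := hg.continuous_gradPow hp
  have cgl : Continuous fun x => gradPow p ux uy (ln x) := cgp.comp cln
  have hlnQ : ∀ x ∈ Icc a b, ln x ∈ Q := fun x hx => hQ (S.line_mem hK.convex hx)
  have hproj : ∀ z ∈ K, z.1 ∈ Icc a b := fun z hz =>
    Ioo_subset_Icc_self (S.proj ▸ ⟨z, hz, rfl⟩)
  have hnear : ∀ z ∈ K, dist z (ln z.1) ≤ δ := by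
    intro z hz
    rw [Prod.dist_eq, hln]
    simp only [dist_self]
    rw [Real.dist_eq]
    exact max_le ((abs_nonneg _).trans (S.near z hz)) (S.near z hz)
  have mod := fun z hz => (hmod z (hQ (subset_closure hz)) _ (hlnQ _ (hproj z hz))
    (hnear z hz)).2
  have e1 := hK.abs_integral_sub_le (F := fun z => |u z| ^ p) (hg.continuous.abs_rpow_const hp)
    (f := fun x => |v x| ^ p) (cv.abs_rpow_const hp) (ε := ε) fun z hz => (mod z hz).1
  have e2 := hK.abs_integral_sub_le (F := gradPow p ux uy) cgp cgl (ε := ε) fun z hz =>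
    (mod z hz).2
  change |wint K φ _ - _| ≤ ε * mass K φ at e1 e2
  rw [abs_le] at e1 e2
  have hs2 : s ^ 2 ≤ 1 := (sq_le_one_iff_abs_le_one s).2 S.slope
  have hS1 : (1 + s ^ 2) ^ (p / 2) ≤ 2 ^ p := by
    calc (1 + s ^ 2) ^ (p / 2) ≤ 2 ^ (p / 2) :=
          Real.rpow_le_rpow (by positivity) (by linarith) (by linarith)
      _ ≤ 2 ^ p := Real.rpow_le_rpow_of_exponent_le (by norm_num) (by linarith)
  set A := ∫ x, marg K φ x * |v x| ^ p with hA
  set B := ∫ x, marg K φ x * |v' x| ^ p with hB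
  set B' := ∫ x, marg K φ x * gradPow p ux uy (ln x) with hB'
  have hA0 : 0 ≤ A := integral_nonneg fun x => mul_nonneg (hK.marg_nonneg x) (by positivity)
  have hB0 : 0 ≤ B := integral_nonneg fun x => mul_nonneg (hK.marg_nonneg x) (by positivity)
  have hB'0 : 0 ≤ B' := integral_nonneg fun x =>
    mul_nonneg (hK.marg_nonneg x) (gradPow_nonneg _ _ _)
  have hBB' : B ≤ 2 ^ p * B' := by
    rw [hB, hB', ← integral_const_mul]
    refine integral_mono (hK.integrable_marg_mul (cv'.abs_rpow_const hp))
      ((hK.integrable_marg_mul cgl).const_mul _) fun x => ?_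
    have h1 := (abs_directional_rpow_le hp s ux uy (ln x)).trans
      (mul_le_mul_of_nonneg_right hS1 (gradPow_nonneg ux uy (ln x)))
    have := mul_le_mul_of_nonneg_left h1 (hK.marg_nonneg x)
    simp only
    linarith
  have iA := hK.integrable_marg_mul (cv.abs_rpow_const hp)
  have iB := hK.integrable_marg_mul (cv'.abs_rpow_const hp)
  have hpt : ∀ x ∈ T, marg K φ x * |v x| ^ p ≤ 2 ^ (p + 1) * (A + B) * (21 / 20) := by
    intro x hx
    by_cases hxab : x ∈ Ioo a b
    · have hZv : volume.real (Icc (1 / 4 : ℝ) (3 / 4)) = 1 / 2 := by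
        rw [Real.volume_real_Icc_of_le (by norm_num)]; norm_num
      have hZ : Icc (1 / 4 : ℝ) (3 / 4) ⊆ Ioo a b := fun t ht =>
        ⟨by linarith [h.left_le, ht.1], by linarith [h.le_right, ht.2]⟩
      have key := weight_mul_abs_rpow_le (x := x) (ρ := marg K φ) (K := 21 / 20) (L := 1) hp
        (v := v) (v' := v') (fun x => hg.hasDerivAt_line y s a x) cv' (I := Ioo a b)
        (Z := Icc (1 / 4) (3 / 4)) measurableSet_Ioo measurableSet_Icc hZ
        (by simp) (by norm_num) (fun t _ => hK.marg_nonneg t) hxab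
        iA.integrableOn iB.integrableOn
        (fun z hz => abs_le.2 ⟨by linarith [hz.1, hz.2, hxab.1, hxab.2, h.left_nonneg],
          by linarith [hz.1, hz.2, hxab.1, hxab.2, h.right_le]⟩)
        (fun z hz t ht => ?_)
      · rw [hZv, Real.one_rpow] at key
        have k1 : ∫ t in Icc (1 / 4) (3 / 4), marg K φ t * |v t| ^ p ≤ A :=
          setIntegral_le_integral iA
            (.of_forall fun t => mul_nonneg (hK.marg_nonneg t) (by positivity))
        have k2 : ∫ t in Ioo a b, marg K φ t * |v' t| ^ p ≤ B :=
          setIntegral_le_integral iB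
            (.of_forall fun t => mul_nonneg (hK.marg_nonneg t) (by positivity))
        have h3 : (2 : ℝ) ^ (p + 1) = 4 * 2 ^ (p - 1) := by
          rw [show p + 1 = 2 + (p - 1) by ring, Real.rpow_add two_pos]; norm_num
        rw [h3]
        have h2p : (0 : ℝ) < 2 ^ (p - 1) := by positivity
        have k3 : marg K φ x * |v x| ^ p * (1 / 2) ≤
            2 ^ (p - 1) * (21 / 20) * (A + 1 * (1 / 2) * B) := by
          refine key.trans ?_
          gcongr
        have k4 := mul_nonneg h2p.le hA0
        have k5 := mul_nonneg h2p.le hB0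
        nlinarith
      · have hzab := hZ hz
        refine ⟨ordConnected_Ioo.uIcc_subset hxab hzab ht, ?_⟩
        rcases hx with hx | hx
        · have hxz : x ≤ z := by linarith [hx.2, hz.1]
          rw [uIcc_of_le hxz] at ht
          exact h.flat_left x t hxab.1 ht.1 (by linarith [ht.2, hz.2])
        · have hxz : z ≤ x := by linarith [hx.1, hz.2]
          rw [uIcc_of_ge hxz] at ht
          exact h.flat_right t x (by linarith [ht.1, hz.1]) ht.2 hxab.2
    · rw [PowConcave.marg_eq_zero (by rw [S.proj]; exact hxab), zero_mul]
      positivity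
  have hTfin : volume T ≠ ⊤ := by
    refine ne_top_of_le_ne_top ?_ (measure_union_le _ _)
    simp
  have hTvol : volume.real T ≤ 2 * σ := by
    refine (measureReal_union_le _ _).trans ?_
    rw [Real.volume_real_Icc_of_le hσ0, Real.volume_real_Icc_of_le (by linarith)]
    linarith
  have hend : ∫ x in T, marg K φ x * |v x| ^ p ≤ 2 ^ (p + 2) * σ * (21 / 20) * (A + B) := by
    have := setIntegral_mono_on iA.integrableOn (integrableOn_const hTfin) hTm hpt
    refine this.trans ?_
    rw [setIntegral_const, smul_eq_mul]
    have h3 : (2 : ℝ) ^ (p + 2) = 2 * 2 ^ (p + 1) := by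
      rw [show p + 2 = 1 + (p + 1) by ring, Real.rpow_add two_pos]; norm_num
    rw [h3]
    have : 0 ≤ 2 ^ (p + 1) * (A + B) * (21 / 20) := by positivity
    nlinarith
  have hloc : ∫ z in Prod.fst ⁻¹' T, K.indicator φ z * |u z| ^ p ≤
      (∫ x in T, marg K φ x * |v x| ^ p) + ε * mass K φ := by
    have cF : Continuous fun z : ℝ × ℝ => |v z.1| ^ p := (cv.comp continuous_fst).abs_rpow_const hp
    have i1 := hK.integrable_mul (hg.continuous.abs_rpow_const hp)
    have i2 := hK.integrable_mul cF
    have i3 := hK.integrable.const_mul ε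
    have e3 := hK.setIntegral_fst_preimage cF T
    simp only [integral_mul_const] at e3
    change _ ≤ (∫ x in T, (∫ y, K.indicator φ (x, y)) * |v x| ^ p) + _
    rw [← e3]
    calc ∫ z in Prod.fst ⁻¹' T, K.indicator φ z * |u z| ^ p
        ≤ ∫ z in Prod.fst ⁻¹' T, (K.indicator φ z * |v z.1| ^ p + ε * K.indicator φ z) := by
          refine setIntegral_mono i1.integrableOn (i2.add i3).integrableOn fun z => ?_
          by_cases hz : z ∈ K
          · have := (abs_le.1 (mod z hz).1).2
            beta_reduce
            rw [mul_comm ε, ← mul_add]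
            exact mul_le_mul_of_nonneg_left (by linarith) (hK.indicator_nonneg' z)
          · simp [indicator_of_notMem hz]
      _ = (∫ z in Prod.fst ⁻¹' T, K.indicator φ z * |v z.1| ^ p) +
          ∫ z in Prod.fst ⁻¹' T, ε * K.indicator φ z := integral_add i2.integrableOn i3.integrableOn
      _ ≤ _ := by
          gcongr
          refine (setIntegral_le_integral i3 (.of_forall fun z =>
            mul_nonneg hε (hK.indicator_nonneg' z))).trans ?_
          rw [integral_const_mul]; rfl
  set M := wint K φ (fun z => |u z| ^ p)
  set E := wint K φ (gradPow p ux uy)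
  have hp1 : (2 : ℝ) ≤ 2 ^ p := by
    calc (2 : ℝ) = 2 ^ (1 : ℝ) := by simp
      _ ≤ 2 ^ p := Real.rpow_le_rpow_of_exponent_le (by norm_num) hp.le
  have h3 : (2 : ℝ) ^ (p + 3) = 2 * 2 ^ (p + 2) := by
    rw [show p + 3 = 1 + (p + 2) by ring, Real.rpow_add two_pos]; norm_num
  have hsum : 21 / 20 * (A + B) ≤ 2 * 2 ^ p * (M + E + 2 * (ε * mass K φ)) := by
    have a1 : A ≤ M + ε * mass K φ := by linarith
    have a2 : B' ≤ E + ε * mass K φ := by linarith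
    have a3 : 2 * A ≤ 2 ^ p * (M + ε * mass K φ) :=
      mul_le_mul hp1 a1 hA0 (by positivity)
    have a4 : 2 ^ p * B' ≤ 2 ^ p * (E + ε * mass K φ) := by gcongr
    linarith
  have h4 : 0 ≤ 2 ^ (p + 2) * σ := by positivity
  have h5 := mul_le_mul_of_nonneg_left hsum h4
  rw [h3]
  linarith

theorem LongCell.slice_nonempty {η τ δ δ₁ a b y s x : ℝ} {K : Set (ℝ × ℝ)} {φ : ℝ × ℝ → ℝ}
    (h : LongCell η τ δ δ₁ K φ a b y s) (hη : 5 * η ^ 2 ≤ δ₁) (hδ₁ : 0 < δ₁)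
    (hx : 2 * δ₁ ≤ x) (hx' : x ≤ 1 - 2 * δ₁) : (slice K x).Nonempty := by
  rw [PowConcave.slice_nonempty_iff, h.sheet.proj]
  exact ⟨by linarith [h.left_le], by linarith [h.le_right]⟩

/-- The width of a long cell at interior points is controlled by that near its ends. -/
theorem LongCell.width_le {m : ℕ} {η τ δ δ₁ a b y s x x' : ℝ} {K : Set (ℝ × ℝ)}
    {φ : ℝ × ℝ → ℝ} (h : LongCell η τ δ δ₁ K φ a b y s) (hK : PowConcave m K φ)
    (hη : 5 * η ^ 2 ≤ δ₁) (hδ₁ : 0 < δ₁) (hx : x ∈ Icc (2 * δ₁) (1 - 2 * δ₁))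
    (hx' : x' ∈ Icc (2 * δ₁) (1 - 2 * δ₁)) :
    3 / 8 * (1 / 4) ^ m * width K x ≤ width K x' := by
  have ha := h.left_le
  have hb := h.le_right
  refine hK.width_le_of_marg_le (h.slice_nonempty hη hδ₁ hx'.1 hx'.2)
    (h.slice_nonempty hη hδ₁ hx.1 hx.2) ?_ ?_ <;> rcases le_total x x' with hxx | hxx
  · exact h.flat_left _ _ (by linarith [hx.1, hx'.1]) (by linarith) hx'.2
  · exact h.flat_right _ _ hx'.1 (by linarith) (by linarith [hx.2, hx'.2])
  · exact h.flat_right _ _ hx.1 (by linarith) (by linarith [hx.2, hx'.2])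
  · exact h.flat_left _ _ (by linarith [hx.1, hx'.1]) (by linarith) hx.2

/-- Disjoint convex sets cross two vertical lines in the same order. -/
theorem lt_of_disjoint_convex {K L : Set (ℝ × ℝ)} (hK : Convex ℝ K) (hL : Convex ℝ L)
    (hd : Disjoint K L) {x x' c d c' d' : ℝ} (h1 : (x, c) ∈ K) (h1' : (x', c') ∈ K)
    (h2 : (x, d) ∈ L) (h2' : (x', d') ∈ L) (hlt : c < d) : c' < d' := by
  by_contra! hle
  set t := (d - c) / ((d - c) + (c' - d')) with ht
  have hpos : 0 < (d - c) + (c' - d') := by linarith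
  have ht0 : 0 ≤ t := div_nonneg (by linarith) hpos.le
  have ht1 : t ≤ 1 := (div_le_one hpos).2 (by linarith)
  have hmul : t * ((d - c) + (c' - d')) = d - c := div_mul_cancel₀ _ hpos.ne'
  have k1 := hK h1 h1' (sub_nonneg.2 ht1) ht0 (by ring)
  have k2 := hL h2 h2' (sub_nonneg.2 ht1) ht0 (by ring)
  have : (1 - t) • (x, c) + t • (x', c') = (1 - t) • (x, d) + t • (x', d') := by
    simp only [Prod.smul_mk, Prod.mk_add_mk, smul_eq_mul, Prod.mk.injEq, true_and]
    linarith
  rw [this] at k1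
  exact Set.disjoint_left.1 hd k1 k2

theorem sum_width_le {B : Finset (Set (ℝ × ℝ))} (ho : ∀ K ∈ B, IsOpen K)
    (hd : ∀ K ∈ B, ∀ L ∈ B, K ≠ L → Disjoint K L) {x : ℝ} {S : Set ℝ} (hS : volume S ≠ ⊤)
    (hB : ∀ K ∈ B, slice K x ⊆ S) : ∑ K ∈ B, width K x ≤ volume.real S := by
  unfold width
  rw [← measureReal_biUnion_finset ?_ ?_ fun K hK =>
    ne_top_of_le_ne_top hS (measure_mono (hB K hK))]
  · exact measureReal_mono (iUnion₂_subset hB) hS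
  · intro K hK L hL hKL
    exact (hd K hK L hL hKL).preimage (fun y : ℝ => (x, y))
  · exact fun K hK => (isOpen_slice (ho K hK) x).measurableSet

/-- Long cells cannot fill more than half of an interior vertical chord. -/
theorem NarrowDomain.sum_width_le_half {m : ℕ} {η τ δ δ₁ σ : ℝ} {Ω : Set (ℝ × ℝ)}
    {φ : ℝ × ℝ → ℝ} {a b y s : Set (ℝ × ℝ) → ℝ} (hΩ : NarrowDomain η Ω)
    {B : Finset (Set (ℝ × ℝ))} (hK : ∀ K ∈ B, PowConcave m K φ) (hsub : ∀ K ∈ B, K ⊆ Ω)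
    (hd : ∀ K ∈ B, ∀ L ∈ B, K ≠ L → Disjoint K L)
    (hB : ∀ K ∈ B, LongCell η τ δ δ₁ K φ (a K) (b K) (y K) (s K))
    (hσ0 : 0 < σ) (hσ : σ ≤ 1 / 4) (hη : 5 * η ^ 2 ≤ δ₁)
    (hδ₁ : δ₁ ≤ 3 / 8 * (1 / 4) ^ m * σ / 160)
    (hτ : τ ≤ (3 / 8 * (1 / 4) ^ m * σ) ^ 2 * η ^ 2 / 128)
    (hη' : 25 * η ^ 2 ≤ (3 / 8 * (1 / 4) ^ m * σ) ^ 2 / 128)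
    (hδ : 6 * δ ≤ 3 / 8 * (1 / 4) ^ m * σ * η / 4)
    {x : ℝ} (hx : x ∈ Ioo σ (1 - σ)) : ∑ K ∈ B, width K x ≤ width Ω x / 2 := by
  have hη0 := hΩ.pos
  set c : ℝ := 3 / 8 * (1 / 4) ^ m with hc
  have hc0 : 0 < c := by positivity
  have hc1 : c ≤ 1 := by
    have : (1 / 4 : ℝ) ^ m ≤ 1 := pow_le_one₀ (by norm_num) (by norm_num)
    linarith
  have hδ₁0 : 0 < δ₁ := lt_of_lt_of_le (by positivity) hη
  have hδσ : 2 * δ₁ ≤ σ := by nlinarith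
  by_contra! hcon
  have hw : σ * η ≤ width Ω x := by
    refine le_trans ?_ (hΩ.le_width x ⟨by linarith [hx.1], by linarith [hx.2]⟩)
    exact mul_le_mul_of_nonneg_right (le_min hx.1.le (by linarith [hx.2])) hη0.le
  set q := c * σ * η / 2 with hq
  have hq0 : 0 < q := by positivity
  have hxI : x ∈ Icc (2 * δ₁) (1 - 2 * δ₁) := ⟨by linarith [hx.1], by linarith [hx.2]⟩
  have hsum : ∀ x' ∈ Icc (2 * δ₁) (1 - 2 * δ₁), q ≤ ∑ K ∈ B, width K x' := by
    intro x' hx'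
    calc q ≤ c * ∑ K ∈ B, width K x := by
          rw [hq]; nlinarith
      _ = ∑ K ∈ B, c * width K x := Finset.mul_sum _ _ _
      _ ≤ _ := Finset.sum_le_sum fun K hKB => (hB K hKB).width_le (hK K hKB) hη hδ₁0 hxI hx'
  have hBne : B.Nonempty := by
    rw [Finset.nonempty_iff_ne_empty]
    rintro rfl
    have := hsum x hxI
    simp only [Finset.sum_empty] at this
    linarith
  have hI1 : 2 * δ₁ ∈ Icc (2 * δ₁) (1 - 2 * δ₁) := ⟨le_rfl, by linarith⟩
  have hI3 : 1 - 2 * δ₁ ∈ Icc (2 * δ₁) (1 - 2 * δ₁) := ⟨by linarith, le_rfl⟩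
  have hpt : ∀ x' ∈ Icc (2 * δ₁) (1 - 2 * δ₁), ∀ K ∈ B, ∃ t, (x', t) ∈ K := fun x' hx' K hKB =>
    (hB K hKB).slice_nonempty hη hδ₁0 hx'.1 hx'.2
  choose! f hf using hpt (2 * δ₁) hI1
  choose! f' hf' using hpt (1 - 2 * δ₁) hI3
  obtain ⟨K₁, hK₁, hmax⟩ := B.exists_max_image f hBne
  obtain ⟨K₂, hK₂, hmin⟩ := B.exists_min_image f hBne
  have hord : ∀ K ∈ B, ∀ L ∈ B, f K ≤ f L → f' K ≤ f' L := by
    intro K hKB L hLB hle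
    rcases eq_or_ne K L with rfl | hne
    · exact le_rfl
    · have hdis := hd K hKB L hLB hne
      have hlt : f K < f L := lt_of_le_of_ne hle fun he =>
        Set.disjoint_left.1 hdis (hf K hKB) (he ▸ hf L hLB)
      exact (lt_of_disjoint_convex (hK K hKB).convex (hK L hLB).convex hdis (hf K hKB)
        (hf' K hKB) (hf L hLB) (hf' L hLB) hlt).le
  have hnear : ∀ K ∈ B, ∀ x' t t', (x', t) ∈ K → (x', t') ∈ K → |t - t'| ≤ 2 * δ := by
    intro K hKB x' t t' ht ht'
    have h1 := abs_le.1 ((hB K hKB).sheet.near _ ht)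
    have h2 := abs_le.1 ((hB K hKB).sheet.near _ ht')
    simp only at h1 h2
    exact abs_le.2 ⟨by linarith, by linarith⟩
  have hspread : ∀ x' ∈ Icc (2 * δ₁) (1 - 2 * δ₁), ∀ F : Set (ℝ × ℝ) → ℝ,
      (∀ K ∈ B, (x', F K) ∈ K) → (∀ K ∈ B, F K ≤ F K₁) → (∀ K ∈ B, F K₂ ≤ F K) →
      q / 2 ≤ (y K₁ + s K₁ * (x' - a K₁)) - (y K₂ + s K₂ * (x' - a K₂)) := by
    intro x' hx' F hF hF1 hF2
    have h1 := sum_width_le (x := x') (S := Icc (F K₂ - 2 * δ) (F K₁ + 2 * δ))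
      (fun K hKB => (hK K hKB).isOpen) hd (by simp) fun K hKB t ht => by
        have := abs_le.1 (hnear K hKB x' t (F K) ht (hF K hKB))
        exact ⟨by linarith [hF2 K hKB], by linarith [hF1 K hKB]⟩
    have h2 := hsum x' hx'
    have hδ0 : 0 ≤ δ := (abs_nonneg _).trans ((hB K₁ hK₁).sheet.near _ (hF K₁ hK₁))
    rw [Real.volume_real_Icc_of_le (by linarith [hF1 K₂ hK₂])] at h1
    have h3 := abs_le.1 ((hB K₁ hK₁).sheet.near _ (hF K₁ hK₁))
    have h4 := abs_le.1 ((hB K₂ hK₂).sheet.near _ (hF K₂ hK₂))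
    simp only at h3 h4
    linarith
  have hD1 := hspread _ hI1 f hf hmax hmin
  have hD3 := hspread _ hI3 f' hf' (fun K hKB => hord K hKB K₁ hK₁ (hmax K hKB))
    (fun K hKB => hord K₂ hK₂ K hKB (hmin K hKB))
  have L₁ := hB K₁ hK₁
  have L₂ := hB K₂ hK₂
  generalize a K₁ = a₁ at *
  generalize b K₁ = b₁ at *
  generalize y K₁ = y₁ at *
  generalize s K₁ = s₁ at *
  generalize a K₂ = a₂ at *
  generalize b K₂ = b₂ at *
  generalize y K₂ = y₂ at *
  generalize s K₂ = s₂ at *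
  have cl₁ : closure K₁ ⊆ closure Ω := closure_mono (hsub K₁ hK₁)
  have cl₂ : closure K₂ ⊆ closure Ω := closure_mono (hsub K₂ hK₂)
  have d12 := hΩ.dist_le_closure (cl₁ L₁.sheet.left) (cl₂ L₂.sheet.right)
  have d21 := hΩ.dist_le_closure (cl₂ L₂.sheet.left) (cl₁ L₁.sheet.right)
  have l1 := L₁.length
  have l2 := L₂.length
  simp only at d12 d21
  have hs₁ := abs_le.1 L₁.slope_le
  have hs₂ := abs_le.1 L₂.slope_le
  have ha₁ := L₁.left_nonneg
  have ha₁' := L₁.left_le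
  have ha₂ := L₂.left_nonneg
  have ha₂' := L₂.left_le
  have hb₁ := L₁.le_right
  have hb₁' := L₁.right_le
  have hb₂ := L₂.le_right
  have hb₂' := L₂.right_le
  have hsm : ∀ r t, -(4 * η) ≤ r ∧ r ≤ 4 * η → 0 ≤ t → t ≤ 2 * δ₁ → |r * t| ≤ 8 * η * δ₁ := by
    intro r t hr ht0 ht
    rw [abs_mul, abs_of_nonneg ht0]
    have := mul_le_mul (abs_le.2 hr) ht ht0 (by positivity)
    linarith
  have hqδ : 16 * η * δ₁ ≤ q / 4 := by
    have := mul_le_mul_of_nonneg_right hδ₁ hη0.le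
    rw [hq]; linarith
  have hA : q / 4 ≤ y₁ - y₂ := by
    have t1 := abs_le.1 (hsm s₁ (2 * δ₁ - a₁) hs₁ (by linarith) (by linarith))
    have t2 := abs_le.1 (hsm s₂ (2 * δ₁ - a₂) hs₂ (by linarith) (by linarith))
    linarith
  have hBB : q / 4 ≤ (y₁ + s₁ * (b₁ - a₁)) - (y₂ + s₂ * (b₂ - a₂)) := by
    have t1 := abs_le.1 (hsm s₁ (b₁ - (1 - 2 * δ₁)) hs₁ (by linarith) (by linarith))
    have t2 := abs_le.1 (hsm s₂ (b₂ - (1 - 2 * δ₁)) hs₂ (by linarith) (by linarith))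
    linarith
  have hprod : (q / 4) * (q / 4) ≤ (y₁ - y₂) *
      ((y₁ + s₁ * (b₁ - a₁)) - (y₂ + s₂ * (b₂ - a₂))) :=
    mul_le_mul hA hBB (by positivity) (by linarith)
  have hab : -(25 * η ^ 4) ≤ (a₁ - a₂) * (b₁ - b₂) := by
    have h1 : |a₁ - a₂| ≤ 5 * η ^ 2 := abs_le.2 ⟨by linarith, by linarith⟩
    have h2 : |b₁ - b₂| ≤ 5 * η ^ 2 := abs_le.2 ⟨by linarith, by linarith⟩
    have h3 := mul_le_mul h1 h2 (abs_nonneg _) (by positivity)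
    rw [← abs_mul] at h3
    have := (abs_le.1 h3).1
    linarith
  have hfin : (q / 4) * (q / 4) - 25 * η ^ 4 < τ := by linarith only [hprod, hab, d12, d21, l1, l2]
  have h25 : 25 * η ^ 4 ≤ (c * σ) ^ 2 / 128 * η ^ 2 := by
    have := mul_le_mul_of_nonneg_right hη' (sq_nonneg η)
    linarith
  have hqq : (q / 4) * (q / 4) = (c * σ) ^ 2 * η ^ 2 / 64 := by rw [hq]; ring
  linarith

theorem half_width_le_of_sum_width_le {Ω : Set (ℝ × ℝ)}
    (hb : Bornology.IsBounded Ω) {B : Finset (Set (ℝ × ℝ))} {x : ℝ}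
    (hB : ∑ K ∈ B, width K x ≤ width Ω x / 2) (hsub : ∀ K ∈ B, K ⊆ Ω) :
    width Ω x / 2 ≤ volume.real (slice Ω x ∩ slice (Ω \ ⋃ K ∈ B, K) x) := by
  have hfin : volume (slice Ω x) ≠ ⊤ := (isBounded_slice hb x).measure_lt_top.ne
  have h1 : slice Ω x = (slice Ω x ∩ slice (Ω \ ⋃ K ∈ B, K) x) ∪ ⋃ K ∈ B, slice K x := by
    ext t
    simp only [slice, mem_union, mem_inter_iff, mem_ofPred_eq, Set.mem_sdiff, mem_iUnion, exists_prop]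
    constructor
    · intro ht
      by_cases hh : ∃ K ∈ B, (x, t) ∈ K
      · right
        obtain ⟨K, hK, hk⟩ := hh
        exact ⟨K, hK, hk⟩
      · exact Or.inl ⟨ht, ht, hh⟩
    · rintro (h | ⟨K, hK, hk⟩)
      · exact h.1
      · exact hsub K hK hk
  have h2 : width Ω x ≤ volume.real (slice Ω x ∩ slice (Ω \ ⋃ K ∈ B, K) x) +
      ∑ K ∈ B, width K x := by
    conv_lhs => rw [width, h1]
    refine (measureReal_union_le _ _).trans ?_
    gcongr
    exact measureReal_biUnion_finset_le _ _
  linarith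

set_option maxHeartbeats 1000000 in
open Classical in
/-- The improved inequality on a narrow domain, up to an arbitrarily small error. -/
theorem NarrowDomain.approx_inequality {m : ℕ} {p η σ δ₁ g κ τ ε : ℝ} {Ω : Set (ℝ × ℝ)}
    {φ u ux uy : ℝ × ℝ → ℝ} (hp : 1 < p) (hΩ : NarrowDomain η Ω) (hφ : PowConcave m Ω φ)
    (hne : Ω.Nonempty) (hg : HasGrad u ux uy) (hmean : wint Ω φ (fun z => sgnPow p (u z)) = 0)
    (hσ0 : 0 < σ) (hσ : σ ≤ 1 / 4) (hση : 2 ^ (p + 3) * 2 ^ p * σ * (piP p ^ p + 2) ≤ 1 / 4)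
    (hδ₁ : δ₁ ≤ 3 / 8 * (1 / 4) ^ m * σ / 160) (hg0 : 0 ≤ g)
    (hgain : ∀ h, IsLogConcaveWeight h → ¬ IsFlat (1 / 25) δ₁ h →
      HasPoincare p (piP p ^ p + g) h)
    (hη : 5 * η ^ 2 ≤ δ₁) (hη' : 25 * η ^ 2 ≤ (3 / 8 * (1 / 4) ^ m * σ) ^ 2 / 128)
    (hηp : 2 ^ (p + 1) * 4 ^ m * η ^ p * (piP p ^ p + 1) ≤ 1 / 4)
    (hτ : τ = (3 / 8 * (1 / 4) ^ m * σ) ^ 2 * η ^ 2 / 128)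
    (hκ0 : 0 ≤ κ) (hκg : κ ≤ g) (hκτ : κ ≤ piP p ^ p * (τ / 2)) (hε : 0 < ε)
    (hE : wint Ω φ (gradPow p ux uy) ≤ (piP p ^ p + 1) * wint Ω φ (fun z => |u z| ^ p)) :
    (piP p ^ p + κ / (2 * (1 + 2 ^ (p + 1) * 4 ^ m))) * wint Ω φ (fun z => |u z| ^ p) ≤
      wint Ω φ (gradPow p ux uy) + ε * (2 * (piP p ^ p + g + 1) + 2 * κ) * mass Ω φ := by
  have hη0 := hΩ.pos
  have hπ : 0 < piP p ^ p := Real.rpow_pos_of_pos (piP_pos hp) p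
  set k : ℝ := 3 / 8 * (1 / 4) ^ m with hk
  have hk0 : 0 < k := by positivity
  have hk1 : k ≤ 1 := by
    have : (1 / 4 : ℝ) ^ m ≤ 1 := pow_le_one₀ (by norm_num) (by norm_num)
    linarith
  have hδ₁8 : δ₁ ≤ 1 / 8 := by nlinarith
  have hkσ : (k * σ) ^ 2 ≤ 1 := by
    have h1 : k * σ ≤ 1 := by nlinarith
    have h2 : 0 ≤ k * σ := by positivity
    nlinarith
  have hτη : τ ≤ η ^ 2 := by rw [hτ]; nlinarith [sq_nonneg η]
  have hτ0 : 0 ≤ τ := by rw [hτ]; positivity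
  have hbc : IsCompact (closure Ω) :=
    Metric.isCompact_of_isClosed_isBounded isClosed_closure hφ.isBounded.closure
  obtain ⟨d, hd0, hmod⟩ := exists_hasModulus hp hg hbc hε
  set δ := min (d / 15) (k * σ * η / 360) with hδdef
  have hδ0 : 0 < δ := by positivity
  have hδd : 15 * δ ≤ d := by linarith [min_le_left (d / 15) (k * σ * η / 360)]
  have hδη : 6 * (15 * δ) ≤ k * σ * η / 4 := by
    linarith [min_le_right (d / 15) (k * σ * η / 360)]
  have hmod' : HasModulus p u ux uy (closure Ω) (15 * δ) ε := hmod.mono le_rfl hδd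
  obtain ⟨P, hP, hball⟩ := hφ.exists_fine_partition hne
    (F := fun z => sgnPow p (u z)) ((continuous_sgnPow hp).comp hg.continuous) hmean hδ0
  have hKc : ∀ K ∈ P, PowConcave m K φ := fun K hK =>
    hφ.mono (hP.subset K hK) (hP.isOpen K hK) (hP.convex K hK)
  have hcell := fun K (hK : K ∈ P) => hΩ.cell_inequality (κ := κ) (s₀ := 1 / 25) hp (hKc K hK)
    (hP.subset K hK) (hP.nonempty K hK) hg hmod' (closure_mono (hP.subset K hK)) (hball K hK)
    (hP.mean K hK) hε.le hg0 hgain hτ0 (by nlinarith only [hτη, hη, hδ₁8])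
    (by nlinarith only [hτη, hη, hδ₁8]) hκg hκτ
  set bad : Set (ℝ × ℝ) → Prop := fun K =>
    ∃ a b y s, IsLongFlat (15 * δ) τ (1 / 25) δ₁ K φ a b y s with hbad
  set B := P.filter bad with hBdef
  set Gd := P.filter (fun K => ¬ bad K) with hGdef
  have hBP : ∀ K ∈ B, K ∈ P := fun K hK => (Finset.mem_filter.1 hK).1
  have hlong : ∀ K ∈ B, ∃ a b y s, LongCell η τ (15 * δ) δ₁ K φ a b y s := by
    intro K hK
    obtain ⟨hKP, a, b, y, s, h⟩ := Finset.mem_filter.1 hK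
    exact ⟨a, b, y, s, hΩ.longCell (hKc K hKP) (hP.subset K hKP) hτη hη hδ₁8 h⟩
  choose! a b y s hL using hlong
  set M := fun K => wint K φ (fun z => |u z| ^ p) with hM
  set E := fun K => wint K φ (gradPow p ux uy) with hEdef
  set μ := fun K => mass K φ with hμ
  have cp := hg.continuous.abs_rpow_const hp
  have hMs : ∑ K ∈ P, M K = M Ω := hP.sum_wint hφ cp
  have hEs : ∑ K ∈ P, E K = E Ω := hP.sum_wint hφ (hg.continuous_gradPow hp)
  have hμs : ∑ K ∈ P, μ K = μ Ω := by
    simp only [hμ, mass_eq_wint]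
    exact hP.sum_wint hφ continuous_const
  have hM0 : ∀ K ∈ P, 0 ≤ M K := fun K hK => (hKc K hK).wint_nonneg fun z => by positivity
  have hE0 : ∀ K ∈ P, 0 ≤ E K := fun K hK => (hKc K hK).wint_nonneg (gradPow_nonneg ux uy)
  have hμ0 : ∀ K ∈ P, 0 ≤ μ K := fun K hK => (hKc K hK).mass_nonneg
  have hMΩ : 0 ≤ M Ω := hφ.wint_nonneg fun z => by positivity
  have hEΩ : 0 ≤ E Ω := hφ.wint_nonneg (gradPow_nonneg ux uy)
  have hμΩ : 0 ≤ μ Ω := hφ.mass_nonneg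
  have hnn : ∀ K ∈ P, ∀ z, 0 ≤ K.indicator φ z * |u z| ^ p := fun K hK z =>
    mul_nonneg ((hKc K hK).indicator_nonneg' z) (by positivity)
  set MG := ∑ K ∈ Gd, M K with hMG
  have hsplit : ∀ f : Set (ℝ × ℝ) → ℝ, (∑ K ∈ B, f K) + ∑ K ∈ Gd, f K = ∑ K ∈ P, f K :=
    fun f => Finset.sum_filter_add_sum_filter_not P bad f
  have hsub : ∀ f : Set (ℝ × ℝ) → ℝ, (∀ K ∈ P, 0 ≤ f K) → ∑ K ∈ B, f K ≤ ∑ K ∈ P, f K :=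
    fun f hf => Finset.sum_le_sum_of_subset_of_nonneg (Finset.filter_subset _ _)
      fun K hK _ => hf K hK
  -- the sharp inequality with gain on the good cells
  have hA : piP p ^ p * M Ω + κ * MG ≤ E Ω + 2 * ε * (piP p ^ p + g + 1) * μ Ω := by
    have h1 : ∑ K ∈ B, piP p ^ p * M K ≤
        ∑ K ∈ B, (E K + 2 * ε * (piP p ^ p + g + 1) * μ K) :=
      Finset.sum_le_sum fun K hK => (hcell K (hBP K hK)).1
    have h2 : ∑ K ∈ Gd, (piP p ^ p + κ) * M K ≤
        ∑ K ∈ Gd, (E K + 2 * ε * (piP p ^ p + g + 1) * μ K) := by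
      refine Finset.sum_le_sum fun K hK => ?_
      obtain ⟨hKP, hnb⟩ := Finset.mem_filter.1 hK
      exact (hcell K hKP).2.resolve_right hnb
    have h3 := add_le_add h1 h2
    rw [hsplit (fun K => E K + 2 * ε * (piP p ^ p + g + 1) * μ K), Finset.sum_add_distrib,
      ← Finset.mul_sum, ← Finset.mul_sum, ← Finset.mul_sum, hEs, hμs] at h3
    have h4 := hsplit M
    rw [hMs] at h4
    rw [← h4]
    linarith
  -- the strip
  have hstrip : ∫ z in Prod.fst ⁻¹' Ioo σ (1 - σ), Ω.indicator φ z * |u z| ^ p ≤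
      2 ^ (p + 1) * 4 ^ m * (MG + η ^ p * E Ω) := by
    have hBm : MeasurableSet (⋃ K ∈ B, K) :=
      B.measurableSet_biUnion fun K hK => (hP.isOpen K (hBP K hK)).measurableSet
    have hGm : MeasurableSet (Ω \ ⋃ K ∈ B, K) := hφ.isOpen.measurableSet.diff hBm
    have h1 := hφ.strip_estimate hp hg hη0.le hGm (T := Ioo σ (1 - σ)) measurableSet_Ioo
      hΩ.width_le fun x hx => half_width_le_of_sum_width_le hφ.isBounded
        (hΩ.sum_width_le_half (fun K hK => hKc K (hBP K hK))
          (fun K hK => hP.subset K (hBP K hK))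
          (fun K hK L hL => hP.disjoint K (hBP K hK) L (hBP L hL)) hL hσ0 hσ hη hδ₁ hτ.le hη'
          hδη hx) (fun K hK => hP.subset K (hBP K hK))
    refine h1.trans ?_
    gcongr
    rw [← hP.sum_setIntegral hφ cp, ← hsplit]
    have hz : ∑ K ∈ B, ∫ z in Ω \ ⋃ K ∈ B, K, K.indicator φ z * |u z| ^ p = 0 := by
      refine Finset.sum_eq_zero fun K hK => setIntegral_eq_zero_of_forall_eq_zero fun z hz => ?_
      rw [indicator_of_notMem fun hzK => hz.2 (mem_iUnion₂.2 ⟨K, hK, hzK⟩), zero_mul]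
    rw [hz, zero_add]
    refine Finset.sum_le_sum fun K hK => ?_
    have hKP := (Finset.mem_filter.1 hK).1
    exact setIntegral_le_integral ((hKc K hKP).integrable_mul cp) (.of_forall (hnn K hKP))
  -- the ends
  set C := (2 : ℝ) ^ (p + 3) * 2 ^ p * σ with hC
  have hC0 : 0 ≤ C := by positivity
  have hC8 : C ≤ 1 / 8 := by
    have : C * 2 ≤ C * (piP p ^ p + 2) := by gcongr; linarith
    linarith
  have hends : ∫ z in Prod.fst ⁻¹' (Icc 0 σ ∪ Icc (1 - σ) 1), Ω.indicator φ z * |u z| ^ p ≤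
      MG + C * (M Ω + E Ω) + (C * 2 + 1) * ε * μ Ω := by
    rw [← hP.sum_setIntegral hφ cp, ← hsplit]
    have h1 : ∑ K ∈ B, ∫ z in Prod.fst ⁻¹' (Icc 0 σ ∪ Icc (1 - σ) 1),
        K.indicator φ z * |u z| ^ p ≤
        ∑ K ∈ B, (C * (M K + E K) + (C * 2 + 1) * ε * μ K) :=
      Finset.sum_le_sum fun K hK => (hL K hK).end_estimate hp (hKc K (hBP K hK)) hg hmod'
        (closure_mono (hP.subset K (hBP K hK))) hε.le hη hδ₁8 hσ0.le hσ
    have h2 := h1.trans (hsub _ fun K hK => add_nonneg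
      (mul_nonneg hC0 (add_nonneg (hM0 K hK) (hE0 K hK)))
      (mul_nonneg (by positivity) (hμ0 K hK)))
    rw [Finset.sum_add_distrib, ← Finset.mul_sum, ← Finset.mul_sum, Finset.sum_add_distrib, hMs,
      hEs, hμs] at h2
    have h3 : ∑ K ∈ Gd, ∫ z in Prod.fst ⁻¹' (Icc 0 σ ∪ Icc (1 - σ) 1),
        K.indicator φ z * |u z| ^ p ≤ MG := by
      refine Finset.sum_le_sum fun K hK => ?_
      have hKP := (Finset.mem_filter.1 hK).1
      exact setIntegral_le_integral ((hKc K hKP).integrable_mul cp) (.of_forall (hnn K hKP))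
    linarith
  have htotal : M Ω ≤ (∫ z in Prod.fst ⁻¹' Ioo σ (1 - σ), Ω.indicator φ z * |u z| ^ p) +
      ∫ z in Prod.fst ⁻¹' (Icc 0 σ ∪ Icc (1 - σ) 1), Ω.indicator φ z * |u z| ^ p := by
    have i0 := hφ.integrable_mul cp
    have hm2 : MeasurableSet (Icc 0 σ ∪ Icc (1 - σ) 1) := measurableSet_Icc.union measurableSet_Icc
    rw [← setIntegral_union ?_ (hm2.preimage measurable_fst) i0.integrableOn i0.integrableOn]
    · refine le_of_eq (setIntegral_eq_integral_of_forall_compl_eq_zero fun z hz => ?_).symm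
      rw [indicator_of_notMem, zero_mul]
      intro hzΩ
      have h1 := hΩ.fst_mem z hzΩ
      apply hz
      rcases le_or_gt z.1 σ with h | h
      · exact Or.inr (Or.inl ⟨h1.1.le, h⟩)
      · rcases le_or_gt (1 - σ) z.1 with h' | h'
        · exact Or.inr (Or.inr ⟨h', h1.2.le⟩)
        · exact Or.inl ⟨h, h'⟩
    · refine Disjoint.preimage _ (Set.disjoint_left.2 ?_)
      rintro x hx (hx' | hx')
      · exact hx.1.not_ge hx'.2
      · exact hx.2.not_ge hx'.1
  set D := (2 : ℝ) ^ (p + 1) * 4 ^ m with hD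
  have hD0 : 0 ≤ D := by positivity
  change E Ω ≤ (piP p ^ p + 1) * M Ω at hE
  change (piP p ^ p + κ / (2 * (1 + D))) * M Ω ≤ E Ω +
    ε * (2 * (piP p ^ p + g + 1) + 2 * κ) * μ Ω
  have k1 : D * (η ^ p * E Ω) ≤ 1 / 4 * M Ω := by
    calc D * (η ^ p * E Ω) ≤ D * (η ^ p * ((piP p ^ p + 1) * M Ω)) := by gcongr
      _ = (D * η ^ p * (piP p ^ p + 1)) * M Ω := by ring
      _ ≤ _ := by gcongr
  have k2 : C * (M Ω + E Ω) ≤ 1 / 4 * M Ω := by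
    calc C * (M Ω + E Ω) ≤ C * (M Ω + (piP p ^ p + 1) * M Ω) := by gcongr
      _ = (C * (piP p ^ p + 2)) * M Ω := by ring
      _ ≤ _ := by gcongr
  have k3 : (C * 2 + 1) * ε * μ Ω ≤ 2 * (ε * μ Ω) := by
    rw [mul_assoc]
    have : 0 ≤ ε * μ Ω := by positivity
    exact mul_le_mul_of_nonneg_right (by linarith) this
  have k4 : M Ω / 2 ≤ (1 + D) * MG + 2 * (ε * μ Ω) := by linarith
  have k5 : M Ω / (2 * (1 + D)) ≤ MG + 2 * (ε * μ Ω) := by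
    have h0 : 0 ≤ ε * μ Ω := by positivity
    rw [div_le_iff₀ (by positivity)]
    nlinarith only [k4, mul_nonneg hD0 h0, h0]
  have k6 := mul_le_mul_of_nonneg_left k5 hκ0
  have k7 : κ / (2 * (1 + D)) * M Ω = κ * (M Ω / (2 * (1 + D))) := by ring
  rw [add_mul, k7]
  linarith

/-- The improved inequality for continuously differentiable functions on narrow domains. -/
theorem exists_narrow_inequality {p : ℝ} (hp : 1 < p) (m : ℕ) :
    ∃ η₀ c : ℝ, 0 < η₀ ∧ 0 < c ∧ ∀ (η : ℝ) (Ω : Set (ℝ × ℝ)) (φ u ux uy : ℝ × ℝ → ℝ),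
      NarrowDomain η Ω → PowConcave m Ω φ → Ω.Nonempty → η ≤ η₀ → HasGrad u ux uy →
      wint Ω φ (fun z => sgnPow p (u z)) = 0 →
      (piP p ^ p + c * η ^ 2) * wint Ω φ (fun z => |u z| ^ p) ≤
        wint Ω φ (gradPow p ux uy) := by
  have hπ : 0 < piP p ^ p := Real.rpow_pos_of_pos (piP_pos hp) p
  set C := (2 : ℝ) ^ (p + 3) * 2 ^ p * (piP p ^ p + 2) with hC
  have hC0 : 0 < C := by positivity
  set σ := min (1 / 4) (1 / (4 * C)) with hσ
  have hσ0 : 0 < σ := by positivity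
  have hσ4 : σ ≤ 1 / 4 := min_le_left _ _
  have hσC : σ * C ≤ 1 / 4 := by
    have := (le_div_iff₀ (by positivity)).1 (min_le_right (1 / 4) (1 / (4 * C)))
    linarith
  set k : ℝ := 3 / 8 * (1 / 4) ^ m with hk
  have hk0 : 0 < k := by positivity
  have hk1 : k ≤ 1 := by
    have : (1 / 4 : ℝ) ^ m ≤ 1 := pow_le_one₀ (by norm_num) (by norm_num)
    linarith
  set δ₁ := k * σ / 160 with hδ₁
  have hδ₁0 : 0 < δ₁ := by positivity
  obtain ⟨g, hg0, hgain⟩ := exists_gain_of_not_isFlat hp (s₀ := 1 / 25) (by norm_num) hδ₁0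
    (by rw [hδ₁]; nlinarith)
  set D := (2 : ℝ) ^ (p + 1) * 4 ^ m with hD
  have hD0 : 0 < D := by positivity
  set η₀ := min (min 1 (1 / (4 * D * (piP p ^ p + 1)))) (min (δ₁ / 5) ((k * σ) ^ 2 / 3200))
    with hη₀
  set c₂ := min g (piP p ^ p * ((k * σ) ^ 2 / 256)) with hc₂
  have hc₂0 : 0 < c₂ := by positivity
  refine ⟨η₀, min (c₂ / (2 * (1 + D))) 1, by positivity, by positivity, ?_⟩
  intro η Ω φ u ux uy hΩ hφ hne hη hg hmean
  have hη0 := hΩ.pos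
  have hη1 : η ≤ 1 := hη.trans ((min_le_left _ _).trans (min_le_left _ _))
  have hηD : η ≤ 1 / (4 * D * (piP p ^ p + 1)) :=
    hη.trans ((min_le_left _ _).trans (min_le_right _ _))
  have hηδ : η ≤ δ₁ / 5 := hη.trans ((min_le_right _ _).trans (min_le_left _ _))
  have hηk : η ≤ (k * σ) ^ 2 / 3200 := hη.trans ((min_le_right _ _).trans (min_le_right _ _))
  have hη2 : η ^ 2 ≤ η := by nlinarith
  set M := wint Ω φ (fun z => |u z| ^ p) with hM
  have hM0 : 0 ≤ M := hφ.wint_nonneg fun z => by positivity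
  rcases le_or_gt (wint Ω φ (gradPow p ux uy)) ((piP p ^ p + 1) * M) with hE | hE
  · have hηp : D * η ^ p * (piP p ^ p + 1) ≤ 1 / 4 := by
      have h1 : η ^ p ≤ η := by
        simpa using Real.rpow_le_rpow_of_exponent_ge hη0 hη1 hp.le
      rw [le_div_iff₀ (by positivity)] at hηD
      have h2 : D * η ^ p * (piP p ^ p + 1) ≤ D * η * (piP p ^ p + 1) := by gcongr
      linarith
    have happ : ∀ ε : ℝ, 0 < ε → _ := fun ε hε => hΩ.approx_inequality hp hφ hne hg hmean hσ0 hσ4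
      (by rw [hC] at hσC; linarith) (δ₁ := δ₁) (g := g) (κ := c₂ * η ^ 2)
      (τ := (k * σ) ^ 2 * η ^ 2 / 128) (ε := ε) le_rfl hg0.le hgain (by linarith) (by rw [← hk]; linarith)
      hηp rfl (by positivity) (by
        have h1 : c₂ ≤ g := min_le_left _ _
        nlinarith [sq_nonneg η]) (by
        have h1 : c₂ ≤ piP p ^ p * ((k * σ) ^ 2 / 256) := min_le_right _ _
        have := mul_le_mul_of_nonneg_right h1 (sq_nonneg η)
        linarith) hε hE
    have hlim : (piP p ^ p + c₂ * η ^ 2 / (2 * (1 + D))) * M ≤ wint Ω φ (gradPow p ux uy) := by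
      set N := (2 * (piP p ^ p + g + 1) + 2 * (c₂ * η ^ 2)) * mass Ω φ with hN
      refine le_of_forall_pos_le_add fun e he => ?_
      have hN0 : 0 ≤ N := mul_nonneg (by positivity) hφ.mass_nonneg
      refine (happ (e / (N + 1)) (by positivity)).trans ?_
      gcongr
      rw [mul_assoc, ← hN, div_mul_eq_mul_div, div_le_iff₀ (by positivity)]
      nlinarith
    refine le_trans ?_ hlim
    refine mul_le_mul_of_nonneg_right ?_ hM0
    have := mul_le_mul_of_nonneg_right (min_le_left (c₂ / (2 * (1 + D))) 1) (sq_nonneg η)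
    rw [div_mul_eq_mul_div] at this
    linarith
  · refine le_trans (mul_le_mul_of_nonneg_right ?_ hM0) hE.le
    have := mul_le_mul_of_nonneg_right (min_le_right (c₂ / (2 * (1 + D))) 1) (sq_nonneg η)
    linarith

open scoped Convolution in
/-- The mollification of a function on the plane. -/
noncomputable def mollify {F : Type*} [NormedAddCommGroup F] [NormedSpace ℝ F]
    (ψ : ContDiffBump (0 : ℝ × ℝ)) (u : ℝ × ℝ → F) : ℝ × ℝ → F :=
  ψ.normed volume ⋆[ContinuousLinearMap.lsmul ℝ ℝ, volume] u

theorem locallyIntegrable_fderiv_of_lipschitzWith {K : NNReal} {u : ℝ × ℝ → ℝ}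
    (hu : LipschitzWith K u) : LocallyIntegrable (fderiv ℝ u) := by
  refine (locallyIntegrable_const (K : ℝ)).mono
    (measurable_fderiv ℝ u).aestronglyMeasurable (.of_forall fun z => ?_)
  simpa using norm_fderiv_le_of_lipschitz ℝ hu

theorem continuous_mollify_fderiv {K : NNReal} {u : ℝ × ℝ → ℝ} (hu : LipschitzWith K u)
    (ψ : ContDiffBump (0 : ℝ × ℝ)) : Continuous (mollify ψ (fderiv ℝ u)) :=
  ψ.hasCompactSupport_normed.continuous_convolution_left _ ψ.continuous_normed
    (locallyIntegrable_fderiv_of_lipschitzWith hu)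

theorem norm_mollify_fderiv_le {K : NNReal} {u : ℝ × ℝ → ℝ} (hu : LipschitzWith K u)
    (ψ : ContDiffBump (0 : ℝ × ℝ)) (z : ℝ × ℝ) : ‖mollify ψ (fderiv ℝ u) z‖ ≤ K := by
  have hi : Integrable fun t => ψ.normed volume t * (K : ℝ) :=
    (ψ.continuous_normed.integrable_of_hasCompactSupport ψ.hasCompactSupport_normed).mul_const _
  refine (norm_integral_le_of_norm_le hi (.of_forall fun t => ?_)).trans ?_
  · rw [ContinuousLinearMap.lsmul_apply, norm_smul, Real.norm_of_nonneg (ψ.nonneg_normed t)]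
    exact mul_le_mul_of_nonneg_left (norm_fderiv_le_of_lipschitz ℝ hu) (ψ.nonneg_normed t)
  · rw [integral_mul_const, ψ.integral_normed, one_mul]

theorem abs_mollify_sub_le {K : NNReal} {u : ℝ × ℝ → ℝ} (hu : LipschitzWith K u)
    (ψ : ContDiffBump (0 : ℝ × ℝ)) (z : ℝ × ℝ) : |mollify ψ u z - u z| ≤ K * ψ.rOut := by
  refine ψ.dist_normed_convolution_le hu.continuous.aestronglyMeasurable fun w hw => ?_
  exact (hu.dist_le_mul w z).trans (mul_le_mul_of_nonneg_left (Metric.mem_ball.1 hw).le K.2)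

theorem hasFDerivAt_mollify {K : NNReal} {u : ℝ × ℝ → ℝ} (hu : LipschitzWith K u)
    (ψ : ContDiffBump (0 : ℝ × ℝ)) (z : ℝ × ℝ) :
    HasFDerivAt (mollify ψ u) (mollify ψ (fderiv ℝ u) z) z := by
  have hψi : Integrable (ψ.normed volume) :=
    ψ.continuous_normed.integrable_of_hasCompactSupport ψ.hasCompactSupport_normed
  have hc : ∀ x : ℝ × ℝ, Continuous fun t => ψ.normed volume t • u (x - t) := fun x =>
    ψ.continuous_normed.smul (hu.continuous.comp (continuous_const.sub continuous_id))
  refine (hasFDerivAt_integral_of_dominated_loc_of_lip (μ := volume)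
    (F := fun x t => ψ.normed volume t • u (x - t))
    (F' := fun t => ψ.normed volume t • fderiv ℝ u (z - t))
    (bound := fun t => ψ.normed volume t * K) univ_mem
    (.of_forall fun x => (hc x).aestronglyMeasurable)
    ((hc z).integrable_of_hasCompactSupport ψ.hasCompactSupport_normed.smul_right)
    ?_ (.of_forall fun t => ?_) (hψi.mul_const _) ?_).2
  · exact (ψ.continuous_normed.measurable.smul
      ((measurable_fderiv ℝ u).comp (measurable_const.sub measurable_id))).aestronglyMeasurable
  · refine LipschitzOnWith.of_dist_le_mul fun x _ y _ => ?_
    have h0 := ψ.nonneg_normed (μ := volume) t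
    rw [dist_smul₀, Real.norm_of_nonneg h0, Real.coe_nnabs, abs_of_nonneg (by positivity),
      mul_assoc]
    refine mul_le_mul_of_nonneg_left ((hu.dist_le_mul _ _).trans_eq ?_) h0
    rw [dist_sub_right]
  · have h1 : ∀ᵐ t : ℝ × ℝ, DifferentiableAt ℝ u (z - t) :=
      (Measure.measurePreserving_sub_left volume z).quasiMeasurePreserving.ae hu.ae_differentiableAt
    filter_upwards [h1] with t ht
    have h2 : HasFDerivAt (fun x => u (x - t)) (fderiv ℝ u (z - t)) z := 
      (ht.hasFDerivAt.comp z ((hasFDerivAt_id z).sub_const t)).congr_fderiv (by simp)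
    exact h2.fun_const_smul _

theorem hasGrad_mollify {K : NNReal} {u : ℝ × ℝ → ℝ} (hu : LipschitzWith K u)
    (ψ : ContDiffBump (0 : ℝ × ℝ)) : HasGrad (mollify ψ u)
      (fun z => mollify ψ (fderiv ℝ u) z (1, 0)) (fun z => mollify ψ (fderiv ℝ u) z (0, 1)) where
  continuous_fst := (continuous_mollify_fderiv hu ψ).clm_apply continuous_const
  continuous_snd := (continuous_mollify_fderiv hu ψ).clm_apply continuous_const
  hasFDerivAt z := (hasFDerivAt_mollify hu ψ z).congr_fderiv (by ext <;> simp)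

/-- A sequence of bump functions shrinking to the origin. -/
noncomputable def shrinkingBump (n : ℕ) : ContDiffBump (0 : ℝ × ℝ) where
  rIn := 1 / (2 * ((n : ℝ) + 1))
  rOut := 1 / ((n : ℝ) + 1)
  rIn_pos := by positivity
  rIn_lt_rOut := by
    have : (0 : ℝ) < (n : ℝ) + 1 := by positivity
    exact one_div_lt_one_div_of_lt this (by linarith)

theorem tendsto_rOut_shrinkingBump : Tendsto (fun n => (shrinkingBump n).rOut) atTop (𝓝 0) :=
  tendsto_one_div_add_atTop_nhds_zero_nat

theorem ae_tendsto_mollify_fderiv {K : NNReal} {u : ℝ × ℝ → ℝ} (hu : LipschitzWith K u) :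
    ∀ᵐ z, Tendsto (fun n => mollify (shrinkingBump n) (fderiv ℝ u) z) atTop
      (𝓝 (fderiv ℝ u z)) :=
  ContDiffBump.ae_convolution_tendsto_right_of_locallyIntegrable (K := 2)
    tendsto_rOut_shrinkingBump (.of_forall fun n => by
      change 1 / ((n : ℝ) + 1) ≤ 2 * (1 / (2 * ((n : ℝ) + 1)))
      apply le_of_eq
      field_simp)
    (locallyIntegrable_fderiv_of_lipschitzWith hu)

theorem HasGrad.sub_const {u ux uy : ℝ × ℝ → ℝ} (h : HasGrad u ux uy) (κ : ℝ) :
    HasGrad (fun z => u z - κ) ux uy :=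
  ⟨h.continuous_fst, h.continuous_snd, fun z => (h.hasFDerivAt z).sub_const κ⟩

theorem abs_sgnPow_sub_le {p R s κ : ℝ} (hp : 1 < p) (hs : |s| ≤ R) (hκ : κ ∈ Icc (-R) R) :
    |sgnPow p (s - κ)| ≤ (2 * R) ^ (p - 1) := by
  rw [abs_sgnPow _ hp]
  refine Real.rpow_le_rpow (abs_nonneg _) ?_ (by linarith)
  have h1 : |κ| ≤ R := abs_le.2 hκ
  linarith [abs_sub s κ]

/-- Every continuous function has a `p`-mean. -/
theorem PowConcave.exists_sub_const_mean_eq_zero {m : ℕ} {K : Set (ℝ × ℝ)} {φ : ℝ × ℝ → ℝ}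
    (h : PowConcave m K φ) {p : ℝ} (hp : 1 < p) {v : ℝ × ℝ → ℝ} (hv : Continuous v) {R : ℝ}
    (hR0 : 0 ≤ R) (hR : ∀ z ∈ K, |v z| ≤ R) :
    ∃ κ ∈ Icc (-R) R, wint K φ (fun z => sgnPow p (v z - κ)) = 0 := by
  have hcont : ContinuousOn (fun κ => wint K φ (fun z => sgnPow p (v z - κ))) (Icc (-R) R) := by
    refine continuousOn_of_dominated (bound := fun z => K.indicator φ z * (2 * R) ^ (p - 1))
      (fun κ _ => ?_) (fun κ hκ => .of_forall fun z => ?_) (h.integrable.mul_const _)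
      (.of_forall fun z => ?_)
    · exact (h.integrable_mul ((continuous_sgnPow hp).comp
        (hv.sub continuous_const))).aestronglyMeasurable
    · by_cases hz : z ∈ K
      · rw [norm_mul, Real.norm_of_nonneg (h.indicator_nonneg' z)]
        exact mul_le_mul_of_nonneg_left (abs_sgnPow_sub_le hp (hR z hz) hκ)
          (h.indicator_nonneg' z)
      · simp [indicator_of_notMem hz]
    · exact (continuous_const.mul ((continuous_sgnPow hp).comp
        (continuous_const.sub continuous_id))).continuousOn
  have hpos : ∀ t : ℝ, 0 ≤ t → 0 ≤ sgnPow p t := fun t ht =>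
    mul_nonneg (by positivity) ht
  have hneg : ∀ t : ℝ, t ≤ 0 → sgnPow p t ≤ 0 := fun t ht =>
    mul_nonpos_of_nonneg_of_nonpos (by positivity) ht
  have hivt := intermediate_value_Icc' (by linarith : -R ≤ R) hcont
  refine hivt ⟨integral_nonpos fun z => ?_, integral_nonneg fun z => ?_⟩
  · by_cases hz : z ∈ K
    · exact mul_nonpos_of_nonneg_of_nonpos (h.indicator_nonneg' z)
        (hneg _ (by linarith [(abs_le.1 (hR z hz)).2]))
    · simp [indicator_of_notMem hz]
  · by_cases hz : z ∈ K
    · exact mul_nonneg (h.indicator_nonneg' z) (hpos _ (by linarith [(abs_le.1 (hR z hz)).1]))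
    · simp [indicator_of_notMem hz]

/-- An inequality between the energy and the norm passes from continuously differentiable to
Lipschitz functions. -/
theorem PowConcave.lipschitz_inequality {m : ℕ} {Ω : Set (ℝ × ℝ)} {φ : ℝ × ℝ → ℝ}
    (h : PowConcave m Ω φ) {p Λ : ℝ} (hp : 1 < p) (hΛ : 0 ≤ Λ)
    (hC : ∀ v vx vy, HasGrad v vx vy → wint Ω φ (fun z => sgnPow p (v z)) = 0 →
      Λ * wint Ω φ (fun z => |v z| ^ p) ≤ wint Ω φ (gradPow p vx vy))
    {K : NNReal} {u : ℝ × ℝ → ℝ} (hu : LipschitzWith K u)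
    (hmean : wint Ω φ (fun z => sgnPow p (u z)) = 0) :
    Λ * wint Ω φ (fun z => |u z| ^ p) ≤ wint Ω φ
      (gradPow p (fun z => fderiv ℝ u z (1, 0)) (fun z => fderiv ℝ u z (0, 1))) := by
  set v := fun n => mollify (shrinkingBump n) u with hv
  set G := fun n => mollify (shrinkingBump n) (fderiv ℝ u) with hG
  set r := fun n => (shrinkingBump n).rOut with hr
  have hvg : ∀ n, HasGrad (v n) (fun z => G n z (1, 0)) (fun z => G n z (0, 1)) := fun n =>
    hasGrad_mollify hu _
  have hr1 : ∀ n, r n ≤ 1 := fun n => by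
    change 1 / ((n : ℝ) + 1) ≤ 1
    rw [div_le_one (by positivity)]
    linarith [n.cast_nonneg (α := ℝ)]
  have hr0 : ∀ n, 0 < r n := fun n => (shrinkingBump n).rOut_pos
  have hvu : ∀ n z, |v n z - u z| ≤ K * r n := fun n z => abs_mollify_sub_le hu _ z
  obtain ⟨B, hB⟩ := h.isBounded.isCompact_closure.exists_bound_of_continuousOn
    hu.continuous.continuousOn
  set R := max B 0 + K with hRdef
  have hK0 : (0 : ℝ) ≤ K := K.2
  have hR0 : 0 ≤ R := by positivity
  have huR : ∀ z ∈ Ω, |u z| ≤ max B 0 := fun z hz =>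
    (hB z (subset_closure hz)).trans (le_max_left _ _)
  have hvR : ∀ n, ∀ z ∈ Ω, |v n z| ≤ R := fun n z hz => by
    have h1 := abs_le.1 (huR z hz)
    have h2 := abs_le.1 (hvu n z)
    have h3 : K * r n ≤ K := mul_le_of_le_one_right hK0 (hr1 n)
    exact abs_le.2 ⟨by linarith, by linarith⟩
  choose κ hκ hκm using fun n =>
    h.exists_sub_const_mean_eq_zero hp (hvg n).continuous hR0 (hvR n)
  set A := p * (2 * R) ^ (p - 1) * K with hA
  have hlow : ∀ n, wint Ω φ (fun z => |u z| ^ p) ≤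
      wint Ω φ (fun z => |v n z - κ n| ^ p) + A * mass Ω φ * r n := by
    intro n
    refine (h.wint_le_wint_sub hp hu.continuous hmean (κ n)).trans ?_
    have c1 : Continuous fun z => |u z - κ n| ^ p :=
      (hu.continuous.sub continuous_const).abs_rpow_const hp
    have c2 : Continuous fun z => |v n z - κ n| ^ p :=
      ((hvg n).continuous.sub continuous_const).abs_rpow_const hp
    rw [mass, mul_right_comm, ← integral_const_mul, wint, wint,
      ← integral_add (h.integrable_mul c2) (h.integrable.const_mul _)]
    refine integral_mono (h.integrable_mul c1)
      ((h.integrable_mul c2).add (h.integrable.const_mul _)) fun z => ?_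
    by_cases hz : z ∈ Ω
    · have h1 := tangent_abs_rpow_le hp (u z - κ n) (v n z - κ n)
      have h2 : |sgnPow p (u z - κ n) * (v n z - u z)| ≤ (2 * R) ^ (p - 1) * (K * r n) := by
        rw [abs_mul]
        exact mul_le_mul (abs_sgnPow_sub_le hp ((huR z hz).trans (by linarith)) (hκ n))
          (hvu n z) (abs_nonneg _) (by positivity)
      have h3 : |u z - κ n| ^ p ≤ |v n z - κ n| ^ p + A * r n := by
        have h4 := mul_le_mul_of_nonneg_left (abs_le.1 h2).1 (by linarith : 0 ≤ p)
        rw [hA]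
        linarith
      have := mul_le_mul_of_nonneg_left h3 (h.indicator_nonneg' z)
      dsimp only
      linarith
    · simp [indicator_of_notMem hz]
  have hlim : Tendsto (fun n => wint Ω φ (gradPow p (fun z => G n z (1, 0))
      (fun z => G n z (0, 1)))) atTop (𝓝 (wint Ω φ (gradPow p (fun z => fderiv ℝ u z (1, 0))
        (fun z => fderiv ℝ u z (0, 1))))) := by
    refine tendsto_integral_of_dominated_convergence
      (fun z => Ω.indicator φ z * ((K : ℝ) ^ 2 + K ^ 2) ^ (p / 2))
      (fun n => (h.integrable_mul ((hvg n).continuous_gradPow hp)).aestronglyMeasurable)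
      (h.integrable.mul_const _) (fun n => .of_forall fun z => ?_) ?_
    · rw [norm_mul, Real.norm_of_nonneg (h.indicator_nonneg' z),
        Real.norm_of_nonneg (gradPow_nonneg _ _ z)]
      refine mul_le_mul_of_nonneg_left ?_ (h.indicator_nonneg' z)
      have hb : ∀ w : ℝ × ℝ, ‖w‖ ≤ 1 → G n z w ^ 2 ≤ (K : ℝ) ^ 2 := fun w hw => by
        refine sq_le_sq.2 ?_
        rw [abs_of_nonneg hK0]
        exact ((G n z).unit_le_opNorm w hw).trans (norm_mollify_fderiv_le hu _ z)
      refine Real.rpow_le_rpow (by positivity) ?_ (by linarith)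
      exact add_le_add (hb _ (by simp [Prod.norm_def])) (hb _ (by simp [Prod.norm_def]))
    · filter_upwards [ae_tendsto_mollify_fderiv hu] with z hz
      refine Tendsto.const_mul _ (Tendsto.rpow_const ?_ (Or.inr (by linarith)))
      have ha : ∀ w : ℝ × ℝ, Tendsto (fun n => G n z w) atTop (𝓝 (fderiv ℝ u z w)) := fun w =>
        ((ContinuousLinearMap.apply ℝ ℝ w).continuous.tendsto _).comp hz
      exact ((ha _).pow 2).add ((ha _).pow 2)
  have hlim2 : Tendsto (fun n => wint Ω φ (gradPow p (fun z => G n z (1, 0))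
      (fun z => G n z (0, 1))) + Λ * (A * mass Ω φ * r n)) atTop
      (𝓝 (wint Ω φ (gradPow p (fun z => fderiv ℝ u z (1, 0))
        (fun z => fderiv ℝ u z (0, 1))) + Λ * (A * mass Ω φ * 0))) :=
    hlim.add ((tendsto_rOut_shrinkingBump.const_mul _).const_mul _)
  rw [mul_zero, mul_zero, add_zero] at hlim2
  refine ge_of_tendsto' hlim2 fun n => ?_
  have h1 := hC _ _ _ ((hvg n).sub_const (κ n)) (hκm n)
  have h2 := mul_le_mul_of_nonneg_left (hlow n) hΛ
  linarith

theorem sq_dist_le_of_mem_closure {Ω : Set (ℝ × ℝ)}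
    (hd : ∀ z ∈ Ω, ∀ w ∈ Ω, (z.1 - w.1) ^ 2 + (z.2 - w.2) ^ 2 ≤ 1) {z w : ℝ × ℝ} (hz : z ∈ Ω)
    (hw : w ∈ closure Ω) : (z.1 - w.1) ^ 2 + (z.2 - w.2) ^ 2 ≤ 1 :=
  closure_minimal (t := {w : ℝ × ℝ | (z.1 - w.1) ^ 2 + (z.2 - w.2) ^ 2 ≤ 1})
    (fun w hw => hd z hz w hw) (isClosed_le (by fun_prop) continuous_const) hw

theorem mem_of_mem_closure_of_mem {Ω : Set (ℝ × ℝ)} (ho : IsOpen Ω) (hc : Convex ℝ Ω)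
    {q x y s : ℝ} (hq : (q, (0 : ℝ)) ∈ closure Ω) (hz : (x, y) ∈ Ω) (hs0 : 0 < s) (hs1 : s ≤ 1) :
    (q + s * (x - q), s * y) ∈ Ω := by
  rcases hs1.eq_or_lt with rfl | hs
  · simpa using hz
  · have h1 := hc.openSegment_interior_closure_subset_interior (ho.interior_eq.symm ▸ hz) hq
    rw [ho.interior_eq] at h1
    refine h1 ⟨s, 1 - s, hs0, by linarith, by ring, ?_⟩
    ext <;> simp
    ring

theorem width_scale_le {Ω : Set (ℝ × ℝ)} (ho : IsOpen Ω) (hc : Convex ℝ Ω)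
    (hb : Bornology.IsBounded Ω) {q x s : ℝ} (hq : (q, (0 : ℝ)) ∈ closure Ω) (hs0 : 0 < s)
    (hs1 : s ≤ 1) : s * width Ω x ≤ width Ω (q + s * (x - q)) := by
  have hsub : slice Ω x ⊆ (s * ·) ⁻¹' slice Ω (q + s * (x - q)) := fun y hy =>
    mem_of_mem_closure_of_mem ho hc hq hy hs0 hs1
  have hfin : volume (slice Ω (q + s * (x - q))) ≠ ⊤ :=
    (isBounded_slice hb _).measure_lt_top.ne
  have h1 : width Ω x ≤ s⁻¹ * width Ω (q + s * (x - q)) := by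
    have h2 := measure_mono (μ := volume) hsub
    rw [Real.volume_preimage_mul_left hs0.ne'] at h2
    have h3 := ENNReal.toReal_mono (ENNReal.mul_ne_top ENNReal.ofReal_ne_top hfin) h2
    rwa [ENNReal.toReal_mul, ENNReal.toReal_ofReal (abs_nonneg _),
      abs_of_pos (inv_pos.2 hs0)] at h3
  rwa [inv_mul_eq_div, le_div_iff₀ hs0, mul_comm] at h1

/-- A convex set of unit diameter attained on the segment `[0, 1] × {0}` is a narrow domain. -/
theorem narrowDomain_iSup_width {Ω : Set (ℝ × ℝ)} (ho : IsOpen Ω) (hc : Convex ℝ Ω)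
    (hb : Bornology.IsBounded Ω) (hne : Ω.Nonempty)
    (hd : ∀ z ∈ Ω, ∀ w ∈ Ω, (z.1 - w.1) ^ 2 + (z.2 - w.2) ^ 2 ≤ 1)
    (h0 : ((0 : ℝ), (0 : ℝ)) ∈ closure Ω) (h1 : ((1 : ℝ), (0 : ℝ)) ∈ closure Ω) :
    NarrowDomain (⨆ x, width Ω x) Ω := by
  have hfin : ∀ x, volume (slice Ω x) ≠ ⊤ := fun x => (isBounded_slice hb x).measure_lt_top.ne
  have hIcc : ∀ z ∈ Ω, z.1 ∈ Icc (0 : ℝ) 1 := fun z hz => by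
    have e0 := sq_dist_le_of_mem_closure hd hz h0
    have e1 := sq_dist_le_of_mem_closure hd hz h1
    dsimp only at e0 e1
    exact ⟨by nlinarith [sq_nonneg z.2], by nlinarith [sq_nonneg z.2]⟩
  have hIoo : ∀ z ∈ Ω, z.1 ∈ Ioo (0 : ℝ) 1 := fun z hz => by
    have hmem : Prod.fst '' Ω ⊆ interior (Icc (0 : ℝ) 1) :=
      interior_maximal (by rintro _ ⟨w, hw, rfl⟩; exact hIcc w hw) (isOpenMap_fst Ω ho)
    rw [interior_Icc] at hmem
    exact hmem ⟨z, hz, rfl⟩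
  have hbd : BddAbove (range fun x => width Ω x) := by
    refine ⟨2, ?_⟩
    rintro _ ⟨x, rfl⟩
    have hs : slice Ω x ⊆ Icc (-1) 1 := fun y hy => by
      have e0 := sq_dist_le_of_mem_closure hd hy h0
      dsimp only at e0
      exact ⟨by nlinarith [sq_nonneg (x - 0)], by nlinarith [sq_nonneg (x - 0)]⟩
    have := measureReal_mono (μ := volume) hs measure_Icc_lt_top.ne
    rw [Real.volume_real_Icc] at this
    norm_num at this
    exact this
  have hle : ∀ x, width Ω x ≤ ⨆ x, width Ω x := fun x => le_ciSup hbd x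
  refine ⟨?_, ho, hc, hd, ?_, hIoo, hle, ?_⟩
  · obtain ⟨⟨x, y⟩, hz⟩ := hne
    refine lt_of_lt_of_le ?_ (hle x)
    exact ENNReal.toReal_pos ((isOpen_slice ho x).measure_pos volume ⟨y, hz⟩).ne' (hfin x)
  · rintro ⟨x, y⟩ hz
    refine le_trans ?_ (hle x)
    have hx := hIcc _ hz
    have hxc : (x, (0 : ℝ)) ∈ closure Ω := by
      have := hc.closure h0 h1 (sub_nonneg.2 hx.2) hx.1 (by ring)
      simpa using this
    have hs : ∀ s ∈ Ioo (0 : ℝ) 1, s * y ∈ slice Ω x := fun s hs => by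
      have := mem_of_mem_closure_of_mem ho hc hxc hz hs.1 hs.2.le
      rwa [sub_self, mul_zero, add_zero] at this
    rcases lt_trichotomy y 0 with hy | rfl | hy
    · have hsub : Ioo y 0 ⊆ slice Ω x := fun t ht => by
        have := hs (t / y) ⟨div_pos_of_neg_of_neg ht.2 hy, (div_lt_one_of_neg hy).2 ht.1⟩
        rwa [div_mul_cancel₀ _ hy.ne] at this
      have := measureReal_mono (μ := volume) hsub (hfin x)
      rw [Real.volume_real_Ioo_of_le hy.le] at this
      rw [abs_of_neg hy]
      linarith [this, show width Ω x = volume.real (slice Ω x) from rfl]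
    · simp [width]
    · have hsub : Ioo 0 y ⊆ slice Ω x := fun t ht => by
        have := hs (t / y) ⟨div_pos ht.1 hy, (div_lt_one hy).2 ht.2⟩
        rwa [div_mul_cancel₀ _ hy.ne'] at this
      have := measureReal_mono (μ := volume) hsub (hfin x)
      rw [Real.volume_real_Ioo_of_le hy.le] at this
      rw [abs_of_pos hy]
      linarith [this, show width Ω x = volume.real (slice Ω x) from rfl]
  · intro x hx
    have hw0 : ∀ t, 0 ≤ width Ω t := fun t => measureReal_nonneg
    have hm0 : 0 ≤ min x (1 - x) := le_min hx.1 (by linarith [hx.2])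
    rw [Real.mul_iSup_of_nonneg hm0]
    refine ciSup_le fun t => ?_
    rcases (slice Ω t).eq_empty_or_nonempty with he | ⟨y, hy⟩
    · have : width Ω t = 0 := by simp [width, he]
      rw [this, mul_zero]
      exact hw0 x
    obtain ⟨ht0, ht1⟩ := hIoo _ hy
    dsimp only at ht0 ht1
    rcases le_or_gt x t with hxt | hxt
    · rcases hx.1.eq_or_lt with rfl | hx0
      · simpa using hw0 0
      have := width_scale_le ho hc hb (x := t) (s := x / t) h0 (by positivity)
        ((div_le_one ht0).2 hxt)
      rw [sub_zero, zero_add, div_mul_cancel₀ _ ht0.ne'] at this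
      refine le_trans (mul_le_mul_of_nonneg_right ?_ (hw0 t)) this
      refine (min_le_left _ _).trans ?_
      rw [le_div_iff₀ ht0]
      nlinarith
    · rcases hx.2.eq_or_lt with rfl | hx1
      · simpa using hw0 1
      have ht : 0 < 1 - t := by linarith
      have := width_scale_le ho hc hb (x := t) (s := (1 - x) / (1 - t)) h1
        (div_pos (by linarith) ht) ((div_le_one ht).2 (by linarith))
      have e : 1 + (1 - x) / (1 - t) * (t - 1) = x := by
        field_simp
        ring
      rw [e] at this
      refine le_trans (mul_le_mul_of_nonneg_right ?_ (hw0 t)) this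
      refine (min_le_right _ _).trans ?_
      rw [le_div_iff₀ ht]
      nlinarith

/-- A positive power-concave function on a bounded open convex set is bounded. -/
theorem exists_bound_of_concaveOn_rpow {Ω : Set (ℝ × ℝ)} {φ : ℝ × ℝ → ℝ} {m : ℕ} (hm : 0 < m)
    (ho : IsOpen Ω) (hb : Bornology.IsBounded Ω) (hpos : ∀ z ∈ Ω, 0 < φ z)
    (hf : ConcaveOn ℝ Ω fun z => φ z ^ (1 / (m : ℝ))) : ∃ C, ∀ z ∈ Ω, φ z ≤ C := by
  rcases Ω.eq_empty_or_nonempty with rfl | ⟨z₀, hz₀⟩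
  · exact ⟨0, by simp⟩
  obtain ⟨r, hr, hball⟩ := Metric.isOpen_iff.1 ho z₀ hz₀
  obtain ⟨R, hR0, hR⟩ := hb.subset_ball_lt 0 z₀
  set t := r / R with ht
  have ht0 : 0 < t := by positivity
  refine ⟨((1 + t) / t * φ z₀ ^ (1 / (m : ℝ))) ^ m, fun z hz => ?_⟩
  set w := z₀ - t • (z - z₀) with hw
  have hwΩ : w ∈ Ω := hball <| by
    rw [Metric.mem_ball, hw, dist_eq_norm, sub_sub_cancel_left, norm_neg, norm_smul,
      Real.norm_of_nonneg ht0.le, ← dist_eq_norm]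
    have := Metric.mem_ball.1 (hR hz)
    calc t * dist z z₀ < t * R := by gcongr
      _ = r := div_mul_cancel₀ _ hR0.ne'
  have hcomb : (1 / (1 + t)) • w + (t / (1 + t)) • z = z₀ := by
    have h1 : (1 + t) ≠ 0 := by positivity
    ext <;> simp [hw] <;> field_simp <;> ring
  have h1 := hf.2 hwΩ hz (by positivity : 0 ≤ 1 / (1 + t)) (by positivity : 0 ≤ t / (1 + t))
    (by field_simp)
  rw [hcomb] at h1
  simp only [smul_eq_mul] at h1
  have h2 : 0 ≤ 1 / (1 + t) * φ w ^ (1 / (m : ℝ)) :=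
    mul_nonneg (by positivity) (Real.rpow_nonneg (hpos w hwΩ).le _)
  have h3 : φ z ^ (1 / (m : ℝ)) ≤ (1 + t) / t * φ z₀ ^ (1 / (m : ℝ)) := by
    have h4 : t / (1 + t) * φ z ^ (1 / (m : ℝ)) ≤ φ z₀ ^ (1 / (m : ℝ)) := by linarith
    calc φ z ^ (1 / (m : ℝ)) = (1 + t) / t * (t / (1 + t) * φ z ^ (1 / (m : ℝ))) := by
          field_simp
      _ ≤ _ := by gcongr
  calc φ z = (φ z ^ (1 / (m : ℝ))) ^ m := by
        rw [one_div, Real.rpow_inv_natCast_pow (hpos z hz).le hm.ne']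
    _ ≤ _ := pow_le_pow_left₀ (Real.rpow_nonneg (hpos z hz).le _) h3 m

/-- The coordinates on the Euclidean plane. -/
noncomputable def planeEquiv : EuclideanSpace ℝ (Fin 2) ≃L[ℝ] ℝ × ℝ :=
  (EuclideanSpace.equiv (Fin 2) ℝ).trans (ContinuousLinearEquiv.finTwoArrow ℝ ℝ)

theorem planeEquiv_apply (z : EuclideanSpace ℝ (Fin 2)) : planeEquiv z = (z 0, z 1) := rfl

theorem planeEquiv_symm_apply (w : ℝ × ℝ) : planeEquiv.symm w = !₂[w.1, w.2] := by
  rw [ContinuousLinearEquiv.symm_apply_eq, planeEquiv_apply]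
  simp

theorem measurePreserving_planeEquiv : MeasurePreserving planeEquiv :=
  (volume_preserving_finTwoArrow ℝ).comp
    (EuclideanSpace.volume_preserving_symm_measurableEquiv_toLp (Fin 2))

theorem setIntegral_planeEquiv (Ω : Set (EuclideanSpace ℝ (Fin 2)))
    (F : EuclideanSpace ℝ (Fin 2) → ℝ) :
    ∫ z in Ω, F z = ∫ w in planeEquiv.symm ⁻¹' Ω, F (planeEquiv.symm w) := by
  have h := measurePreserving_planeEquiv.setIntegral_preimage_emb
    planeEquiv.toHomeomorph.measurableEmbedding (fun w => F (planeEquiv.symm w))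
    (planeEquiv.symm ⁻¹' Ω)
  rw [← h, ← preimage_comp]
  simp

theorem norm_eq_sqrt_of_dual (A : EuclideanSpace ℝ (Fin 2) →L[ℝ] ℝ) :
    ‖A‖ ^ 2 = A (planeEquiv.symm (1, 0)) ^ 2 + A (planeEquiv.symm (0, 1)) ^ 2 := by
  set v := (InnerProductSpace.toDual ℝ (EuclideanSpace ℝ (Fin 2))).symm A with hv
  have h1 : ∀ w, A w = inner ℝ v w := fun w => (InnerProductSpace.toDual_symm_apply).symm
  have h2 : ‖A‖ = ‖v‖ := (LinearIsometryEquiv.norm_map _ _).symm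
  rw [h2, EuclideanSpace.norm_sq_eq, Fin.sum_univ_two, h1, h1, planeEquiv_symm_apply,
    planeEquiv_symm_apply]
  simp [PiLp.inner_apply]

theorem gradPow_comp_planeEquiv (p : ℝ) (u : EuclideanSpace ℝ (Fin 2) → ℝ) (w : ℝ × ℝ) :
    gradPow p (fun z => fderiv ℝ (u ∘ planeEquiv.symm) z (1, 0))
      (fun z => fderiv ℝ (u ∘ planeEquiv.symm) z (0, 1)) w =
      ‖fderiv ℝ u (planeEquiv.symm w)‖ ^ p := by
  rw [gradPow, ContinuousLinearEquiv.comp_right_fderiv]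
  simp only [ContinuousLinearMap.comp_apply, ContinuousLinearEquiv.coe_coe]
  rw [← norm_eq_sqrt_of_dual, ← abs_rpow_eq_sq_rpow, abs_of_nonneg (norm_nonneg _)]

theorem etaOmega_eq_iSup_width (Ω : Set (EuclideanSpace ℝ (Fin 2))) :
    etaOmega Ω = ⨆ x, width (planeEquiv.symm ⁻¹' Ω) x := by
  have : ∀ x : ℝ, {y : ℝ | ∃ z ∈ Ω, z 0 = x ∧ z 1 = y} = slice (planeEquiv.symm ⁻¹' Ω) x := by
    intro x
    ext y
    constructor
    · rintro ⟨z, hz, rfl, rfl⟩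
      change planeEquiv.symm (planeEquiv z) ∈ Ω
      rwa [ContinuousLinearEquiv.symm_apply_apply]
    · intro hy
      exact ⟨_, hy, by simp [planeEquiv_symm_apply], by simp [planeEquiv_symm_apply]⟩
  simp only [etaOmega, this]
  rfl

theorem PowConcave.wint_abs_rpow_pos {m : ℕ} {K : Set (ℝ × ℝ)} {φ : ℝ × ℝ → ℝ}
    (h : PowConcave m K φ) {p : ℝ} (hp : 1 < p) {u : ℝ × ℝ → ℝ} (hu : Continuous u)
    (hne : ∃ z ∈ K, u z ≠ 0) : 0 < wint K φ (fun z => |u z| ^ p) := by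
  obtain ⟨z₀, hz₀, hu₀⟩ := hne
  have hnn : ∀ z, 0 ≤ K.indicator φ z * |u z| ^ p := fun z =>
    mul_nonneg (h.indicator_nonneg' z) (by positivity)
  refine (integral_pos_iff_support_of_nonneg hnn (h.integrable_mul (hu.abs_rpow_const hp))).2 ?_
  have ho : IsOpen (K ∩ {z | u z ≠ 0}) := h.isOpen.inter (isOpen_ne_fun hu continuous_const)
  refine (ho.measure_pos volume ⟨z₀, hz₀, hu₀⟩).trans_le (measure_mono ?_)
  rintro z ⟨hz, hz0⟩
  rw [Function.mem_support, indicator_of_mem hz]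
  exact mul_ne_zero (h.pos z hz).ne' (Real.rpow_pos_of_pos (abs_pos.2 hz0) p).ne'

section Transfer

variable {Ω : Set (EuclideanSpace ℝ (Fin 2))} {φ : EuclideanSpace ℝ (Fin 2) → ℝ} {m : ℕ}

theorem powConcave_comp_planeEquiv (hm : 0 < m) (ho : IsOpen Ω) (hc : Convex ℝ Ω)
    (hb : Bornology.IsBounded Ω) (hφ : IsAlphaConcaveOn (1 / m) Ω φ) :
    PowConcave m (planeEquiv.symm ⁻¹' Ω) (φ ∘ planeEquiv.symm) := by
  have ho' : IsOpen (planeEquiv.symm ⁻¹' Ω) := ho.preimage planeEquiv.symm.continuous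
  have hb' : Bornology.IsBounded (planeEquiv.symm ⁻¹' Ω) := by
    rw [← ContinuousLinearEquiv.image_eq_preimage_symm]
    exact planeEquiv.lipschitz.isBounded_image hb
  have hf : ConcaveOn ℝ (planeEquiv.symm ⁻¹' Ω)
      fun z => (φ ∘ planeEquiv.symm) z ^ (1 / (m : ℝ)) :=
    hφ.2.comp_linearMap (planeEquiv.symm : ℝ × ℝ →ₗ[ℝ] EuclideanSpace ℝ (Fin 2))
  have hpos : ∀ z ∈ planeEquiv.symm ⁻¹' Ω, 0 < (φ ∘ planeEquiv.symm) z := fun z hz => hφ.1 _ hz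
  exact ⟨hm, ho', hc.linear_preimage _, hb', hpos, hf,
    exists_bound_of_concaveOn_rpow hm ho' hb' hpos hf⟩

theorem narrowDomain_planeEquiv (ho : IsOpen Ω) (hc : Convex ℝ Ω) (hb : Bornology.IsBounded Ω)
    (hne : Ω.Nonempty) (hdiam : Metric.diam Ω = 1)
    (hseg : segment ℝ (0 : EuclideanSpace ℝ (Fin 2)) (EuclideanSpace.single 0 1) ⊆ closure Ω) :
    NarrowDomain (etaOmega Ω) (planeEquiv.symm ⁻¹' Ω) := by
  have hcl : ∀ z ∈ closure Ω, planeEquiv z ∈ closure (planeEquiv.symm ⁻¹' Ω) := fun z hz => by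
    rw [← ContinuousLinearEquiv.image_eq_preimage_symm]
    exact mem_closure_image planeEquiv.continuous.continuousAt hz
  rw [etaOmega_eq_iSup_width]
  refine narrowDomain_iSup_width (ho.preimage planeEquiv.symm.continuous) (hc.linear_preimage _)
    ?_ ?_ (fun z hz w hw => ?_) ?_ ?_
  · rw [← ContinuousLinearEquiv.image_eq_preimage_symm]
    exact planeEquiv.lipschitz.isBounded_image hb
  · obtain ⟨z, hz⟩ := hne
    exact ⟨planeEquiv z, by simpa using hz⟩
  · have h1 := Metric.dist_le_diam_of_mem hb hz hw
    rw [hdiam, EuclideanSpace.dist_eq, Real.sqrt_le_iff, one_pow, Fin.sum_univ_two,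
      planeEquiv_symm_apply, planeEquiv_symm_apply] at h1
    simpa [Real.dist_eq, sq_abs] using h1.2
  · simpa [planeEquiv_apply] using hcl _ (hseg (left_mem_segment ℝ _ _))
  · simpa [planeEquiv_apply] using hcl _ (hseg (right_mem_segment ℝ _ _))

end Transfer

/-- Lemma 5.1, quantitative inequality for narrow planar convex sets:
there are explicit constants `η₀ = η₀(p,m) > 0` and `c = c(p,m) > 0` such that every open
bounded convex `Ω ⊂ ℝ²` with diameter one, positioned so that `[0,1]×{0}` is a diameter,
with `η_Ω ≤ η₀`, and every positive `(1/m)`-concave weight `φ` on `Ω`, satisfy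
`μ_p(Ω,φ) ≥ π_p^p + c η_Ω²`. -/
theorem stmt15 (p : ℝ) (hp : 1 < p) (m : ℕ) (hm : 0 < m) :
    ∃ η₀ c : ℝ, 0 < η₀ ∧ 0 < c ∧
      ∀ (Ω : Set (EuclideanSpace ℝ (Fin 2))) (φ : EuclideanSpace ℝ (Fin 2) → ℝ),
        IsOpen Ω → Convex ℝ Ω → Bornology.IsBounded Ω → Ω.Nonempty →
        Metric.diam Ω = 1 →
        segment ℝ (0 : EuclideanSpace ℝ (Fin 2)) (EuclideanSpace.single 0 1) ⊆ closure Ω →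
        etaOmega Ω ≤ η₀ →
        IsAlphaConcaveOn (1 / m) Ω φ →
        muP p Ω φ ≥ piP p ^ p + c * etaOmega Ω ^ 2 := by
  obtain ⟨η₀, c, hη₀, hc0, hmain⟩ := exists_narrow_inequality hp m
  refine ⟨η₀, c, hη₀, hc0, fun Ω φ ho hc hb hne hdiam hseg hη hφ => ?_⟩
  have hK := powConcave_comp_planeEquiv hm ho hc hb hφ
  have hN := narrowDomain_planeEquiv ho hc hb hne hdiam hseg
  set K := planeEquiv.symm ⁻¹' Ω with hKdef
  set ψ := φ ∘ planeEquiv.symm with hψ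
  have hKne : K.Nonempty := by
    obtain ⟨z, hz⟩ := hne
    exact ⟨planeEquiv z, by simpa [hKdef] using hz⟩
  have hπ : 0 < piP p ^ p := Real.rpow_pos_of_pos (piP_pos hp) p
  have htr : ∀ F : EuclideanSpace ℝ (Fin 2) → ℝ,
      ∫ z in Ω, φ z * F z = wint K ψ (F ∘ planeEquiv.symm) := fun F => by
    rw [setIntegral_planeEquiv]
    exact hK.setIntegral_eq (F ∘ planeEquiv.symm)
  have hmeaneq : ∀ u : EuclideanSpace ℝ (Fin 2) → ℝ, ∫ x in Ω, φ x * |u x| ^ (p - 2) * u x =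
      wint K ψ (fun z => sgnPow p (u (planeEquiv.symm z))) := fun u => by
    simp only [mul_assoc]
    exact htr fun x => sgnPow p (u x)
  refine le_csInf ?_ ?_
  · obtain ⟨κ, -, hκ⟩ := hK.exists_sub_const_mean_eq_zero hp continuous_fst (R := 1) zero_le_one
      fun z hz => abs_le.2 ⟨by linarith [(hN.fst_mem z hz).1], (hN.fst_mem z hz).2.le⟩
    refine ⟨_, fun z => z 0 - κ, 1, ?_, ?_, ?_, rfl⟩
    · refine LipschitzWith.of_dist_le_mul fun z w => ?_
      rw [NNReal.coe_one, one_mul, Real.dist_eq, sub_sub_sub_cancel_right, dist_eq_norm]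
      exact PiLp.norm_apply_le (z - w) 0
    · intro hae
      have hcont : Continuous fun z : EuclideanSpace ℝ (Fin 2) => z 0 - κ := by fun_prop
      have hzero : EqOn (fun z : EuclideanSpace ℝ (Fin 2) => z 0 - κ) (fun _ => 0) Ω :=
        Measure.eqOn_open_of_ae_eq hae ho hcont.continuousOn continuousOn_const
      obtain ⟨z, hz⟩ := hKne
      have hopen : IsOpen (Prod.fst '' K) := isOpenMap_fst K hK.isOpen
      have hsub : Prod.fst '' K ⊆ {κ} := by
        rintro _ ⟨w, hw, rfl⟩
        have := hzero hw
        simp only [planeEquiv_symm_apply] at this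
        simpa [sub_eq_zero] using this
      have := hopen.measure_pos volume ⟨_, z, hz, rfl⟩
      exact this.ne' (measure_mono_null hsub (by simp))
    · rw [hmeaneq]
      simpa [planeEquiv_symm_apply] using hκ
  · rintro r ⟨u, L, hu, hnz, hmean, rfl⟩
    rw [hmeaneq] at hmean
    have hlip := hu.comp planeEquiv.symm.lipschitz
    have hex : ∃ z ∈ K, (u ∘ planeEquiv.symm) z ≠ 0 := by
      by_contra! hall
      refine hnz ((ae_restrict_iff' ho.measurableSet).2 (.of_forall fun x hx => ?_))
      simpa using hall (planeEquiv x) (by simpa [hKdef] using hx)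
    have hden := hK.wint_abs_rpow_pos hp hlip.continuous hex
    have hineq := hK.lipschitz_inequality hp (Λ := piP p ^ p + c * etaOmega Ω ^ 2) (by positivity)
      (fun v vx vy hv hv0 => hmain _ K ψ v vx vy hN hK hKne hη hv hv0) hlip hmean
    rw [htr, htr]
    refine (le_div_iff₀ hden).2 (hineq.trans_eq (congrArg _ (funext fun w => ?_)))
    exact gradPow_comp_planeEquiv p u w
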